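/- arXiv:1002.5028 — 4 statements merged into one kernel-verified Lean document; each statement's English description precedes it below -/
import Mathlib

section
/- Let d ≥ 1 and k ≥ 1, and let V = {v_1,…,v_n} be a multiset of vectors in ℝ^d with the property that for every affine hyperplane H ⊂ ℝ^d, at least k indices i satisfy dist(v_i, H) ≥ 1. Let ξ_1,…,ξ_n be i.i.d. Rademacher random variables and X_V = Σ ξ_i v_i. Then for any closed ball B of radius 1, P(X_V ∈ B) = O_d(k^{−d/2}), with the implied constant depending only on d (not on k or n). -/
open scoped RealInnerProductSpace
open MeasureTheory ProbabilityTheory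

lemma cb_bound (q : ℕ) : (2*q+1) * (q.centralBinom)^2 ≤ 16^q := by
  induction q with
  | zero => simp
  | succ n ih =>
    have h := Nat.succ_mul_centralBinom_succ n
    have h2 : (n+1)^2 * ((2*(n+1)+1) * ((n+1).centralBinom)^2) ≤ (n+1)^2 * 16^(n+1) := by
      calc (n+1)^2 * ((2*(n+1)+1) * ((n+1).centralBinom)^2)
          = (2*(n+1)+1) * ((n+1) * (n+1).centralBinom)^2 := by ring
        _ = (2*(n+1)+1) * (4 * (2*n+1)) * ((2*n+1) * n.centralBinom^2) := by rw [h]; ring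
        _ ≤ (2*(n+1)+1) * (4 * (2*n+1)) * 16^n := by gcongr
        _ ≤ (16 * (n+1)^2) * 16^n := Nat.mul_le_mul_right _ (by nlinarith)
        _ = _ := by ring
    exact Nat.le_of_mul_le_mul_left h2 (by positivity)

lemma cb_bound' (q : ℕ) : (q.centralBinom : ℝ) / 4^q ≤ 1 / √(2*q+1) := by
  have h : ((2*q+1) * (q.centralBinom)^2 : ℝ) ≤ 16^q := by exact_mod_cast cb_bound q
  rw [div_le_div_iff₀ (by positivity) (by positivity), one_mul]
  have : (q.centralBinom : ℝ) * √(2*q+1) = √((2*q+1) * (q.centralBinom)^2) := by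
    rw [Real.sqrt_mul (by positivity), Real.sqrt_sq (by positivity), mul_comm]
  rw [this]
  apply Real.sqrt_le_iff.2 ⟨by positivity, ?_⟩
  rw [← pow_mul, mul_comm q 2, pow_mul]; norm_num; exact h

lemma sum_bd : ∃ K : ℝ, 1 ≤ K ∧ ∀ q : ℕ,
    ∑ j ∈ Finset.range (2*q+1), Real.exp (-2*((j:ℝ)-q)^2) ≤ K := by
  have hs : Summable (fun l : ℤ => Real.exp (-2*(l:ℝ)^2)) := by
    have hn : Summable (fun l : ℕ => Real.exp (-2*(l:ℝ)^2)) := by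
      have := Real.summable_exp_nat_mul_iff.2 (show (-2:ℝ) < 0 by norm_num)
      refine Summable.of_nonneg_of_le (fun _ => by positivity) (fun l => ?_) this
      apply Real.exp_le_exp.2
      have : (l:ℝ) ≤ (l:ℝ)^2 := by exact_mod_cast Nat.le_self_pow (by norm_num) l
      nlinarith
    apply Summable.of_nat_of_neg <;> simpa using hn
  refine ⟨max 1 (∑' l : ℤ, Real.exp (-2*(l:ℝ)^2)), le_max_left _ _, fun q => le_trans ?_ (le_max_right _ _)⟩
  have hinj : Function.Injective (fun j : ℕ => (j:ℤ) - q) := by intro a b h; simpa using h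
  calc _ = ∑ l ∈ (Finset.range (2*q+1)).map ⟨_, hinj⟩, Real.exp (-2*(l:ℝ)^2) := by
        rw [Finset.sum_map]; simp
    _ ≤ _ := hs.sum_le_tsum _ (fun _ _ => by positivity)

lemma cos_pow_eq (q : ℕ) (y : ℝ) : ((Real.cos y ^ (2*q) : ℝ) : ℂ) =
    ∑ j ∈ Finset.range (2*q+1), (((2*q).choose j : ℝ) / 4^q : ℝ) *
      Complex.exp ((2*((j:ℝ)-q) * y : ℝ) * Complex.I) := by
  push_cast
  rw [Complex.cos, div_pow, add_pow, Finset.sum_div]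
  refine Finset.sum_congr rfl fun j hj => ?_
  have hj' : j ≤ 2*q := by simpa [Nat.lt_succ_iff] using hj
  rw [← Complex.exp_nat_mul, ← Complex.exp_nat_mul, ← Complex.exp_add, pow_mul]
  rw [Nat.cast_sub hj']
  push_cast
  norm_num
  rw [show (j:ℂ) * (y * Complex.I) + -((2*q - j) * (y * Complex.I)) = 2 * (j-q) * y * Complex.I by ring]
  ring

lemma one_dim : ∃ K : ℝ, 1 ≤ K ∧ ∀ (q : ℕ) (L c : ℝ), 1 ≤ |L| →
    ∫ s, Real.cos (c + s * L) ^ (2*q) ∂(gaussianReal 0 1) ≤ K / √(2*q+1) := by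
  obtain ⟨K, hK, hb⟩ := sum_bd
  refine ⟨K, hK, fun q L c hL => ?_⟩
  have h1 : ((∫ s, Real.cos (c + s * L) ^ (2*q) ∂(gaussianReal 0 1) : ℝ) : ℂ) =
      ∑ j ∈ Finset.range (2*q+1), (((2*q).choose j : ℝ) / 4^q : ℝ) *
      (Complex.exp ((2*((j:ℝ)-q) * c : ℝ) * Complex.I) * Complex.exp ((-(2*((j:ℝ)-q) * L)^2/2 : ℝ))) := by
    rw [← integral_complex_ofReal]
    simp_rw [cos_pow_eq]
    rw [integral_finsetSum]
    · refine Finset.sum_congr rfl fun j hj => ?_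
      rw [integral_const_mul]
      congr 1
      have := charFun_gaussianReal (μ := 0) (v := 1) (2*((j:ℝ)-q) * L)
      rw [charFun_apply_real] at this
      have h3 : ∀ s : ℝ, Complex.exp ((2*((j:ℝ)-q) * (c + s * L) : ℝ) * Complex.I) =
        Complex.exp ((2*((j:ℝ)-q) * c : ℝ) * Complex.I) *
        Complex.exp (((2*((j:ℝ)-q) * L : ℝ)) * s * Complex.I) := by
        intro s; rw [← Complex.exp_add]; congr 1; push_cast; ring
      simp_rw [h3]
      rw [integral_const_mul, this]
      congr 2
      push_cast; ring
    · intro j hj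
      apply Integrable.const_mul
      apply Integrable.of_bound (C := 1)
      · apply Continuous.aestronglyMeasurable; fun_prop
      · filter_upwards with s
        rw [Complex.norm_exp_ofReal_mul_I]
  have h2 : ∫ s, Real.cos (c + s * L) ^ (2*q) ∂(gaussianReal 0 1) ≤
     ∑ j ∈ Finset.range (2*q+1), ((q.centralBinom : ℝ) / 4^q) * Real.exp (-2*((j:ℝ)-q)^2) := by
    refine le_trans (le_abs_self _) ?_
    rw [← Real.norm_eq_abs, ← Complex.norm_real, h1]
    refine le_trans (norm_sum_le _ _) (Finset.sum_le_sum fun j hj => ?_)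
    rw [norm_mul, norm_mul, Complex.norm_exp_ofReal_mul_I, one_mul, Complex.norm_real, ← Complex.ofReal_exp, Complex.norm_real, Real.norm_of_nonneg (by positivity), Real.norm_of_nonneg (by positivity)]
    gcongr
    · exact_mod_cast Nat.choose_le_centralBinom j q
    · have : 1 ≤ L^2 := by rw [← sq_abs]; nlinarith
      nlinarith [sq_nonneg ((j:ℝ)-q)]
  refine h2.trans ?_
  rw [← Finset.mul_sum]
  calc _ ≤ (1 / √(2*q+1)) * K := by
        exact mul_le_mul (cb_bound' q) (hb q) (Finset.sum_nonneg fun _ _ => by positivity) (by positivity)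
    _ = _ := by ring


lemma gauss_split {d : ℕ} (e : EuclideanSpace ℝ (Fin d)) (he : ‖e‖ = 1) :
    ((stdGaussian (EuclideanSpace ℝ (Fin d))).prod (gaussianReal 0 1)).map
      (fun p => (p.1 - ⟪e, p.1⟫ • e) + p.2 • e) = stdGaussian (EuclideanSpace ℝ (Fin d)) := by
  have : IsProbabilityMeasure (((stdGaussian (EuclideanSpace ℝ (Fin d))).prod (gaussianReal 0 1)).map
      (fun p => (p.1 - ⟪e, p.1⟫ • e) + p.2 • e)) :=
    Measure.isProbabilityMeasure_map (by fun_prop)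
  apply Measure.ext_of_charFun
  ext x
  rw [charFun_stdGaussian, charFun_apply, integral_map (by fun_prop) (by apply Continuous.aestronglyMeasurable; fun_prop)]
  have h : ∀ p : EuclideanSpace ℝ (Fin d) × ℝ,
      Complex.exp ((⟪(p.1 - ⟪e, p.1⟫ • e) + p.2 • e, x⟫ : ℝ) * Complex.I) =
      Complex.exp ((⟪p.1, x - ⟪e, x⟫ • e⟫ : ℝ) * Complex.I) * 
        Complex.exp ((⟪e, x⟫ : ℝ) * (p.2 : ℝ) * Complex.I) := by
    intro p
    rw [← Complex.exp_add]
    congr 1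
    simp only [inner_add_left, inner_sub_left, inner_sub_right, real_inner_smul_left, real_inner_smul_right]
    rw [real_inner_comm e p.1]
    push_cast; ring
  simp_rw [h]
  rw [integral_prod_mul (fun t : EuclideanSpace ℝ (Fin d) => Complex.exp ((⟪t, x - ⟪e, x⟫ • e⟫ : ℝ) * Complex.I)) (fun s : ℝ => Complex.exp ((⟪e, x⟫ : ℝ) * s * Complex.I))]
  rw [← charFun_apply, ← charFun_apply_real, charFun_stdGaussian, charFun_gaussianReal, ← Complex.exp_add]
  congr 1
  have : ‖x - ⟪e, x⟫ • e‖^2 = ‖x‖^2 - ⟪e,x⟫^2 := by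
    rw [norm_sub_sq_real, norm_smul, real_inner_smul_right, he, real_inner_comm x e, mul_one, Real.norm_eq_abs, sq_abs]
    ring
  have h2 : ((‖x - ⟪e, x⟫ • e‖:ℂ))^2 = ‖x‖^2 - (⟪e,x⟫:ℝ)^2 := by exact_mod_cast this
  rw [h2]
  push_cast; ring

lemma gauss_step {d : ℕ} (e w : EuclideanSpace ℝ (Fin d)) (he : ‖e‖ = 1)
    (F : EuclideanSpace ℝ (Fin d) → ℝ) (hF : Continuous F) (hF0 : ∀ t, 0 ≤ F t) (hF1 : ∀ t, F t ≤ 1)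
    (hinv : ∀ t (s:ℝ), F (t + s • e) = F t) (q : ℕ) (A : ℝ)
    (hA : ∀ c : ℝ, ∫ s, Real.cos (c + s * ⟪e, w⟫) ^ (2*q) ∂(gaussianReal 0 1) ≤ A) :
    ∫ t, F t * Real.cos ⟪t, w⟫ ^ (2*q) ∂(stdGaussian (EuclideanSpace ℝ (Fin d))) ≤
      A * ∫ t, F t ∂(stdGaussian (EuclideanSpace ℝ (Fin d))) := by
  have hc : ∀ y : ℝ, |Real.cos y ^ (2*q)| ≤ 1 := fun y => by
    rw [abs_pow]; exact pow_le_one₀ (abs_nonneg _) (Real.abs_cos_le_one y)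
  have hinv' : ∀ p : EuclideanSpace ℝ (Fin d) × ℝ, F ((p.1 - ⟪e, p.1⟫ • e) + p.2 • e) = F p.1 := by
    intro p; rw [hinv, sub_eq_add_neg, ← neg_smul, hinv]
  have h2 : ∀ p : EuclideanSpace ℝ (Fin d) × ℝ, ⟪(p.1 - ⟪e, p.1⟫ • e) + p.2 • e, w⟫ =
      ⟪p.1 - ⟪e, p.1⟫ • e, w⟫ + p.2 * ⟪e, w⟫ := by
    intro p; rw [inner_add_left, real_inner_smul_left]
  conv_lhs => rw [← gauss_split e he]
  rw [integral_map (by fun_prop) (by apply Continuous.aestronglyMeasurable; fun_prop)]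
  simp_rw [hinv', h2]
  rw [integral_prod]
  · simp_rw [integral_const_mul]
    rw [← integral_const_mul]
    apply integral_mono_of_nonneg
    · filter_upwards with t
      apply mul_nonneg (hF0 t)
      apply integral_nonneg
      intro s
      simp only [Pi.zero_apply]
      rw [pow_mul]; positivity
    · apply Integrable.const_mul
      apply Integrable.of_bound (C := 1) hF.aestronglyMeasurable
      filter_upwards with t
      rw [Real.norm_of_nonneg (hF0 t)]; exact hF1 t
    · filter_upwards with t
      rw [mul_comm A]
      exact mul_le_mul_of_nonneg_left (hA _) (hF0 t)
  · apply Integrable.of_bound (C := 1)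
    · apply Continuous.aestronglyMeasurable; fun_prop
    · filter_upwards with p
      rw [norm_mul, Real.norm_of_nonneg (hF0 _)]
      exact mul_le_one₀ (hF1 _) (norm_nonneg _) (hc _)

lemma gauss_iter {d : ℕ} (q : ℕ) (A : ℝ) (hA0 : 0 ≤ A)
    (hA : ∀ L c : ℝ, 1 ≤ |L| → ∫ s, Real.cos (c + s * L) ^ (2*q) ∂(gaussianReal 0 1) ≤ A)
    (J : ℕ) : ∀ (w e : Fin J → EuclideanSpace ℝ (Fin d)), (∀ j, ‖e j‖ = 1) →
      (∀ i j, i < j → ⟪e j, w i⟫ = 0) → (∀ j, 1 ≤ |⟪e j, w j⟫|) →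
    ∫ t, ∏ j, Real.cos ⟪t, w j⟫ ^ (2*q) ∂(stdGaussian (EuclideanSpace ℝ (Fin d))) ≤ A ^ J := by
  induction J with
  | zero => intro w e _ _ _; simp
  | succ J ih =>
    intro w e h1 h2 h3
    simp_rw [Fin.prod_univ_castSucc]
    refine (gauss_step (e (Fin.last J)) (w (Fin.last J)) (h1 _)
      (fun t => ∏ j : Fin J, Real.cos ⟪t, w j.castSucc⟫ ^ (2*q)) (by fun_prop) ?_ ?_ ?_ q A
      (fun c => hA _ c (h3 _))).trans ?_
    · intro t; exact Finset.prod_nonneg fun j _ => by rw [pow_mul]; positivity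
    · intro t
      refine Finset.prod_le_one (fun j _ => by rw [pow_mul]; positivity) fun j _ => ?_
      rw [pow_mul]
      exact pow_le_one₀ (by positivity) (Real.cos_sq_le_one _)
    · intro t s
      refine Finset.prod_congr rfl fun j _ => ?_
      rw [inner_add_left, real_inner_smul_left, h2 _ _ (Fin.castSucc_lt_last j)]; simp
    · rw [pow_succ, mul_comm]
      gcongr
      exact ih (fun j => w j.castSucc) (fun j => e j.castSucc) (fun j => h1 _)
        (fun i j hij => h2 _ _ (by simpa using hij)) (fun j => h3 _)


lemma exists_unit_perp {d J : ℕ} (hJ : J < d) (w : Fin J → EuclideanSpace ℝ (Fin d)) :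
    ∃ e : EuclideanSpace ℝ (Fin d), ‖e‖ = 1 ∧ ∀ i, ⟪e, w i⟫ = 0 := by
  set S := Submodule.span ℝ (Set.range w) with hS
  have h1 : Module.finrank ℝ S ≤ J := by
    simpa [Set.finrank] using finrank_range_le_card (R := ℝ) w
  have h2 : Sᗮ ≠ ⊥ := by
    intro h
    rw [Submodule.orthogonal_eq_bot_iff] at h
    rw [h, finrank_top] at h1
    simp at h1; omega
  obtain ⟨x, hx, hx0⟩ := Submodule.exists_mem_ne_zero_of_ne_bot h2
  refine ⟨‖x‖⁻¹ • x, by simp [norm_smul, hx0], fun i => ?_⟩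
  rw [real_inner_smul_left, real_inner_comm, (Submodule.mem_orthogonal S x).1 hx (w i) (Submodule.subset_span ⟨i, rfl⟩), mul_zero]

lemma greedy {d k n : ℕ} (v : Fin n → EuclideanSpace ℝ (Fin d))
    (hv : ∀ (a : EuclideanSpace ℝ (Fin d)) (c : ℝ), a ≠ 0 →
        k ≤ Nat.card {i : Fin n //
          1 ≤ Metric.infDist (v i) {x : EuclideanSpace ℝ (Fin d) | ⟪a, x⟫ = c}})
    (S : Finset (Fin n)) (J : ℕ) : J ≤ d → S.card + J ≤ k →
    ∃ (f : Fin J → Fin n) (e : Fin J → EuclideanSpace ℝ (Fin d)), Function.Injective f ∧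
      (∀ j, f j ∉ S) ∧ (∀ j, ‖e j‖ = 1) ∧ (∀ i j, i < j → ⟪e j, v (f i)⟫ = 0) ∧
      (∀ j, 1 ≤ |⟪e j, v (f j)⟫|) := by
  induction J with
  | zero => 
    intro _ _
    exact ⟨Fin.elim0, Fin.elim0, fun i => i.elim0, fun i => i.elim0, fun i => i.elim0, fun i => i.elim0, fun i => i.elim0⟩
  | succ J ih =>
    intro hJ hk
    obtain ⟨f, e, hf, hfS, he, hperp, hbig⟩ := ih (by omega) (by omega)
    obtain ⟨a, ha, hap⟩ := exists_unit_perp (show J < d by omega) (fun i => v (f i))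
    have ha0 : a ≠ 0 := by rintro rfl; simp at ha
    have hcard := hv a 0 ha0
    classical
    rw [Nat.card_eq_fintype_card, Fintype.card_subtype] at hcard
    obtain ⟨i, hi, hi2⟩ := Finset.exists_mem_notMem_of_card_lt_card
      (s := S ∪ Finset.univ.image f) (t := Finset.univ.filter fun i : Fin n =>
          1 ≤ Metric.infDist (v i) {x : EuclideanSpace ℝ (Fin d) | ⟪a, x⟫ = 0}) (by
        have h1 := Finset.card_union_le S (Finset.univ.image f)
        have h2 : (Finset.univ.image f).card ≤ J := by simpa using Finset.card_image_le (s := Finset.univ) (f := f)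
        omega)
    simp only [Finset.mem_filter, Finset.mem_univ, true_and] at hi
    simp only [Finset.mem_union, Finset.mem_image, Finset.mem_univ, true_and, not_or, not_exists] at hi2
    have hia : 1 ≤ |⟪a, v i⟫| := by
      refine hi.trans ((Metric.infDist_le_dist_of_mem (y := v i - ⟪a, v i⟫ • a) ?_).trans ?_)
      · simp [inner_sub_right, real_inner_smul_right, ha]
      · simp [norm_smul, ha]
    refine ⟨Fin.snoc f i, Fin.snoc e a, ?_, ?_, ?_, ?_, ?_⟩
    · rw [Fin.snoc_injective_iff]
      exact ⟨hf, by rintro ⟨j, hj⟩; exact hi2.2 j hj⟩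
    · intro j; refine Fin.lastCases ?_ (fun j => ?_) j
      · simpa using hi2.1
      · simpa using hfS j
    · intro j; refine Fin.lastCases ?_ (fun j => ?_) j
      · simpa using ha
      · simpa using he j
    · intro l j; refine Fin.lastCases ?_ (fun j => ?_) j <;> refine Fin.lastCases ?_ (fun l => ?_) l
      · simp
      · intro _; simpa using hap l
      · intro h; exact absurd h (by simp [Fin.le_last])
      · intro h; simpa using hperp l j (by simpa using h)
    · intro j; refine Fin.lastCases ?_ (fun j => ?_) j
      · simpa using hia
      · simpa using hbig j

lemma greedy2 {d k n : ℕ} (v : Fin n → EuclideanSpace ℝ (Fin d))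
    (hv : ∀ (a : EuclideanSpace ℝ (Fin d)) (c : ℝ), a ≠ 0 →
        k ≤ Nat.card {i : Fin n //
          1 ≤ Metric.infDist (v i) {x : EuclideanSpace ℝ (Fin d) | ⟪a, x⟫ = c}})
    (N : ℕ) : N * d ≤ k →
    ∃ (f : Fin N → Fin d → Fin n), Function.Injective (fun p : Fin N × Fin d => f p.1 p.2) ∧
      ∀ b, ∃ e : Fin d → EuclideanSpace ℝ (Fin d), (∀ j, ‖e j‖ = 1) ∧ (∀ i j, i < j → ⟪e j, v (f b i)⟫ = 0) ∧
      (∀ j, 1 ≤ |⟪e j, v (f b j)⟫|) := by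
  induction N with
  | zero => intro _; exact ⟨Fin.elim0, fun p => p.1.elim0, fun b => b.elim0⟩
  | succ N ih =>
    intro hN
    rw [Nat.succ_mul] at hN
    obtain ⟨f, hf, hgood⟩ := ih (by omega)
    obtain ⟨g, e, hg, hgS, h1, h2, h3⟩ := greedy v hv
      (Finset.univ.image (fun p : Fin N × Fin d => f p.1 p.2)) d le_rfl (by
        have := Finset.card_image_le (s := Finset.univ) (f := (fun p : Fin N × Fin d => f p.1 p.2))
        simp at this; omega)
    simp only [Finset.mem_image, Finset.mem_univ, true_and, not_exists, Prod.forall] at hgS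
    refine ⟨Fin.snoc f g, ?_, ?_⟩
    · rintro ⟨b, j⟩ ⟨b', j'⟩
      refine Fin.lastCases ?_ (fun b => ?_) b <;> refine Fin.lastCases ?_ (fun b' => ?_) b'
      · simp only [Fin.snoc_last]; intro h; rw [hg h]
      · simp only [Fin.snoc_last, Fin.snoc_castSucc]; intro h; exact absurd h.symm (hgS _ _ _)
      · simp only [Fin.snoc_last, Fin.snoc_castSucc]; intro h; exact absurd h (hgS _ _ _)
      · simp only [Fin.snoc_castSucc]; intro h
        have := hf (a₁ := (b, j)) (a₂ := (b', j')) h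
        simp only [Prod.mk.injEq] at this
        rw [this.1, this.2]
    · intro b; refine Fin.lastCases ?_ (fun b => ?_) b
      · simp only [Fin.snoc_last]; exact ⟨e, h1, h2, h3⟩
      · simp only [Fin.snoc_castSucc]; exact hgood b

lemma amgm {N : ℕ} (hN : 0 < N) (F : Fin N → ℝ) (hF : ∀ b, 0 ≤ F b) :
    ∏ b, F b ≤ ∑ b, (1/(N:ℝ)) * F b ^ N := by
  have hN' : (N:ℝ) ≠ 0 := by positivity
  have := Real.geom_mean_le_arith_mean_weighted Finset.univ (fun _ : Fin N => 1/(N:ℝ)) (fun b => F b ^ N)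
    (fun _ _ => by positivity) (by simp [hN']) (fun b _ => pow_nonneg (hF b) _)
  refine le_trans (le_of_eq ?_) this
  refine Finset.prod_congr rfl fun b _ => ?_
  rw [← Real.rpow_natCast, ← Real.rpow_mul (hF b)]
  simp [hN']

lemma fourier_bd {d n : ℕ} (v : Fin n → EuclideanSpace ℝ (Fin d)) (x : EuclideanSpace ℝ (Fin d)) :
    (((PMF.uniformOfFintype (Fin n → Bool)).toMeasure
          {ω | (∑ j, (if ω j then (1 : ℝ) else -1) • v j) ∈ Metric.closedBall x 1}).toReal)
     ≤ Real.exp (1/2) * ∫ t, ∏ i, |Real.cos ⟪t, v i⟫| ∂(stdGaussian (EuclideanSpace ℝ (Fin d))) := by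
  classical
  set X : (Fin n → Bool) → EuclideanSpace ℝ (Fin d) := fun ω => ∑ j, (if ω j then (1 : ℝ) else -1) • v j with hX
  have h1 : (((PMF.uniformOfFintype (Fin n → Bool)).toMeasure
          {ω | X ω ∈ Metric.closedBall x 1}).toReal)
      = ∑ ω, (if X ω ∈ Metric.closedBall x 1 then ((2:ℝ)^n)⁻¹ else 0) := by
    rw [PMF.toMeasure_apply_fintype, ENNReal.toReal_sum]
    · refine Finset.sum_congr rfl fun ω _ => ?_
      simp only [Set.indicator_apply, Set.mem_setOf_eq]
      split_ifs <;> simp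
    · intro ω _
      simp only [Set.indicator_apply]
      split_ifs <;> simp
  have h2 : (((PMF.uniformOfFintype (Fin n → Bool)).toMeasure
          {ω | X ω ∈ Metric.closedBall x 1}).toReal)
      ≤ Real.exp (1/2) * ∑ ω, ((2:ℝ)^n)⁻¹ * Real.exp (-‖X ω - x‖^2/2) := by
    rw [h1, Finset.mul_sum]
    refine Finset.sum_le_sum fun ω _ => ?_
    split_ifs with h
    · rw [mem_closedBall_iff_norm] at h
      rw [mul_left_comm, ← Real.exp_add]
      have : 1 ≤ Real.exp (1/2 + -‖X ω - x‖^2/2) := by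
        apply Real.one_le_exp
        nlinarith [norm_nonneg (X ω - x)]
      exact le_mul_of_one_le_right (by positivity) this
    · positivity
  refine h2.trans ?_
  gcongr
  have h3 : ((∑ ω, ((2:ℝ)^n)⁻¹ * Real.exp (-‖X ω - x‖^2/2) : ℝ) : ℂ) =
      ∫ t, Complex.exp ((-⟪t, x⟫ : ℝ) * Complex.I) * ((∏ i, Real.cos ⟪t, v i⟫ : ℝ) : ℂ)
        ∂(stdGaussian (EuclideanSpace ℝ (Fin d))) := by
    have h4 : ∀ t : EuclideanSpace ℝ (Fin d), Complex.exp ((-⟪t, x⟫ : ℝ) * Complex.I) * ((∏ i, Real.cos ⟪t, v i⟫ : ℝ) : ℂ)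
        = ∑ ω, ((2:ℂ)^n)⁻¹ * Complex.exp ((⟪t, X ω - x⟫ : ℝ) * Complex.I) := by
      intro t
      have h5 : ∀ i, ((Real.cos ⟪t, v i⟫ : ℝ) : ℂ) = ∑ b : Bool, (2:ℂ)⁻¹ *
          Complex.exp (((if b then (1:ℝ) else -1) * ⟪t, v i⟫ : ℝ) * Complex.I) := by
        intro i
        rw [Complex.ofReal_cos, Complex.cos]
        simp
        ring
      push_cast
      simp_rw [← Complex.ofReal_cos, h5]
      rw [Fintype.prod_sum, Finset.mul_sum]
      refine Finset.sum_congr rfl fun ω _ => ?_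
      rw [Finset.prod_mul_distrib, ← Complex.exp_sum, mul_left_comm, ← Complex.exp_add]
      simp only [Finset.prod_const, Finset.card_univ, Fintype.card_fin, inv_pow]
      congr 2
      rw [← Finset.sum_mul, ← add_mul]
      congr 1
      rw [inner_sub_right, hX, inner_sum]
      simp only [real_inner_smul_right]
      push_cast
      ring
    simp_rw [h4]
    rw [integral_finsetSum]
    · push_cast
      refine Finset.sum_congr rfl fun ω _ => ?_
      rw [integral_const_mul, ← charFun_apply, charFun_stdGaussian]
    · intro ω _
      apply Integrable.const_mul
      apply Integrable.of_bound (C := 1)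
      · apply Continuous.aestronglyMeasurable; fun_prop
      · filter_upwards with s
        rw [Complex.norm_exp_ofReal_mul_I]
  refine le_trans (le_abs_self _) ?_
  rw [← Real.norm_eq_abs, ← Complex.norm_real, h3]
  refine (norm_integral_le_integral_norm _).trans (le_of_eq ?_)
  congr 1
  ext t
  rw [norm_mul, Complex.norm_exp_ofReal_mul_I, one_mul, Complex.norm_real, Real.norm_eq_abs, Finset.abs_prod]


lemma prod_sub {d n N : ℕ} (c : Fin n → ℝ) (h0 : ∀ i, 0 ≤ c i) (h1 : ∀ i, c i ≤ 1)
    (f : Fin N → Fin d → Fin n) (hf : Function.Injective (fun p : Fin N × Fin d => f p.1 p.2)) :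
    ∏ i, c i ≤ ∏ b, ∏ j, c (f b j) := by
  classical
  rw [← Fintype.prod_prod_type' (fun b j => c (f b j))]
  rw [← Finset.prod_image (f := c) (g := fun p : Fin N × Fin d => f p.1 p.2) (s := Finset.univ) (fun a _ b _ h => hf h)]
  rw [← Finset.prod_mul_prod_compl (Finset.univ.image (fun p : Fin N × Fin d => f p.1 p.2)) c]
  exact mul_le_of_le_one_right (Finset.prod_nonneg fun i _ => h0 i)
    (Finset.prod_le_one (fun i _ => h0 i) (fun i _ => h1 i))

lemma main_int {d k n : ℕ} (v : Fin n → EuclideanSpace ℝ (Fin d))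
    (hv : ∀ (a : EuclideanSpace ℝ (Fin d)) (c : ℝ), a ≠ 0 →
        k ≤ Nat.card {i : Fin n //
          1 ≤ Metric.infDist (v i) {x : EuclideanSpace ℝ (Fin d) | ⟪a, x⟫ = c}})
    (q : ℕ) (hq : 0 < q) (hqk : 2 * q * d ≤ k) (A : ℝ) (hA0 : 0 ≤ A)
    (hA : ∀ L c : ℝ, 1 ≤ |L| → ∫ s, Real.cos (c + s * L) ^ (2*q) ∂(gaussianReal 0 1) ≤ A) :
    ∫ t, ∏ i, |Real.cos ⟪t, v i⟫| ∂(stdGaussian (EuclideanSpace ℝ (Fin d))) ≤ A ^ d := by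
  obtain ⟨f, hf, hgood⟩ := greedy2 v hv (2*q) hqk
  have hpt : ∀ t : EuclideanSpace ℝ (Fin d), ∏ i, |Real.cos ⟪t, v i⟫| ≤
      ∑ b : Fin (2*q), (1/((2*q : ℕ):ℝ)) * ∏ j, Real.cos ⟪t, v (f b j)⟫ ^ (2*q) := by
    intro t
    refine (prod_sub (fun i => |Real.cos ⟪t, v i⟫|) (fun _ => abs_nonneg _)
      (fun _ => Real.abs_cos_le_one _) f hf).trans ?_
    refine (amgm (by omega) _ (fun b => Finset.prod_nonneg fun j _ => abs_nonneg _)).trans (le_of_eq ?_)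
    refine Finset.sum_congr rfl fun b _ => ?_
    rw [← Finset.prod_pow]
    congr 1
    refine Finset.prod_congr rfl fun j _ => ?_
    rw [pow_mul, sq_abs, ← pow_mul]
  have hint : ∀ b : Fin (2*q), Integrable (fun t : EuclideanSpace ℝ (Fin d) =>
      (1/((2*q : ℕ):ℝ)) * ∏ j, Real.cos ⟪t, v (f b j)⟫ ^ (2*q)) (stdGaussian (EuclideanSpace ℝ (Fin d))) := by
    intro b
    apply Integrable.const_mul
    apply Integrable.of_bound (C := 1)
    · apply Continuous.aestronglyMeasurable; fun_prop
    · filter_upwards with t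
      rw [Real.norm_eq_abs, Finset.abs_prod]
      refine Finset.prod_le_one (fun _ _ => abs_nonneg _) (fun j _ => ?_)
      rw [abs_pow]; exact pow_le_one₀ (abs_nonneg _) (Real.abs_cos_le_one _)
  calc _ ≤ ∫ t, ∑ b : Fin (2*q), (1/((2*q : ℕ):ℝ)) * ∏ j, Real.cos ⟪t, v (f b j)⟫ ^ (2*q)
        ∂(stdGaussian (EuclideanSpace ℝ (Fin d))) := by
        apply integral_mono_of_nonneg
        · filter_upwards with t
          exact Finset.prod_nonneg fun _ _ => abs_nonneg _
        · exact integrable_finsetSum _ fun b _ => hint b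
        · filter_upwards with t using hpt t
    _ = ∑ b : Fin (2*q), (1/((2*q : ℕ):ℝ)) * ∫ t, ∏ j, Real.cos ⟪t, v (f b j)⟫ ^ (2*q)
        ∂(stdGaussian (EuclideanSpace ℝ (Fin d))) := by
        rw [integral_finsetSum _ fun b _ => hint b]
        simp_rw [integral_const_mul]
    _ ≤ ∑ b : Fin (2*q), (1/((2*q : ℕ):ℝ)) * A ^ d := by
        refine Finset.sum_le_sum fun b _ => ?_
        obtain ⟨e, h1, h2, h3⟩ := hgood b
        gcongr
        exact gauss_iter q A hA0 hA d (fun j => v (f b j)) e h1 h2 h3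
    _ = A ^ d := by
        have : ((2*q : ℕ):ℝ) ≠ 0 := by positivity
        rw [Finset.sum_const, Finset.card_univ, Fintype.card_fin, nsmul_eq_mul]
        field_simp

theorem small_ball_bound_high_dim (d : ℕ) (hd : 1 ≤ d) :
    ∃ C : ℝ, 0 < C ∧
      ∀ (k n : ℕ), 1 ≤ k →
      ∀ (v : Fin n → EuclideanSpace ℝ (Fin d)),
      (∀ (a : EuclideanSpace ℝ (Fin d)) (c : ℝ), a ≠ 0 →
        k ≤ Nat.card {i : Fin n //
          1 ≤ Metric.infDist (v i) {x : EuclideanSpace ℝ (Fin d) | ⟪a, x⟫ = c}}) →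
      ∀ x : EuclideanSpace ℝ (Fin d),
      (((PMF.uniformOfFintype (Fin n → Bool)).toMeasure
          {ω | (∑ j, (if ω j then (1 : ℝ) else -1) • v j) ∈ Metric.closedBall x 1}).toReal)
        ≤ C * (k : ℝ) ^ (-(d : ℝ) / 2) := by
  obtain ⟨K, hK, hb⟩ := one_dim
  have hd' : (0:ℝ) < d := by exact_mod_cast hd
  refine ⟨Real.exp (1/2) * (K * √(2*d))^d, by positivity, fun k n hk v hv x => ?_⟩
  refine (fourier_bd v x).trans ?_
  rw [mul_assoc]
  refine mul_le_mul_of_nonneg_left ?_ (by positivity)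
  set q := k / (2*d) with hq
  have hk' : (0:ℝ) < k := by exact_mod_cast hk
  have hI : ∫ t, ∏ i, |Real.cos ⟪t, v i⟫| ∂(stdGaussian (EuclideanSpace ℝ (Fin d))) ≤ (K / √(2*q+1)) ^ d := by
    rcases Nat.eq_zero_or_pos q with h0 | hpos
    · rw [h0]
      simp only [Nat.cast_zero, mul_zero, zero_add, Real.sqrt_one, div_one]
      refine le_trans ?_ (one_le_pow₀ hK)
      have := integral_mono_of_nonneg (μ := stdGaussian (EuclideanSpace ℝ (Fin d)))
        (f := fun t => ∏ i, |Real.cos ⟪t, v i⟫|) (g := fun _ => (1:ℝ))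
        (by filter_upwards with t; exact Finset.prod_nonneg fun _ _ => abs_nonneg _)
        (integrable_const _)
        (by filter_upwards with t; exact Finset.prod_le_one (fun _ _ => abs_nonneg _) (fun _ _ => Real.abs_cos_le_one _))
      simpa using this
    · refine main_int v hv q hpos ?_ _ (by positivity) (fun L c hL => hb q L c hL)
      have := Nat.div_mul_le_self k (2*d)
      rw [← hq] at this
      calc 2*q*d = q*(2*d) := by ring
        _ ≤ k := this
  refine hI.trans ?_
  have hpow : (k:ℝ) ^ (-(d:ℝ)/2) = ((√k)⁻¹)^d := by
    rw [Real.sqrt_eq_rpow, ← Real.rpow_neg hk'.le, ← Real.rpow_natCast, ← Real.rpow_mul hk'.le]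
    congr 1; ring
  rw [hpow, ← mul_pow]
  refine pow_le_pow_left₀ (by positivity) ?_ d
  rw [← div_eq_mul_inv, div_le_div_iff₀ (by positivity) (by positivity), mul_assoc, ← Real.sqrt_mul (by positivity)]
  gcongr
  have h1 : k < 2*d*(q+1) := by
    rw [hq]; exact Nat.lt_mul_div_succ k (by omega)
  have h2 : (k:ℝ) < 2*d*(q+1) := by exact_mod_cast h1
  have h3 : (0:ℝ) ≤ q := by positivity
  nlinarith [mul_nonneg hd'.le h3]
end

section
/- Erdős' Littlewood–Offord inequality: let v_1,…,v_n be real numbers with |v_i| ≥ 1 for all i, let ξ_1,…,ξ_n be i.i.d. Rademacher, and let Δ ≥ 0 with s := ⌊Δ⌋ + 1. Then for any closed interval I of length 2Δ, P(ξ_1 v_1 + … + ξ_n v_n ∈ I) ≤ 2^{−n} S(n,s), where S(n,s) is the sum of the s largest binomial coefficients C(n,i). Moreover this bound is attained. -/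
/-- `S n m` is the sum of the `m` largest binomial coefficients among
`n.choose 0, …, n.choose n`. -/
def S (n m : ℕ) : ℕ :=
  ((Finset.range (n + 1)).powersetCard (min m (n + 1))).sup fun A => ∑ i ∈ A, n.choose i

lemma choose_mono_half (n j k : ℕ) (hjk : j ≤ k) (hk : 2 * k ≤ n) :
    n.choose j ≤ n.choose k := by
  induction k, hjk using Nat.le_induction with
  | base => rfl
  | succ k hk' ih =>
    exact (ih (by omega)).trans (Nat.choose_le_succ_of_lt_half_left (by omega))

lemma choose_le_of_mid (n j k : ℕ) (hk : k ≤ n) (h1 : j ≤ n) (h : min j (n - j) ≤ min k (n - k)) :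
    n.choose j ≤ n.choose k := by
  have e : ∀ i, i ≤ n → n.choose i = n.choose (min i (n - i)) := by
    intro i hi
    rcases le_total i (n - i) with h | h
    · rw [min_eq_left h]
    · rw [min_eq_right h, Nat.choose_symm hi]
  rw [e j h1, e k hk]
  exact choose_mono_half _ _ _ h (by omega)

lemma knap (n m l : ℕ) (hm : m ≤ n + 1) (hm0 : 0 < m) (hl : l = (n + 1 - m) / 2) (a : ℕ → ℝ)
    (ha : ∀ k ∈ Finset.range (n + 1), 0 ≤ a k ∧ a k ≤ n.choose k)
    (hs : ∑ k ∈ Finset.range (n + 1), a k / n.choose k ≤ m) :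
    ∑ k ∈ Finset.range (n + 1), a k ≤ ∑ k ∈ Finset.Ico l (l + m), (n.choose k : ℝ) := by
  have hsub : Finset.Ico l (l + m) ⊆ Finset.range (n + 1) := by
    intro x hx; simp at hx ⊢; omega
  have hne : (Finset.Ico l (l + m)).Nonempty := by simpa using hm0
  obtain ⟨c, hc, hmin⟩ := Finset.exists_min_image (Finset.Ico l (l + m)) (fun k => n.choose k) hne
  rw [← Finset.sum_sdiff hsub] at hs ⊢
  have hcpos : ∀ k ∈ Finset.range (n + 1), (0 : ℝ) < n.choose k := by
    intro k hk; simp at hk; exact_mod_cast Nat.choose_pos (by omega)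
  have h1 : ∑ k ∈ Finset.range (n + 1) \ Finset.Ico l (l + m), a k ≤
      n.choose c * ∑ k ∈ Finset.range (n + 1) \ Finset.Ico l (l + m), a k / n.choose k := by
    rw [Finset.mul_sum]
    apply Finset.sum_le_sum
    intro k hk
    have hk' := (Finset.mem_sdiff.1 hk)
    have hp := hcpos k hk'.1
    have hle : (n.choose k : ℝ) ≤ n.choose c := by
      have := hk'.1
      have h2 := hk'.2
      simp at this h2 hc
      exact_mod_cast choose_le_of_mid n k c (by omega) (by omega) (by omega)
    rw [mul_div_assoc', le_div_iff₀ hp, mul_comm]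
    exact mul_le_mul_of_nonneg_right hle (ha k hk'.1).1
  have h2 : n.choose c * ∑ k ∈ Finset.Ico l (l + m), (1 - a k / n.choose k) ≤
      ∑ k ∈ Finset.Ico l (l + m), ((n.choose k : ℝ) - a k) := by
    rw [Finset.mul_sum]
    apply Finset.sum_le_sum
    intro k hk
    have hp := hcpos k (hsub hk)
    have hle : (n.choose c : ℝ) ≤ n.choose k := by exact_mod_cast hmin k hk
    have : (n.choose k : ℝ) - a k = n.choose k * (1 - a k / n.choose k) := by
      field_simp
    rw [this]
    refine mul_le_mul_of_nonneg_right hle ?_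
    rw [sub_nonneg, div_le_one hp]
    exact (ha k (hsub hk)).2
  simp only [Finset.sum_sub_distrib] at h2
  simp at h2
  have hc0 : (0 : ℝ) ≤ n.choose c := by positivity
  have := mul_le_mul_of_nonneg_left hs hc0
  linarith

lemma S_eq (n s m l : ℕ) (hm : m = min s (n + 1)) (hm0 : 0 < m) (hl : l = (n + 1 - m) / 2) :
    S n s = ∑ k ∈ Finset.Ico l (l + m), n.choose k := by
  unfold S
  rw [← hm]
  apply le_antisymm
  · apply Finset.sup_le
    intro A hA
    rw [Finset.mem_powersetCard] at hA
    have h := knap n m l (by omega) hm0 hl (fun k => if k ∈ A then n.choose k else 0)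
      (by intro k hk; split_ifs <;> simp) (by
        have : ∀ k ∈ Finset.range (n + 1), (if k ∈ A then (n.choose k : ℝ) else 0) / n.choose k
          = if k ∈ A then 1 else 0 := by
          intro k hk
          have : (n.choose k : ℝ) ≠ 0 := by
            simp at hk; exact_mod_cast (Nat.choose_pos (by omega)).ne'
          split_ifs
          · field_simp
          · simp
        rw [Finset.sum_congr rfl this, ← Finset.sum_filter, Finset.filter_mem_eq_inter,
          Finset.inter_eq_right.2 hA.1]
        simp [hA.2])
    rw [← Finset.sum_filter, Finset.filter_mem_eq_inter, Finset.inter_eq_right.2 hA.1] at h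
    exact_mod_cast h
  · apply Finset.le_sup (f := fun A => ∑ i ∈ A, n.choose i)
    rw [Finset.mem_powersetCard]
    refine ⟨?_, by simp⟩
    intro x hx; simp at hx ⊢; omega

lemma fam_bound (n s : ℕ) (hs0 : 0 < s) (F : Finset (Finset (Fin n))) (g : Finset (Fin n) → ℕ)
    (hg : ∀ A ∈ F, g A < s)
    (hanti : ∀ A ∈ F, ∀ B ∈ F, g A = g B → A ⊆ B → A = B) : F.card ≤ S n s := by
  have hmaps : ∀ A ∈ F, A.card ∈ Finset.range (n + 1) := by
    intro A _
    have := Finset.card_le_univ A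
    simp at this ⊢; omega
  have hle : ∀ k, (F.filter (fun A => A.card = k)).card ≤ n.choose k := by
    intro k
    have : F.filter (fun A => A.card = k) ⊆ Finset.powersetCard k Finset.univ := by
      intro A hA; simp at hA ⊢; exact hA.2
    simpa using Finset.card_le_card this
  set m := min s (n + 1) with hm
  have key := knap n m _ (by omega) (by omega) rfl
    (fun k => ((F.filter (fun A => A.card = k)).card : ℝ))
    (fun k _ => ⟨by positivity, by exact_mod_cast hle k⟩) (by
      rw [hm, Nat.cast_min]
      apply le_min
      · have e : ∑ k ∈ Finset.range (n + 1), ((F.filter (fun A => A.card = k)).card : ℝ) / n.choose k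
            = ∑ A ∈ F, ((n.choose A.card : ℝ))⁻¹ := by
          rw [← Finset.sum_fiberwise_of_maps_to' hmaps (fun k => ((n.choose k : ℝ))⁻¹)]
          simp [div_eq_mul_inv]
        rw [e, ← Finset.sum_fiberwise_of_maps_to (g := g) (t := Finset.range s)
          (by simpa using hg)]
        have : ∀ i ∈ Finset.range s, ∑ A ∈ F with g A = i, ((n.choose A.card : ℝ))⁻¹ ≤ 1 := by
          intro i _
          have := Finset.lubell_yamamoto_meshalkin_inequality_sum_inv_choose (𝕜 := ℝ)
            (𝒜 := F.filter (fun A => g A = i)) (by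
              intro A hA B hB hne hsub
              simp at hA hB
              exact hne (hanti A hA.1 B hB.1 (hA.2.trans hB.2.symm) hsub))
          simpa using this
        simpa using Finset.sum_le_sum this
      · have : ∀ k ∈ Finset.range (n + 1),
            ((F.filter (fun A => A.card = k)).card : ℝ) / n.choose k ≤ 1 := by
          intro k _
          exact div_le_one_of_le₀ (by exact_mod_cast hle k) (by positivity)
        simpa using Finset.sum_le_sum this)
  rw [S_eq n s m _ hm (by omega) rfl, Finset.card_eq_sum_card_fiberwise (f := Finset.card) hmaps]
  exact_mod_cast key

lemma meas_eq (n : ℕ) (T : Set (Fin n → Bool)) [DecidablePred (· ∈ T)] :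
    ((PMF.uniformOfFintype (Fin n → Bool)).toMeasure T).toReal
      = (2 : ℝ) ^ (-(n : ℝ)) * ((Finset.univ.filter (· ∈ T)).card : ℝ) := by
  rw [PMF.toMeasure_uniformOfFintype_apply _ (Set.toFinite T).measurableSet]
  rw [Fintype.card_subtype]
  simp [Real.rpow_neg, div_eq_mul_inv, mul_comm]

lemma upper (n : ℕ) (Δ : ℝ) (hΔ : 0 ≤ Δ) (v : Fin n → ℝ) (hv : ∀ i, 1 ≤ |v i|) (a : ℝ)
    (T : Finset (Fin n → Bool))
    (hT : ∀ ω ∈ T, (∑ j, (if ω j then (1 : ℝ) else -1) * v j) ∈ Set.Icc a (a + 2 * Δ)) :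
    T.card ≤ S n (⌊Δ⌋₊ + 1) := by
  classical
  let φ : (Fin n → Bool) → Finset (Fin n) := fun ω =>
    Finset.univ.filter (fun j => (ω j = true ↔ 0 ≤ v j))
  have hφ : Function.Injective φ := by
    intro x y hxy
    funext j
    have : j ∈ φ x ↔ j ∈ φ y := by rw [hxy]
    simp only [φ, Finset.mem_filter, Finset.mem_univ, true_and] at this
    by_cases h : 0 ≤ v j <;> cases hx : x j <;> cases hy : y j <;> simp_all
  let σ : Finset (Fin n) → ℝ := fun A => ∑ j, if j ∈ A then |v j| else -|v j|
  have hσ : ∀ ω, (∑ j, (if ω j then (1 : ℝ) else -1) * v j) = σ (φ ω) := by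
    intro ω
    apply Finset.sum_congr rfl
    intro j _
    simp only [φ, Finset.mem_filter, Finset.mem_univ, true_and]
    by_cases h : 0 ≤ v j
    · cases hx : ω j <;> simp [h, abs_of_nonneg h]
    · have h' : v j < 0 := not_le.1 h
      cases hx : ω j <;> simp [h, abs_of_neg h']
  have hstep : ∀ A B : Finset (Fin n), A ⊆ B → A ≠ B → σ A + 2 ≤ σ B := by
    intro A B hAB hne
    obtain ⟨j, hjB, hjA⟩ := Finset.exists_of_ssubset (Finset.ssubset_iff_subset_ne.2 ⟨hAB, hne⟩)
    have h0 : ∀ i ∈ Finset.univ, (0 : ℝ) ≤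
        (if i ∈ B then |v i| else -|v i|) - (if i ∈ A then |v i| else -|v i|) := by
      intro i _
      have := abs_nonneg (v i)
      by_cases h1 : i ∈ A
      · simp [h1, hAB h1]
      · by_cases h2 : i ∈ B <;> simp [h1, h2]
    have := Finset.single_le_sum h0 (Finset.mem_univ j)
    rw [Finset.sum_sub_distrib] at this
    simp only [hjA, hjB, if_true, if_false] at this
    have := hv j
    simp only [σ]
    linarith
  rw [← Finset.card_image_of_injective T hφ]
  have hI : ∀ A ∈ T.image φ, a ≤ σ A ∧ σ A ≤ a + 2 * Δ := by
    intro A hA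
    obtain ⟨ω, hω, rfl⟩ := Finset.mem_image.1 hA
    rw [← hσ]; exact hT ω hω
  apply fam_bound n _ (Nat.succ_pos _) _ (fun A => ⌊(σ A - a) / 2⌋₊)
  · intro A hA
    have := hI A hA
    exact Nat.lt_succ_of_le (Nat.floor_mono (by linarith))
  · intro A hA B hB hg hsub
    by_contra hne
    have h1 := hstep A B hsub hne
    have hA' := hI A hA
    have h3 := Nat.lt_floor_add_one ((σ B - a) / 2)
    have h4 := Nat.floor_le (show 0 ≤ (σ A - a) / 2 by linarith)
    rw [← hg] at h3
    linarith

lemma attained (n : ℕ) (Δ : ℝ) (hΔ : 0 ≤ Δ) : ∃ a : ℝ, ∀ T : Finset (Fin n → Bool),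
    (∀ ω, ω ∈ T ↔ (∑ j, (if ω j then (1 : ℝ) else -1) * 1) ∈ Set.Icc a (a + 2 * Δ)) →
    T.card = S n (⌊Δ⌋₊ + 1) := by
  classical
  set m := min (⌊Δ⌋₊ + 1) (n + 1) with hm
  obtain ⟨l, hl⟩ : ∃ l, l = (n + 1 - m) / 2 := ⟨_, rfl⟩
  refine ⟨2 * l - n, fun T hT => ?_⟩
  rw [S_eq n _ m l hm (by omega) hl]
  let φ : (Fin n → Bool) → Finset (Fin n) := fun ω => Finset.univ.filter (fun j => ω j = true)
  have hφ : Function.Injective φ := by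
    intro x y hxy
    funext j
    have : j ∈ φ x ↔ j ∈ φ y := by rw [hxy]
    simp only [φ, Finset.mem_filter, Finset.mem_univ, true_and] at this
    cases hx : x j <;> cases hy : y j <;> simp_all
  have hcard : ∀ ω, (φ ω).card ≤ n := fun ω => by simpa using Finset.card_le_univ (φ ω)
  have hsum : ∀ ω, (∑ j, (if ω j then (1 : ℝ) else -1) * 1) = 2 * ((φ ω).card : ℝ) - n := by
    intro ω
    have : ∀ j, (if ω j then (1 : ℝ) else -1) * 1 = 2 * (if ω j then 1 else 0) - 1 := by
      intro j; split_ifs <;> norm_num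
    simp only [this, Finset.sum_sub_distrib, ← Finset.mul_sum, Finset.sum_boole]
    simp [φ]
  have hmem : ∀ ω, ω ∈ T ↔ (φ ω).card ∈ Finset.Ico l (l + m) := by
    intro ω
    rw [hT, hsum, Finset.mem_Ico, Set.mem_Icc]
    have hc := hcard ω
    constructor
    · rintro ⟨h1, h2⟩
      have h1' : l ≤ (φ ω).card := by
        have : (l : ℝ) ≤ (φ ω).card := by linarith
        exact_mod_cast this
      have h2' : (φ ω).card - l ≤ ⌊Δ⌋₊ := by
        apply Nat.le_floor
        rw [Nat.cast_sub h1']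
        linarith
      omega
    · rintro ⟨h1, h2⟩
      have h1' : (l : ℝ) ≤ (φ ω).card := by exact_mod_cast h1
      have h2' : ((φ ω).card : ℝ) ≤ l + ⌊Δ⌋₊ := by
        have : (φ ω).card ≤ l + ⌊Δ⌋₊ := by omega
        exact_mod_cast this
      have := Nat.floor_le hΔ
      constructor <;> linarith
  rw [← Finset.card_image_of_injective T hφ]
  rw [Finset.card_eq_sum_card_fiberwise (f := Finset.card) (t := Finset.Ico l (l + m))]
  · apply Finset.sum_congr rfl
    intro k hk
    have : (T.image φ).filter (fun A => A.card = k) = Finset.powersetCard k Finset.univ := by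
      ext A
      simp only [Finset.mem_filter, Finset.mem_image, Finset.mem_powersetCard, Finset.subset_univ,
        true_and]
      constructor
      · exact fun h => h.2
      · intro h
        refine ⟨⟨fun j => decide (j ∈ A), ?_, ?_⟩, h⟩
        · rw [hmem]; simpa [φ, h] using hk
        · simp [φ]
    rw [this]; simp
  · intro A hA
    obtain ⟨ω, hω, rfl⟩ := Finset.mem_image.1 hA
    exact (hmem ω).1 hω


theorem erdos_littlewood_offord (n : ℕ) (Δ : ℝ) (hΔ : 0 ≤ Δ) :
    (∀ (v : Fin n → ℝ), (∀ i, 1 ≤ |v i|) → ∀ a : ℝ,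
      (((PMF.uniformOfFintype (Fin n → Bool)).toMeasure
          {ω | (∑ j, (if ω j then (1 : ℝ) else -1) * v j) ∈ Set.Icc a (a + 2 * Δ)}).toReal)
        ≤ (2 : ℝ) ^ (-(n : ℝ)) * (S n (⌊Δ⌋₊ + 1) : ℝ)) ∧
    (∃ (v : Fin n → ℝ), (∀ i, 1 ≤ |v i|) ∧ ∃ a : ℝ,
      (((PMF.uniformOfFintype (Fin n → Bool)).toMeasure
          {ω | (∑ j, (if ω j then (1 : ℝ) else -1) * v j) ∈ Set.Icc a (a + 2 * Δ)}).toReal)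
        = (2 : ℝ) ^ (-(n : ℝ)) * (S n (⌊Δ⌋₊ + 1) : ℝ)) := by
  classical
  constructor
  · intro v hv a
    rw [meas_eq]
    apply mul_le_mul_of_nonneg_left _ (by positivity)
    exact_mod_cast upper n Δ hΔ v hv a _ (fun ω hω => (Finset.mem_filter.1 hω).2)
  · obtain ⟨a, ha⟩ := attained n Δ hΔ
    refine ⟨fun _ => 1, by simp, a, ?_⟩
    rw [meas_eq, ha _ (fun ω => by simp only [Finset.mem_filter, Finset.mem_univ, true_and, Set.mem_ofPred_eq])]
end

section
/- Frankl–Füredi asymptotic Littlewood–Offord inequality: fix d ≥ 1 and Δ ≥ 0, and set s := ⌊Δ⌋ + 1. Let p_d(n,Δ) := sup P(ξ_1 v_1 + … + ξ_n v_n ∈ B), the supremum over all multisets of vectors v_1,…,v_n ∈ ℝ^d with |v_i| ≥ 1 and all closed balls B of radius Δ, with ξ_i i.i.d. Rademacher. Then p_d(n,Δ) = (1 + o(1)) 2^{−n} S(n,s) as n → ∞. -/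
/-- The Littlewood–Offord small ball probability `p_d(n, Δ)`: the supremum over all
families of `n` vectors in `ℝ^d` of norm at least `1` and all closed balls `B` of
radius `Δ` of the probability that the random Bernoulli sum lies in `B`. -/
noncomputable def smallBallProb (d n : ℕ) (Δ : ℝ) : ℝ :=
  sSup {q : ℝ | ∃ v : Fin n → EuclideanSpace ℝ (Fin d), (∀ i, 1 ≤ ‖v i‖) ∧
    ∃ x : EuclideanSpace ℝ (Fin d),
      q = (((PMF.uniformOfFintype (Fin n → Bool)).toMeasure
        {ω | (∑ j, (if ω j then (1 : ℝ) else -1) • v j) ∈ Metric.closedBall x Δ}).toReal)}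

open Finset in
lemma ff_fact_le {X : Type*} [Fintype X] [DecidableEq X] (A : Finset X) :
    (Fintype.card X).factorial ≤
      #(Numbering.prefixed A) * (Fintype.card X).choose (Fintype.card X / 2) := by
  rw [Numbering.card_prefixed, ← Nat.choose_mul_factorial_mul_factorial (Finset.card_le_univ A)]
  have := Nat.choose_le_middle (#A) (Fintype.card X)
  calc _ = (#A).factorial * (Fintype.card X - #A).factorial * (Fintype.card X).choose (#A) := by ring
    _ ≤ _ := Nat.mul_le_mul_left _ this

open Finset in
lemma ff_lym_one {X : Type*} [Fintype X] [DecidableEq X] (F : Finset (Finset X)) (s : ℕ)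
    (h : ∀ f : Numbering X, #{A ∈ F | f.IsPrefix A} ≤ s) :
    #F ≤ s * (Fintype.card X).choose (Fintype.card X / 2) := by
  set C := (Fintype.card X).choose (Fintype.card X / 2) with hC
  have h1 : ∑ A ∈ F, #(Numbering.prefixed A) = ∑ f : Numbering X, #{A ∈ F | f.IsPrefix A} := by
    simp only [Numbering.prefixed, card_filter]
    rw [sum_comm]
  have h2 : ∑ f : Numbering X, #{A ∈ F | f.IsPrefix A} ≤ (Fintype.card X).factorial * s := by
    calc _ ≤ ∑ f : Numbering X, s := sum_le_sum fun f _ => h f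
      _ = _ := by simp
  have h3 : #F * (Fintype.card X).factorial ≤ (∑ A ∈ F, #(Numbering.prefixed A)) * C := by
    rw [sum_mul, ← smul_eq_mul, ← sum_const]
    exact sum_le_sum fun A _ => ff_fact_le A
  have h4 : (Fintype.card X).factorial * #F ≤ (Fintype.card X).factorial * (s * C) := by
    calc _ = #F * (Fintype.card X).factorial := by ring
      _ ≤ _ := h3
      _ ≤ ((Fintype.card X).factorial * s) * C := Nat.mul_le_mul_right _ (h1 ▸ h2)
      _ = _ := by ring
  exact Nat.le_of_mul_le_mul_left h4 (Nat.factorial_pos _)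

open Finset in
lemma ff_lym_two {X Y : Type*} [Fintype X] [DecidableEq X] [Fintype Y] [DecidableEq Y]
    (F : Finset (Finset X × Finset Y)) (s : ℕ)
    (h : ∀ (f : Numbering X) (g : Numbering Y),
      #{A ∈ F | f.IsPrefix A.1 ∧ g.IsPrefix A.2} ≤ s) :
    #F ≤ s * ((Fintype.card X).choose (Fintype.card X / 2) *
      (Fintype.card Y).choose (Fintype.card Y / 2)) := by
  set C := (Fintype.card X).choose (Fintype.card X / 2) with hC
  set D := (Fintype.card Y).choose (Fintype.card Y / 2) with hD
  set a := (Fintype.card X).factorial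
  set b := (Fintype.card Y).factorial
  have h1 : ∑ A ∈ F, #(Numbering.prefixed A.1 ×ˢ Numbering.prefixed A.2) =
      ∑ f : Numbering X × Numbering Y, #{A ∈ F | f.1.IsPrefix A.1 ∧ f.2.IsPrefix A.2} := by
    simp only [card_filter]
    rw [sum_comm]
    refine sum_congr rfl fun A _ => ?_
    rw [← card_filter]
    congr 1
    ext f
    simp
  have h2 : ∑ f : Numbering X × Numbering Y, #{A ∈ F | f.1.IsPrefix A.1 ∧ f.2.IsPrefix A.2}
      ≤ (a * b) * s := by
    calc _ ≤ ∑ f : Numbering X × Numbering Y, s := sum_le_sum fun f _ => h f.1 f.2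
      _ = _ := by simp [a, b]
  have h3 : #F * (a * b) ≤
      (∑ A ∈ F, #(Numbering.prefixed A.1 ×ˢ Numbering.prefixed A.2)) * (C * D) := by
    rw [sum_mul, ← smul_eq_mul, ← sum_const]
    refine sum_le_sum fun A _ => ?_
    rw [card_product]
    calc a * b ≤ _ := Nat.mul_le_mul (ff_fact_le A.1) (ff_fact_le A.2)
      _ = _ := by ring
  have h4 : (a * b) * #F ≤ (a * b) * (s * (C * D)) := by
    calc _ = #F * (a * b) := by ring
      _ ≤ _ := h3
      _ ≤ ((a * b) * s) * (C * D) := Nat.mul_le_mul_right _ (h1 ▸ h2)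
      _ = _ := by ring
  exact Nat.le_of_mul_le_mul_left h4 (Nat.mul_pos (Nat.factorial_pos _) (Nat.factorial_pos _))

open Classical in
/-- number of subset sums in a ball -/
noncomputable def ffN {ι E : Type*} [NormedAddCommGroup E]
    (I : Finset ι) (v : ι → E) (x : E) (r : ℝ) : ℕ :=
  (I.powerset.filter fun A => ‖∑ i ∈ A, v i - x‖ ≤ r).card

open Classical in
lemma ffN_insert {ι E : Type*} [DecidableEq ι] [NormedAddCommGroup E]
    (I : Finset ι) (v : ι → E) (x : E) (r : ℝ) (a : ι) (ha : a ∉ I) :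
    ffN (insert a I) v x r = ffN I v x r + ffN I v (x - v a) r := by
  unfold ffN
  rw [Finset.powerset_insert, Finset.filter_union, Finset.card_union_of_disjoint]
  · congr 1
    rw [Finset.filter_image, Finset.card_image_of_injOn]
    · congr 1
      apply Finset.filter_congr
      intro A hA
      have : a ∉ A := fun h => ha (Finset.mem_powerset.1 hA h)
      rw [Finset.sum_insert this]
      have e : v a + ∑ i ∈ A, v i - x = ∑ i ∈ A, v i - (x - v a) := by abel
      rw [e]
    · intro A hA B hB h
      simp only [Finset.coe_filter, Finset.mem_powerset, Set.mem_ofPred_eq] at hA hB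
      have h1 : a ∉ A := fun h => ha (hA.1 h)
      have h2 : a ∉ B := fun h => ha (hB.1 h)
      rw [← Finset.erase_insert h1, ← Finset.erase_insert h2]
      exact congrArg (fun S => Finset.erase S a) h
  · rw [Finset.disjoint_left]
    intro A hA hB
    simp only [Finset.mem_filter, Finset.mem_powerset, Finset.mem_image] at hA hB
    obtain ⟨⟨B, hB, rfl⟩, _⟩ := hB
    exact ha (hA.1 (Finset.mem_insert_self _ _))

open Classical in
lemma ffN_cond {ι E : Type*} [DecidableEq ι] [NormedAddCommGroup E]
    (I K : Finset ι) (v : ι → E) (r : ℝ) (b : ℕ) (hd : Disjoint I K)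
    (h : ∀ x, ffN I v x r ≤ b) (x : E) :
    ffN (I ∪ K) v x r ≤ 2 ^ K.card * b := by
  induction K using Finset.induction_on generalizing x with
  | empty => simpa using h x
  | insert a K ha ih =>
    rw [Finset.disjoint_insert_right] at hd
    rw [Finset.union_insert, ffN_insert _ _ _ _ _ (by simp [ha, hd.1]),
      Finset.card_insert_of_notMem ha, pow_succ]
    have h1 := ih hd.2 x
    have h2 := ih hd.2 (x - v a)
    linarith

open Classical in
lemma ffN_flip {ι E : Type*} [DecidableEq ι] [NormedAddCommGroup E]
    (I : Finset ι) (v w : ι → E) (r : ℝ) (h : ∀ i ∈ I, w i = v i ∨ w i = - v i) :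
    ∃ y, ∀ x, ffN I v x r = ffN I w (x + y) r := by
  induction I using Finset.induction_on with
  | empty => exact ⟨0, fun x => by simp [ffN, Finset.filter_singleton]⟩
  | insert a I ha ih =>
    obtain ⟨y, hy⟩ := ih fun i hi => h i (Finset.mem_insert_of_mem hi)
    rcases h a (Finset.mem_insert_self _ _) with h1 | h1
    · refine ⟨y, fun x => ?_⟩
      rw [ffN_insert _ _ _ _ _ ha, ffN_insert _ _ _ _ _ ha, hy, hy, h1]
      congr 2; abel
    · refine ⟨y - v a, fun x => ?_⟩
      rw [ffN_insert _ _ _ _ _ ha, ffN_insert _ _ _ _ _ ha, hy, hy, h1, add_comm]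
      congr 2 <;> abel

open Classical in
lemma ffN_one {ι E : Type*} [NormedAddCommGroup E] [InnerProductSpace ℝ E]
    (I : Finset ι) (v : ι → E) (x e : E) (r κ : ℝ) (s : ℕ) (he : ‖e‖ = 1)
    (hv : ∀ i ∈ I, κ ≤ inner ℝ (v i) e) (hr : 2 * r < κ * s) (hκ : 0 < κ) :
    ffN I v x r ≤ s * I.card.choose (I.card / 2) := by
  set F : Finset (Finset I) := Finset.univ.filter fun A => ‖∑ i ∈ A, v i - x‖ ≤ r with hF
  have h1 : ffN I v x r ≤ F.card := by
    refine Finset.card_le_card_of_injOn (fun A => A.subtype (· ∈ I)) ?_ ?_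
    · intro A hA
      simp only [Finset.coe_filter, Finset.mem_powerset, Set.mem_ofPred_eq] at hA
      simp only [hF, Finset.coe_filter, Finset.mem_univ, true_and, Set.mem_ofPred_eq]
      rw [Finset.sum_subtype_of_mem v (fun i hi => hA.1 hi)]
      exact hA.2
    · intro A hA B hB h
      simp only [Finset.coe_filter, Finset.mem_powerset, Set.mem_ofPred_eq] at hA hB
      have := congrArg (fun S => Finset.map (Function.Embedding.subtype (· ∈ I)) S) h
      simp only [Finset.subtype_map] at this
      rwa [Finset.filter_true_of_mem (fun i hi => hA.1 hi),
        Finset.filter_true_of_mem (fun i hi => hB.1 hi)] at this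
  have key : ∀ A ∈ F, ∀ B ∈ F, A ⊆ B → B.card < A.card + s := by
    intro A hA B hB hAB
    simp only [hF, Finset.mem_filter, Finset.mem_univ, true_and] at hA hB
    have h2 : ∑ i ∈ B \ A, v i = (∑ i ∈ B, v i - x) - (∑ i ∈ A, v i - x) := by
      rw [← Finset.sum_sdiff hAB]; abel
    have h3 : ‖∑ i ∈ B \ A, v i‖ ≤ 2 * r := by
      rw [h2]; exact (norm_sub_le _ _).trans (by linarith)
    have h4 : ((B \ A).card : ℝ) * κ ≤ inner ℝ (∑ i ∈ B \ A, v i) e := by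
      rw [sum_inner, ← nsmul_eq_mul]
      exact Finset.card_nsmul_le_sum _ _ _ fun i _ => hv i i.2
    have h5 := real_inner_le_norm (∑ i ∈ B \ A, v i) e
    rw [he, mul_one] at h5
    have h6 : ((B \ A).card : ℝ) * κ < s * κ := by linarith
    have h7 : (B \ A).card < s := by exact_mod_cast lt_of_mul_lt_mul_right h6 hκ.le
    have h8 := Finset.card_sdiff_add_card_eq_card hAB
    omega
  have h2 := ff_lym_one F s (by
    intro f
    set G := F.filter fun A => f.IsPrefix A with hG
    rcases G.eq_empty_or_nonempty with h0 | h0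
    · simp [h0]
    obtain ⟨A0, hA0, hmin⟩ := Finset.exists_min_image G Finset.card h0
    have : G.card ≤ (Finset.Ico A0.card (A0.card + s)).card := by
      refine Finset.card_le_card_of_injOn Finset.card ?_ ?_
      · intro B hB
        have hB' : B ∈ G := hB
        have hle := hmin B hB'
        rw [hG, Finset.mem_filter] at hB' hA0
        simp only [Finset.coe_Ico, Set.mem_Ico]
        exact ⟨hle, key A0 hA0.1 B hB'.1 (hA0.2.subset_of_card_le_card hB'.2 hle)⟩
      · intro A hA B hB h
        have hA' : A ∈ G := hA
        have hB' : B ∈ G := hB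
        rw [hG, Finset.mem_filter] at hA' hB'
        exact (hA'.2.subset_of_card_le_card hB'.2 h.le).antisymm
          (hB'.2.subset_of_card_le_card hA'.2 h.ge)
    simpa using this)
  rw [Fintype.card_coe] at h2
  exact h1.trans h2

lemma ff_cone {ι E : Type*} [NormedAddCommGroup E] [InnerProductSpace ℝ E]
    (T : Finset ι) (v : ι → E) (e : E) (δ : ℝ)
    (hn : ∀ i ∈ T, 1 ≤ ‖v i‖) (h : ∀ i ∈ T, ‖v i - ‖v i‖ • e‖ ≤ δ * ‖v i‖) :
    ∃ t : ℝ, (T.card : ℝ) ≤ t ∧ ‖∑ i ∈ T, v i - t • e‖ ≤ δ * t := by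
  refine ⟨∑ i ∈ T, ‖v i‖, ?_, ?_⟩
  · simpa using Finset.card_nsmul_le_sum T (fun i => ‖v i‖) 1 hn
  · rw [Finset.sum_smul, ← Finset.sum_sub_distrib, Finset.mul_sum]
    exact norm_sum_le_of_le _ h

lemma ff_cone_diff {ι E : Type*} [NormedAddCommGroup E] [InnerProductSpace ℝ E] [DecidableEq ι]
    (A B : Finset ι) (v : ι → E) (e : E) (δ : ℝ)
    (hn : ∀ i, 1 ≤ ‖v i‖) (h : ∀ i, ‖v i - ‖v i‖ • e‖ ≤ δ * ‖v i‖)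
    (hAB : A ⊆ B ∨ B ⊆ A) :
    ∃ t : ℝ, |(A.card : ℝ) - B.card| ≤ |t| ∧
      ‖∑ i ∈ A, v i - ∑ i ∈ B, v i - t • e‖ ≤ δ * |t| := by
  rcases hAB with h1 | h1
  · obtain ⟨t, ht, ht'⟩ := ff_cone (B \ A) v e δ (fun i _ => hn i) (fun i _ => h i)
    have h0 : (0:ℝ) ≤ t := le_trans (by positivity) ht
    have hc : ((B \ A).card : ℝ) + A.card = B.card := by
      exact_mod_cast Finset.card_sdiff_add_card_eq_card h1
    have hc0 : (0:ℝ) ≤ (B \ A).card := by positivity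
    refine ⟨-t, ?_, ?_⟩
    · rw [abs_neg, abs_of_nonneg h0, abs_le]; constructor <;> linarith
    · rw [abs_neg, abs_of_nonneg h0, ← Finset.sum_sdiff h1]
      have e1 : ∑ i ∈ A, v i - (∑ i ∈ B \ A, v i + ∑ i ∈ A, v i) - (-t) • e =
          -(∑ i ∈ B \ A, v i - t • e) := by rw [neg_smul]; abel
      rw [e1, norm_neg]; exact ht'
  · obtain ⟨t, ht, ht'⟩ := ff_cone (A \ B) v e δ (fun i _ => hn i) (fun i _ => h i)
    have h0 : (0:ℝ) ≤ t := le_trans (by positivity) ht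
    have hc : ((A \ B).card : ℝ) + B.card = A.card := by
      exact_mod_cast Finset.card_sdiff_add_card_eq_card h1
    have hc0 : (0:ℝ) ≤ (A \ B).card := by positivity
    refine ⟨t, ?_, ?_⟩
    · rw [abs_of_nonneg h0, abs_le]; constructor <;> linarith
    · rw [abs_of_nonneg h0, ← Finset.sum_sdiff h1]
      convert ht' using 2
      abel

lemma ff_sep {E : Type*} [NormedAddCommGroup E] [InnerProductSpace ℝ E]
    (e₁ e₂ x y : E) (t u η : ℝ) (h1 : ‖e₁‖ = 1) (h2 : ‖e₂‖ = 1) (hη : 0 < η) (hη1 : η ≤ 1)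
    (h12 : |inner ℝ e₁ e₂| ≤ 1 - 3 * η / 4)
    (hx : ‖x - t • e₁‖ ≤ η / 4 * |t|) (hy : ‖y - u • e₂‖ ≤ η / 4 * |u|) :
    η / 4 * (|t| + |u|) ≤ ‖x + y‖ := by
  have hA : η / 2 * (|t| + |u|) ≤ ‖t • e₁ + u • e₂‖ := by
    refine le_of_pow_le_pow_left₀ two_ne_zero (norm_nonneg _) ?_
    rw [@norm_add_sq_real, norm_smul, norm_smul, h1, h2, inner_smul_left, inner_smul_right]
    simp only [Real.norm_eq_abs, mul_one, conj_trivial]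
    have h3 : -(|t| * (|u| * (1 - 3 * η / 4))) ≤ t * (u * inner ℝ e₁ e₂) := by
      have : |t * (u * inner ℝ e₁ e₂)| ≤ |t| * (|u| * (1 - 3 * η / 4)) := by
        rw [abs_mul, abs_mul]; gcongr
      linarith [neg_abs_le (t * (u * inner ℝ e₁ e₂))]
    have ht := abs_nonneg t
    have hu := abs_nonneg u
    have h4 : (η / 2 * (|t| + |u|)) ^ 2 ≤ η / 4 * (|t| + |u|) ^ 2 := by
      rw [mul_pow]; gcongr; nlinarith
    have h5 : (|t| + |u|) ^ 2 ≤ 2 * (|t| ^ 2 + |u| ^ 2) := by nlinarith [sq_nonneg (|t| - |u|)]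
    have h6 : η / 4 * (|t| + |u|) ^ 2 ≤ η / 4 * (2 * (|t| ^ 2 + |u| ^ 2)) := by gcongr
    have h7 : 0 ≤ (1 - 3 * η / 4) * (|t| - |u|) ^ 2 :=
      mul_nonneg (by linarith) (sq_nonneg _)
    have h8 : 0 ≤ η * (|t| ^ 2 + |u| ^ 2) := by positivity
    nlinarith
  have h3 : t • e₁ + u • e₂ = (x + y) - ((x - t • e₁) + (y - u • e₂)) := by abel
  have h4 : ‖t • e₁ + u • e₂‖ ≤ ‖x + y‖ + (η / 4 * |t| + η / 4 * |u|) := by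
    rw [h3]
    exact (norm_sub_le _ _).trans (add_le_add_right ((norm_add_le _ _).trans (add_le_add hx hy)) _)
  linarith

open Classical in
lemma ffN_two {ι E : Type*} [DecidableEq ι] [NormedAddCommGroup E] [InnerProductSpace ℝ E]
    (J K : Finset ι) (hJK : Disjoint J K) (v : ι → E) (x e₁ e₂ : E) (r η : ℝ) (L : ℕ)
    (h1 : ‖e₁‖ = 1) (h2 : ‖e₂‖ = 1) (hη : 0 < η) (hη1 : η ≤ 1)
    (h12 : |inner ℝ e₁ e₂| ≤ 1 - 3 * η / 4) (hn : ∀ i, 1 ≤ ‖v i‖)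
    (hJ : ∀ i ∈ J, ‖v i - ‖v i‖ • e₁‖ ≤ η / 4 * ‖v i‖)
    (hK : ∀ i ∈ K, ‖v i - ‖v i‖ • e₂‖ ≤ η / 4 * ‖v i‖)
    (hL : 2 * r ≤ η / 4 * L) :
    ffN (J ∪ K) v x r ≤ (2 * L + 1) ^ 2 *
      (J.card.choose (J.card / 2) * K.card.choose (K.card / 2)) := by
  set F : Finset (Finset J × Finset K) :=
    Finset.univ.filter fun A => ‖∑ i ∈ A.1, v i + ∑ i ∈ A.2, v i - x‖ ≤ r with hF
  have hsplit : ∀ A ⊆ J ∪ K, A = A.filter (· ∈ J) ∪ A.filter (· ∈ K) := by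
    intro A hA
    ext i
    simp only [Finset.mem_union, Finset.mem_filter]
    have := @hA i
    simp only [Finset.mem_union] at this
    tauto
  have hc : ffN (J ∪ K) v x r ≤ F.card := by
    refine Finset.card_le_card_of_injOn
      (fun A => (A.subtype (· ∈ J), A.subtype (· ∈ K))) ?_ ?_
    · intro A hA
      simp only [Finset.coe_filter, Finset.mem_powerset, Set.mem_ofPred_eq] at hA
      simp only [hF, Finset.coe_filter, Finset.mem_univ, true_and, Set.mem_ofPred_eq]
      rw [Finset.sum_subtype_eq_sum_filter, Finset.sum_subtype_eq_sum_filter,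
        ← Finset.sum_union, ← hsplit A hA.1]
      · exact hA.2
      · rw [Finset.disjoint_left] at hJK ⊢
        intro i hi hi'
        exact hJK (Finset.mem_filter.1 hi).2 (Finset.mem_filter.1 hi').2
    · intro A hA B hB h
      simp only [Finset.coe_filter, Finset.mem_powerset, Set.mem_ofPred_eq] at hA hB
      have t1 := congrArg (fun S => Finset.map (Function.Embedding.subtype (· ∈ J)) S.1) h
      have t2 := congrArg (fun S => Finset.map (Function.Embedding.subtype (· ∈ K)) S.2) h
      simp only [Finset.subtype_map] at t1 t2
      rw [hsplit A hA.1, hsplit B hB.1, t1, t2]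
  have key : ∀ A ∈ F, ∀ B ∈ F, (A.1 ⊆ B.1 ∨ B.1 ⊆ A.1) → (A.2 ⊆ B.2 ∨ B.2 ⊆ A.2) →
      (A.1.card ≤ B.1.card + L ∧ A.2.card ≤ B.2.card + L) := by
    intro A hA B hB hs1 hs2
    simp only [hF, Finset.mem_filter, Finset.mem_univ, true_and] at hA hB
    obtain ⟨t, ht, ht'⟩ := ff_cone_diff A.1 B.1 (fun i : J => v i) e₁ (η / 4)
      (fun i => hn i) (fun i => hJ i i.2) hs1
    obtain ⟨u, hu, hu'⟩ := ff_cone_diff A.2 B.2 (fun i : K => v i) e₂ (η / 4)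
      (fun i => hn i) (fun i => hK i i.2) hs2
    have h3 := ff_sep e₁ e₂ _ _ t u η h1 h2 hη hη1 h12 ht' hu'
    have h4 : (∑ i ∈ A.1, v i - ∑ i ∈ B.1, v i) + (∑ i ∈ A.2, v i - ∑ i ∈ B.2, v i) =
      (∑ i ∈ A.1, v i + ∑ i ∈ A.2, v i - x) - (∑ i ∈ B.1, v i + ∑ i ∈ B.2, v i - x) := by abel
    rw [h4] at h3
    have h5 : η / 4 * (|t| + |u|) ≤ η / 4 * L :=
      (h3.trans (norm_sub_le _ _)).trans (by linarith)
    have h6 : |t| + |u| ≤ L := le_of_mul_le_mul_left h5 (by positivity)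
    have h7 := abs_nonneg t
    have h8 := abs_nonneg u
    have h9 := le_abs_self ((A.1.card : ℝ) - B.1.card)
    have h10 := le_abs_self ((A.2.card : ℝ) - B.2.card)
    constructor
    · have : (A.1.card : ℝ) ≤ B.1.card + L := by linarith
      exact_mod_cast this
    · have : (A.2.card : ℝ) ≤ B.2.card + L := by linarith
      exact_mod_cast this
  have hfin := ff_lym_two F ((2 * L + 1) ^ 2) (by
    intro f g
    set G := F.filter fun A => f.IsPrefix A.1 ∧ g.IsPrefix A.2 with hG
    rcases G.eq_empty_or_nonempty with h0 | ⟨A0, hA0⟩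
    · simp [h0]
    have hcmp : ∀ A ∈ G, ∀ B ∈ G, A.1.card ≤ B.1.card + L ∧ A.2.card ≤ B.2.card + L := by
      intro A hA B hB
      rw [hG, Finset.mem_filter] at hA hB
      refine key A hA.1 B hB.1 ?_ ?_
      · exact (le_total A.1.card B.1.card).imp (hA.2.1.subset_of_card_le_card hB.2.1)
          (hB.2.1.subset_of_card_le_card hA.2.1)
      · exact (le_total A.2.card B.2.card).imp (hA.2.2.subset_of_card_le_card hB.2.2)
          (hB.2.2.subset_of_card_le_card hA.2.2)
    have : G.card ≤ (Finset.Icc (A0.1.card - L) (A0.1.card + L) ×ˢ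
        Finset.Icc (A0.2.card - L) (A0.2.card + L)).card := by
      refine Finset.card_le_card_of_injOn (fun A => (A.1.card, A.2.card)) ?_ ?_
      · intro B hB
        have q1 := hcmp B hB A0 hA0
        have q2 := hcmp A0 hA0 B hB
        simp only [Finset.coe_product, Finset.coe_Icc, Set.mem_prod, Set.mem_Icc]
        omega
      · intro A hA B hB h
        have hA' : A ∈ G := hA
        have hB' : B ∈ G := hB
        rw [hG, Finset.mem_filter] at hA' hB'
        simp only [Prod.mk.injEq] at h
        exact Prod.ext
          ((hA'.2.1.subset_of_card_le_card hB'.2.1 h.1.le).antisymm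
            (hB'.2.1.subset_of_card_le_card hA'.2.1 h.1.ge))
          ((hA'.2.2.subset_of_card_le_card hB'.2.2 h.2.le).antisymm
            (hB'.2.2.subset_of_card_le_card hA'.2.2 h.2.ge))
    refine this.trans ?_
    rw [Finset.card_product, Nat.card_Icc, Nat.card_Icc, pow_two]
    exact Nat.mul_le_mul (by omega) (by omega))
  rw [Fintype.card_coe, Fintype.card_coe] at hfin
  exact hc.trans hfin

/-- central binomial probability -/
noncomputable def ffb (n : ℕ) : ℝ := (n.choose (n / 2) : ℝ) / 2 ^ n

noncomputable def ffa (k : ℕ) : ℝ := (k.centralBinom : ℝ) / 4 ^ k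

lemma ffa_pos (k : ℕ) : 0 < ffa k := by
  have := Nat.centralBinom_pos k
  unfold ffa; positivity

lemma ffa_succ (k : ℕ) : ffa (k + 1) = ffa k * ((2 * k + 1) / (2 * k + 2)) := by
  have h := Nat.succ_mul_centralBinom_succ k
  have h' : ((k : ℝ) + 1) * (k + 1).centralBinom = 2 * (2 * k + 1) * k.centralBinom := by
    exact_mod_cast h
  unfold ffa
  rw [pow_succ]
  field_simp
  linarith

lemma ffb_eq (n : ℕ) : ffb n = ffa ((n + 1) / 2) := by
  unfold ffb ffa
  rcases Nat.even_or_odd' n with ⟨k, rfl | rfl⟩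
  · have h1 : 2 * k / 2 = k := by omega
    have h2 : (2 * k + 1) / 2 = k := by omega
    rw [h1, h2, Nat.centralBinom_eq_two_mul_choose, pow_mul]; norm_num
  · have h1 : (2 * k + 1) / 2 = k := by omega
    have h2 : (2 * k + 1 + 1) / 2 = k + 1 := by omega
    rw [h1, h2, Nat.centralBinom_eq_two_mul_choose]
    have h3 : (2 * (k + 1)).choose (k + 1) = 2 * (2 * k + 1).choose k := by
      have : 2 * (k + 1) = 2 * k + 1 + 1 := by ring
      rw [this, Nat.choose_succ_succ, Nat.choose_symm_half]; ring
    rw [h3]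
    have : (4 : ℝ) ^ (k + 1) = 2 * 2 ^ (2 * k + 1) := by
      rw [show (4 : ℝ) = 2 ^ 2 by norm_num, ← pow_mul]; ring
    rw [this]; push_cast
    field_simp

lemma ffa_mono : Monotone fun k : ℕ => (k : ℝ) * ffa k ^ 2 := by
  apply monotone_nat_of_le_succ
  intro k
  rw [ffa_succ]
  have h := sq_nonneg (ffa k)
  rw [mul_pow, div_pow]
  push_cast
  have : (k : ℝ) ≤ (k + 1) * ((2 * k + 1) ^ 2 / (2 * k + 2) ^ 2) := by
    rw [← mul_div_assoc, le_div_iff₀ (by positivity)]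
    nlinarith [(Nat.cast_nonneg k : (0:ℝ) ≤ k)]
  nlinarith

lemma ffa_anti : Antitone fun k : ℕ => (2 * (k : ℝ) + 1) * ffa k ^ 2 := by
  apply antitone_nat_of_succ_le
  intro k
  rw [ffa_succ]
  have h := sq_nonneg (ffa k)
  rw [mul_pow, div_pow]
  push_cast
  have : (2 * ((k : ℝ) + 1) + 1) * ((2 * k + 1) ^ 2 / (2 * k + 2) ^ 2) ≤ 2 * k + 1 := by
    rw [← mul_div_assoc, div_le_iff₀ (by positivity)]
    nlinarith [(Nat.cast_nonneg k : (0:ℝ) ≤ k)]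
  nlinarith

lemma ffb_pos (n : ℕ) : 0 < ffb n := by rw [ffb_eq]; exact ffa_pos _

lemma ffb_le (m n : ℕ) (h : m ≤ n) : m * ffb m ^ 2 ≤ (n + 1) * ffb n ^ 2 := by
  rw [ffb_eq, ffb_eq]
  have h1 : ((m + 1) / 2 : ℕ) ≤ (n + 1) / 2 := by omega
  have h2 := ffa_mono h1
  have h3 : (m : ℝ) ≤ 2 * ((m + 1) / 2 : ℕ) := by
    have : m ≤ 2 * ((m + 1) / 2) := by omega
    exact_mod_cast this
  have h4 : 2 * (((n + 1) / 2 : ℕ) : ℝ) ≤ n + 1 := by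
    have : 2 * ((n + 1) / 2) ≤ n + 1 := by omega
    exact_mod_cast this
  simp only at h2
  have h5 := mul_le_mul_of_nonneg_right h3 (sq_nonneg (ffa ((m + 1) / 2)))
  have h6 := mul_le_mul_of_nonneg_right h4 (sq_nonneg (ffa ((n + 1) / 2)))
  linarith

lemma ffb_upper (m : ℕ) : m * ffb m ^ 2 ≤ 1 := by
  rw [ffb_eq]
  have h2 := ffa_anti (Nat.zero_le ((m + 1) / 2))
  have h3 : (m : ℝ) ≤ 2 * ((m + 1) / 2 : ℕ) + 1 := by
    have : m ≤ 2 * ((m + 1) / 2) + 1 := by omega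
    exact_mod_cast this
  have h0 : ffa 0 = 1 := by simp [ffa]
  simp only [h0] at h2
  have h5 := mul_le_mul_of_nonneg_right h3 (sq_nonneg (ffa ((m + 1) / 2)))
  norm_num at h2
  linarith

lemma ffb_lower (n : ℕ) (hn : 1 ≤ n) : 1 / 4 ≤ (n + 1) * ffb n ^ 2 := by
  have := ffb_le 1 n hn
  have h1 : ffb 1 = 1 / 2 := by norm_num [ffb]
  rw [h1] at this
  norm_num at this ⊢
  exact this

lemma ff_choose (n : ℕ) : (n.choose (n / 2) : ℝ) = 2 ^ n * ffb n := by
  unfold ffb; field_simp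

lemma ff_ratio (j : ℕ) : Filter.Tendsto
    (fun n : ℕ => (n.choose (n / 2 + j) : ℝ) / n.choose (n / 2)) Filter.atTop (nhds 1) := by
  induction j with
  | zero =>
    refine tendsto_const_nhds.congr fun n => ?_
    have : (n.choose (n / 2) : ℝ) ≠ 0 := by
      rw [ff_choose]; have := ffb_pos n; positivity
    simp [this]
  | succ j ih =>
    have h1 : Filter.Tendsto (fun n : ℕ => ((n - n / 2 - j : ℕ) : ℝ) / ((n / 2 + j + 1 : ℕ) : ℝ))
        Filter.atTop (nhds 1) := by
      have hl : Filter.Tendsto (fun n : ℕ => 1 - (4 * j + 2 : ℝ) / n) Filter.atTop (nhds 1) := by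
        simpa using tendsto_const_nhds.sub (tendsto_const_div_atTop_nhds_zero_nat (4 * j + 2 : ℝ))
      refine tendsto_of_tendsto_of_tendsto_of_le_of_le' hl tendsto_const_nhds ?_ ?_
      · filter_upwards [Filter.eventually_ge_atTop (2 * j + 1)] with n hn
        rw [sub_le_iff_le_add, ← sub_le_iff_le_add']
        have hn0 : (0:ℝ) < n := by exact_mod_cast (by omega : 0 < n)
        have e : (1:ℝ) - ((n - n / 2 - j : ℕ) : ℝ) / ((n / 2 + j + 1 : ℕ) : ℝ) =
          (((n / 2 + j + 1 : ℕ) : ℝ) - ((n - n / 2 - j : ℕ) : ℝ)) / ((n / 2 + j + 1 : ℕ) : ℝ) := by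
          field_simp
        rw [e, div_le_div_iff₀ (by positivity) hn0]
        have a1 : ((n / 2 + j + 1 : ℕ) : ℝ) - ((n - n / 2 - j : ℕ) : ℝ) ≤ 2 * j + 1 := by
          rw [sub_le_iff_le_add]
          exact_mod_cast (by omega : n / 2 + j + 1 ≤ 2 * j + 1 + (n - n / 2 - j))
        have a2 : (n : ℝ) ≤ 2 * ((n / 2 + j + 1 : ℕ) : ℝ) := by
          exact_mod_cast (by omega : n ≤ 2 * (n / 2 + j + 1))
        calc _ ≤ (2 * j + 1 : ℝ) * n := by gcongr
          _ ≤ (2 * j + 1) * (2 * ((n / 2 + j + 1 : ℕ) : ℝ)) := by gcongr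
          _ = _ := by ring
      · filter_upwards with n
        apply div_le_one_of_le₀ _ (by positivity)
        exact_mod_cast (by omega : n - n / 2 - j ≤ n / 2 + j + 1)
    have h2 := ih.mul h1
    rw [mul_one] at h2
    refine h2.congr fun n => ?_
    have h3 := Nat.choose_succ_right_eq n (n / 2 + j)
    rw [← add_assoc]
    have h4 : (n.choose (n / 2 + j + 1) : ℝ) * ((n / 2 + j + 1 : ℕ) : ℝ) =
      n.choose (n / 2 + j) * ((n - n / 2 - j : ℕ) : ℝ) := by
      rw [Nat.sub_sub]; exact_mod_cast h3
    have h5 : (n.choose (n / 2) : ℝ) ≠ 0 := by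
      rw [ff_choose]; have := ffb_pos n; positivity
    have h6 : ((n / 2 + j + 1 : ℕ) : ℝ) ≠ 0 := by positivity
    rw [div_mul_div_comm, ← h4]
    field_simp

open Classical in
lemma ff_pigeon {ι E : Type*} (I : Finset ι) (T : Finset E) (near : ι → E → Prop)
    (h : ∀ i ∈ I, ∃ e ∈ T, near i e) (hI : I.Nonempty) :
    ∃ e ∈ T, I.card ≤ T.card * (I.filter fun i => near i e).card := by
  by_contra hcon
  push Not at hcon
  have hT : T.Nonempty := by
    obtain ⟨i, hi⟩ := hI
    obtain ⟨e, he, _⟩ := h i hi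
    exact ⟨e, he⟩
  have h1 : I.card ≤ ∑ e ∈ T, (I.filter fun i => near i e).card := by
    refine le_trans (Finset.card_le_card ?_) Finset.card_biUnion_le
    intro i hi
    obtain ⟨e, he, h2⟩ := h i hi
    exact Finset.mem_biUnion.2 ⟨e, he, Finset.mem_filter.2 ⟨hi, h2⟩⟩
  have h2 : ∑ e ∈ T, T.card * (I.filter fun i => near i e).card < ∑ e ∈ T, I.card :=
    Finset.sum_lt_sum_of_nonempty hT hcon
  rw [← Finset.mul_sum, Finset.sum_const, smul_eq_mul] at h2
  exact absurd (lt_of_mul_lt_mul_left h2 (Nat.zero_le _)) (not_lt.2 h1)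

set_option maxHeartbeats 2000000 in
open Classical in
lemma ff_upper {E : Type*} [NormedAddCommGroup E] [InnerProductSpace ℝ E] [FiniteDimensional ℝ E]
    (Δ ρ : ℝ) (hΔ : 0 ≤ Δ) (hρ : 0 < ρ) (s : ℕ) (hs : Δ < s) :
    ∀ᶠ n : ℕ in Filter.atTop, ∀ v : Fin n → E, (∀ i, 1 ≤ ‖v i‖) → ∀ x : E,
      (ffN Finset.univ v x (Δ / 2) : ℝ) ≤ (1 + ρ) * s * n.choose (n / 2) := by
  have hs0 : (0:ℝ) < s := lt_of_le_of_lt hΔ hs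
  have hs1 : (1:ℝ) ≤ s := by exact_mod_cast (by exact_mod_cast hs0 : 0 < s)
  set κ : ℝ := (Δ + s) / (2 * s) with hκ
  have hκ0 : 0 < κ := by positivity
  have hκ1 : κ < 1 := by rw [hκ, div_lt_one (by positivity)]; linarith
  have hκs : Δ < κ * s := by
    have : κ * s = (Δ + s) / 2 := by rw [hκ]; field_simp
    rw [this]; linarith
  obtain ⟨η, hηdef⟩ : ∃ η, η = 1 - κ := ⟨_, rfl⟩
  have hη : 0 < η := by linarith
  have hη1 : η ≤ 1 := by linarith
  set ε : ℝ := ρ / (2 * (1 + ρ)) with hε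
  have hε0 : 0 < ε := by positivity
  have hερ : (1 + ρ) * (1 - ε) = 1 + ρ / 2 := by rw [hε]; field_simp; ring
  obtain ⟨T₀, hT₀s, hT₀f, hT₀c⟩ := (isCompact_sphere (0 : E) 1).finite_cover_balls
    (show 0 < η / 4 by positivity)
  set T := hT₀f.toFinset with hT
  obtain ⟨L, hL⟩ := exists_nat_ge (Δ / (η / 4))
  have hL' : 2 * (Δ / 2) ≤ η / 4 * L := by
    rw [div_le_iff₀ (by positivity)] at hL; linarith
  set M : ℝ := (T.card : ℝ) + 1 with hM
  have hM0 : 0 < M := by positivity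
  set K0 : ℝ := (2 * L + 1) ^ 2 with hK0
  have hK00 : 0 < K0 := by positivity
  obtain ⟨n1, hn1⟩ := exists_nat_ge (2 / ρ)
  obtain ⟨n2, hn2⟩ := exists_nat_ge (8 * K0 ^ 2 * M ^ 2 / ε)
  filter_upwards [Filter.eventually_ge_atTop 1, Filter.eventually_ge_atTop n1,
    Filter.eventually_ge_atTop n2] with n hn hnn1 hnn2 v hv x
  have hnR : (1:ℝ) ≤ n := by exact_mod_cast hn
  have hnA : n + 1 ≤ (1 + ρ / 2) * n := by
    have : 2 / ρ ≤ n := hn1.trans (by exact_mod_cast hnn1)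
    rw [div_le_iff₀ hρ] at this
    linarith
  have hnB : 8 * K0 ^ 2 * M ^ 2 ≤ ε * n := by
    have : 8 * K0 ^ 2 * M ^ 2 / ε ≤ n := hn2.trans (by exact_mod_cast hnn2)
    rw [div_le_iff₀ hε0] at this
    linarith
  have hnear : ∀ i, ∃ e ∈ T, ‖v i - ‖v i‖ • e‖ ≤ η / 4 * ‖v i‖ := by
    intro i
    have hvi : 0 < ‖v i‖ := lt_of_lt_of_le one_pos (hv i)
    have h1 : ‖v i‖⁻¹ • v i ∈ Metric.sphere (0 : E) 1 := by
      rw [mem_sphere_zero_iff_norm, norm_smul, norm_inv, norm_norm, inv_mul_cancel₀ hvi.ne']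
    obtain ⟨e, he, h2⟩ := Set.mem_iUnion₂.1 (hT₀c h1)
    refine ⟨e, by simpa [hT] using he, ?_⟩
    rw [Metric.mem_ball, dist_eq_norm] at h2
    have h3 : v i - ‖v i‖ • e = ‖v i‖ • (‖v i‖⁻¹ • v i - e) := by
      rw [smul_sub, smul_smul, mul_inv_cancel₀ hvi.ne', one_smul]
    rw [h3, norm_smul, norm_norm, mul_comm]
    gcongr
  have hTn : ∀ e ∈ T, ‖e‖ = 1 := by
    intro e he
    rw [hT, Set.Finite.mem_toFinset] at he
    exact mem_sphere_zero_iff_norm.1 (hT₀s he)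
  have hne : (Finset.univ : Finset (Fin n)).Nonempty := ⟨⟨0, by omega⟩, Finset.mem_univ _⟩
  obtain ⟨e₁, he₁, hc₁⟩ := ff_pigeon Finset.univ T
    (fun i e => ‖v i - ‖v i‖ • e‖ ≤ η / 4 * ‖v i‖) (fun i _ => hnear i) hne
  have hne₁ := hTn e₁ he₁
  set J : Finset (Fin n) := Finset.univ.filter fun i => ‖v i - ‖v i‖ • e₁‖ ≤ η / 4 * ‖v i‖ with hJ
  set Bd : Finset (Fin n) := Finset.univ.filter fun i => |inner ℝ (v i) e₁| < κ * ‖v i‖ with hBd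
  rw [ff_choose]
  have hbn := ffb_pos n
  rcases le_or_gt (Bd.card : ℝ) (ε * n) with hA | hB
  · -- concentrated case
    set w : Fin n → E := fun i => if 0 ≤ inner ℝ (v i) e₁ then v i else - v i with hw
    obtain ⟨y, hy⟩ := ffN_flip Bdᶜ v w (Δ / 2) (by
      intro i _
      simp only [hw]
      split_ifs <;> simp)
    have hb : ∀ x, ffN Bdᶜ v x (Δ / 2) ≤ s * (Bdᶜ).card.choose ((Bdᶜ).card / 2) := by
      intro x
      rw [hy]
      refine ffN_one Bdᶜ w (x + y) e₁ (Δ / 2) κ s hne₁ ?_ (by linarith) hκ0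
      intro i hi
      have h1 : κ * ‖v i‖ ≤ |inner ℝ (v i) e₁| := by
        simpa [hBd] using hi
      have h2 : κ ≤ κ * ‖v i‖ := le_mul_of_one_le_right hκ0.le (hv i)
      simp only [hw]
      split_ifs with h3
      · rw [abs_of_nonneg h3] at h1; linarith
      · rw [abs_of_neg (not_le.1 h3)] at h1; rw [inner_neg_left]; linarith
    have h1 := ffN_cond Bdᶜ Bd v (Δ / 2) _ disjoint_compl_left hb x
    rw [Finset.union_comm, Finset.union_compl] at h1
    have hcard : (Bdᶜ).card + Bd.card = n := by
      rw [add_comm, Finset.card_add_card_compl, Fintype.card_fin]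
    set m := (Bdᶜ).card with hm
    have h2 : (ffN Finset.univ v x (Δ / 2) : ℝ) ≤ 2 ^ Bd.card * (s * m.choose (m / 2)) := by
      exact_mod_cast h1
    rw [ff_choose] at h2
    have h3 : (2:ℝ) ^ n = 2 ^ m * 2 ^ Bd.card := by rw [← pow_add, hcard]
    have h4 : ffb m ≤ (1 + ρ) * ffb n := by
      have hcR : (m : ℝ) + Bd.card = n := by exact_mod_cast hcard
      have hm1 : (1 - ε) * n ≤ m := by linarith
      have hm2 : (n : ℝ) + 1 ≤ m * (1 + ρ) := by
        have : (1 + ρ) * ((1 - ε) * n) ≤ (1 + ρ) * m := by gcongr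
        rw [← mul_assoc, hερ] at this
        linarith
      have hm0 : (0 : ℝ) < m := by
        by_contra hcon
        have : (m : ℝ) * (1 + ρ) ≤ 0 :=
          mul_nonpos_of_nonpos_of_nonneg (not_lt.1 hcon) (by linarith)
        linarith
      have h5 := ffb_le m n (by omega)
      have h6 : (n + 1) * ffb n ^ 2 ≤ m * (1 + ρ) * ffb n ^ 2 := by gcongr
      have h7 : (m : ℝ) * ffb m ^ 2 ≤ m * ((1 + ρ) * ffb n ^ 2) := by linarith
      have h8 := le_of_mul_le_mul_left h7 hm0
      refine le_of_pow_le_pow_left₀ two_ne_zero (by positivity) ?_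
      have h9 : 0 < ffb n ^ 2 := by positivity
      rw [mul_pow]
      nlinarith
    calc (ffN Finset.univ v x (Δ / 2) : ℝ) ≤ 2 ^ n * s * ffb m := by rw [h3]; linarith
      _ ≤ 2 ^ n * s * ((1 + ρ) * ffb n) := by gcongr
      _ = _ := by ring
  · -- spread case
    have hBne : Bd.Nonempty := by
      rw [← Finset.card_pos]
      have : (0:ℝ) < Bd.card := lt_of_le_of_lt (by positivity) hB
      exact_mod_cast this
    obtain ⟨e₂, he₂, hc₂⟩ := ff_pigeon Bd T
      (fun i e => ‖v i - ‖v i‖ • e‖ ≤ η / 4 * ‖v i‖) (fun i _ => hnear i) hBne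
    have hne₂ := hTn e₂ he₂
    set K : Finset (Fin n) := Bd.filter fun i => ‖v i - ‖v i‖ • e₂‖ ≤ η / 4 * ‖v i‖ with hK
    have hJK : Disjoint J K := by
      rw [Finset.disjoint_left]
      intro i hi hi'
      simp only [hJ, hK, hBd, Finset.mem_filter, Finset.mem_univ, true_and] at hi hi'
      have hvi : 0 < ‖v i‖ := lt_of_lt_of_le one_pos (hv i)
      have h1 := abs_real_inner_le_norm (v i - ‖v i‖ • e₁) e₁
      rw [inner_sub_left, inner_smul_left, real_inner_self_eq_norm_sq, hne₁] at h1
      simp only [conj_trivial, one_pow, mul_one] at h1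
      have h2 := (abs_le.1 (h1.trans hi)).1
      have h3 := (abs_lt.1 hi'.1).2
      have h4 : κ = 1 - η := by linarith
      rw [h4] at h3
      have h5 : 0 < η * ‖v i‖ := by positivity
      linarith
    have hKpos : 0 < K.card := by
      rcases Nat.eq_zero_or_pos K.card with h | h
      · rw [h] at hc₂
        have := Finset.card_pos.2 hBne
        omega
      · exact h
    have h12 : |inner ℝ e₁ e₂| ≤ 1 - 3 * η / 4 := by
      obtain ⟨i, hi⟩ := Finset.card_pos.1 hKpos
      simp only [hK, hBd, Finset.mem_filter, Finset.mem_univ, true_and] at hi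
      have hvi : 0 < ‖v i‖ := lt_of_lt_of_le one_pos (hv i)
      have h1 := abs_real_inner_le_norm (v i - ‖v i‖ • e₂) e₁
      rw [inner_sub_left, inner_smul_left, hne₁, real_inner_comm] at h1
      simp only [conj_trivial, mul_one] at h1
      have h2 := h1.trans hi.2
      have h3 : ‖v i‖ * |inner ℝ e₁ e₂| ≤ ‖v i‖ * (1 - 3 * η / 4) := by
        have h5 := abs_sub_abs_le_abs_sub (‖v i‖ * inner ℝ e₁ e₂) (inner ℝ (v i) e₁)
        have h6 : |‖v i‖ * inner ℝ e₁ e₂| = ‖v i‖ * |inner ℝ e₁ e₂| := by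
          rw [abs_mul, abs_of_pos hvi]
        rw [h6, abs_sub_comm] at h5
        have h7 := hi.1
        have h4 : κ = 1 - η := by linarith
        rw [h4] at h7
        rw [real_inner_comm] at h2 
        have h8 : inner ℝ e₂ e₁ = inner ℝ e₁ e₂ := real_inner_comm _ _
        simp only [real_inner_comm e₁ (v i), h8] at h2 h5 h7
        linarith
      exact le_of_mul_le_mul_left h3 hvi
    have hb := fun x => ffN_two J K hJK v x e₁ e₂ (Δ / 2) η L hne₁ hne₂ hη hη1 h12 hv
      (fun i hi => (Finset.mem_filter.1 hi).2) (fun i hi => (Finset.mem_filter.1 hi).2) hL'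
    have h1 := ffN_cond (J ∪ K) (J ∪ K)ᶜ v (Δ / 2) _ disjoint_compl_right hb x
    rw [Finset.union_compl] at h1
    have hcard : J.card + K.card + ((J ∪ K)ᶜ).card = n := by
      rw [← Finset.card_union_of_disjoint hJK, Finset.card_add_card_compl, Fintype.card_fin]
    set R := (J ∪ K)ᶜ with hR
    have h2 : (ffN Finset.univ v x (Δ / 2) : ℝ) ≤ 2 ^ R.card * (K0 *
        (J.card.choose (J.card / 2) * K.card.choose (K.card / 2))) := by
      rw [hK0]; exact_mod_cast h1
    rw [ff_choose, ff_choose] at h2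
    have h3 : (2:ℝ) ^ n = 2 ^ J.card * 2 ^ K.card * 2 ^ R.card := by
      rw [← pow_add, ← pow_add, hcard]
    have hj := ffb_pos J.card
    have hk := ffb_pos K.card
    have h4 : K0 * (ffb J.card * ffb K.card) ≤ ffb n := by
      have hj1 : (n : ℝ) ≤ M * J.card := by
        have : (n : ℝ) ≤ T.card * J.card := by
          rw [Finset.card_univ, Fintype.card_fin] at hc₁
          exact_mod_cast hc₁
        have h0 : (0:ℝ) ≤ J.card := by positivity
        rw [hM]; linarith
      have hk1 : ε * n ≤ M * K.card := by
        have : (Bd.card : ℝ) ≤ T.card * K.card := by exact_mod_cast hc₂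
        have h0 : (0:ℝ) ≤ K.card := by positivity
        rw [hM]; linarith
      have uj := ffb_upper J.card
      have uk := ffb_upper K.card
      have uj' : n * ffb J.card ^ 2 ≤ M := by
        calc _ ≤ M * J.card * ffb J.card ^ 2 := by gcongr
          _ = M * (J.card * ffb J.card ^ 2) := by ring
          _ ≤ M * 1 := by gcongr
          _ = M := mul_one _
      have uk' : ε * n * ffb K.card ^ 2 ≤ M := by
        calc _ ≤ M * K.card * ffb K.card ^ 2 := by gcongr
          _ = M * (K.card * ffb K.card ^ 2) := by ring
          _ ≤ M * 1 := by gcongr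
          _ = M := mul_one _
      have low := ffb_lower n hn
      have low' : 1 ≤ 8 * n * ffb n ^ 2 := by
        have : (n + 1) * ffb n ^ 2 ≤ (2 * n) * ffb n ^ 2 := by gcongr; linarith
        linarith
      refine le_of_pow_le_pow_left₀ two_ne_zero hbn.le ?_
      have hq : 0 < 8 * ε * (n:ℝ) ^ 2 := by positivity
      refine le_of_mul_le_mul_left ?_ hq
      calc 8 * ε * (n:ℝ) ^ 2 * (K0 * (ffb J.card * ffb K.card)) ^ 2
          = 8 * K0 ^ 2 * ((n * ffb J.card ^ 2) * (ε * n * ffb K.card ^ 2)) := by ring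
        _ ≤ 8 * K0 ^ 2 * (M * M) := by gcongr
        _ ≤ ε * n * 1 := by linarith
        _ ≤ ε * n * (8 * n * ffb n ^ 2) := by gcongr
        _ = _ := by ring
    calc (ffN Finset.univ v x (Δ / 2) : ℝ)
        ≤ 2 ^ n * (K0 * (ffb J.card * ffb K.card)) := by rw [h3]; linarith
      _ ≤ 2 ^ n * ffb n := by gcongr
      _ = 1 * 1 * (2 ^ n * ffb n) := by ring
      _ ≤ _ := by gcongr; linarith

open Classical in
lemma ff_prob {E : Type*} [NormedAddCommGroup E] [InnerProductSpace ℝ E] (n : ℕ)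
    (v : Fin n → E) (x : E) (Δ : ℝ) :
    (((PMF.uniformOfFintype (Fin n → Bool)).toMeasure
        {ω | (∑ j, (if ω j then (1 : ℝ) else -1) • v j) ∈ Metric.closedBall x Δ}).toReal) =
      (ffN Finset.univ v ((1 / 2 : ℝ) • (x + ∑ j, v j)) (Δ / 2) : ℝ) / 2 ^ n := by
  rw [PMF.toMeasure_uniformOfFintype_apply _ (Set.toFinite _).measurableSet]
  rw [ENNReal.toReal_div, ENNReal.toReal_natCast, ENNReal.toReal_natCast]
  have hc : Fintype.card (Fin n → Bool) = 2 ^ n := by simp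
  rw [hc]
  push_cast
  congr 2
  rw [← Set.toFinset_card]
  unfold ffN
  have hsum : ∀ ω : Fin n → Bool, (∑ j, (if ω j then (1 : ℝ) else -1) • v j) =
      (2 : ℝ) • ∑ j ∈ Finset.univ.filter (fun j => ω j = true), v j - ∑ j, v j := by
    intro ω
    rw [Finset.sum_filter, Finset.smul_sum, ← Finset.sum_sub_distrib]
    refine Finset.sum_congr rfl fun j _ => ?_
    split_ifs
    · rw [two_smul, one_smul]; abel
    · simp
  have hiff : ∀ y : E, ‖(2 : ℝ) • y - ∑ j, v j - x‖ ≤ Δ ↔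
      ‖y - (1 / 2 : ℝ) • (x + ∑ j, v j)‖ ≤ Δ / 2 := by
    intro y
    have : (2 : ℝ) • y - ∑ j, v j - x = (2 : ℝ) • (y - (1 / 2 : ℝ) • (x + ∑ j, v j)) := by
      rw [smul_sub, smul_smul]; norm_num; abel
    rw [this, norm_smul, Real.norm_eq_abs, abs_of_pos (by norm_num : (0:ℝ) < 2)]
    constructor <;> intro h <;> linarith
  refine Finset.card_bij' (fun ω _ => Finset.univ.filter (fun j => ω j = true))
    (fun A _ => fun j => decide (j ∈ A)) ?_ ?_ ?_ ?_
  · intro ω hω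
    rw [Set.mem_toFinset, Set.mem_ofPred_eq, Metric.mem_closedBall, dist_eq_norm, hsum, hiff] at hω
    simpa using hω
  · intro A hA
    rw [Set.mem_toFinset, Set.mem_ofPred_eq, Metric.mem_closedBall, dist_eq_norm, hsum, hiff]
    simpa using hA
  · intro ω hω
    ext j; simp
  · intro A hA
    ext j; simp

/-- the window sum -/
def ffW (n s : ℕ) : ℕ := ∑ j ∈ Finset.range s, n.choose (n / 2 + j)

lemma ffW_le_S (n s : ℕ) (h : 2 * s ≤ n) : ffW n s ≤ S n s := by
  unfold S ffW
  rw [min_eq_left (by omega)]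
  have hinj : Function.Injective (fun j => n / 2 + j) := fun a b h => by simpa using h
  rw [← Finset.sum_image (s := Finset.range s) (g := fun j => n / 2 + j) (f := fun i => n.choose i)
    (fun a _ b _ h => hinj h)]
  refine Finset.le_sup (f := fun A => ∑ i ∈ A, n.choose i) ?_
  rw [Finset.mem_powersetCard]
  constructor
  · intro i hi
    simp only [Finset.mem_image, Finset.mem_range] at hi ⊢
    omega
  · rw [Finset.card_image_of_injective _ hinj, Finset.card_range]

lemma ff_S_le (n s : ℕ) : S n s ≤ s * n.choose (n / 2) := by
  unfold S
  refine Finset.sup_le fun A hA => ?_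
  rw [Finset.mem_powersetCard] at hA
  refine (Finset.sum_le_card_nsmul A _ _ fun i _ => Nat.choose_le_middle i n).trans ?_
  rw [hA.2, smul_eq_mul]
  exact Nat.mul_le_mul_right _ (min_le_left _ _)

open Classical in
lemma ffW_le_N {E : Type*} [NormedAddCommGroup E] [InnerProductSpace ℝ E] (n s : ℕ)
    (e : E) (he : ‖e‖ = 1) (Δ : ℝ) (hs : (s : ℝ) ≤ Δ + 1) :
    ffW n s ≤ ffN (Finset.univ : Finset (Fin n)) (fun _ => e)
      ((((n / 2 : ℕ) : ℝ) + ((s : ℝ) - 1) / 2) • e) (Δ / 2) := by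
  unfold ffW ffN
  have h1 : ∑ j ∈ Finset.range s, n.choose (n / 2 + j) = ((Finset.range s).biUnion fun j =>
      Finset.powersetCard (n / 2 + j) (Finset.univ : Finset (Fin n))).card := by
    rw [Finset.card_biUnion]
    · simp
    · intro a _ b _ hab
      exact Finset.pairwise_disjoint_powersetCard _ (by simpa using hab)
  rw [h1]
  refine Finset.card_le_card ?_
  intro A hA
  simp only [Finset.mem_biUnion, Finset.mem_range, Finset.mem_powersetCard] at hA
  obtain ⟨j, hj, _, hA⟩ := hA
  rw [Finset.mem_filter]
  refine ⟨by simp, ?_⟩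
  rw [Finset.sum_const, hA, ← Nat.cast_smul_eq_nsmul ℝ, ← sub_smul, norm_smul, he, mul_one,
    Real.norm_eq_abs, abs_le]
  have hj' : (j : ℝ) + 1 ≤ s := by exact_mod_cast hj
  have hj0 : (0 : ℝ) ≤ j := by positivity
  push_cast
  constructor <;> linarith

lemma ffW_ratio (s : ℕ) (hs : 0 < s) : Filter.Tendsto
    (fun n : ℕ => (ffW n s : ℝ) / (s * n.choose (n / 2))) Filter.atTop (nhds 1) := by
  have h := (tendsto_finsetSum (Finset.range s) fun j _ => ff_ratio j).div_const (s : ℝ)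
  have hs' : (s : ℝ) ≠ 0 := by positivity
  simp only [Finset.sum_const, Finset.card_range, nsmul_eq_mul, mul_one] at h
  rw [div_self hs'] at h
  refine h.congr fun n => ?_
  unfold ffW
  rw [← Finset.sum_div]
  push_cast
  rw [div_div, mul_comm]

theorem frankl_furedi_asymptotic (d : ℕ) (hd : 1 ≤ d) (Δ : ℝ) (hΔ : 0 ≤ Δ) :
    Filter.Tendsto
      (fun n : ℕ => smallBallProb d n Δ / ((2 : ℝ) ^ (-(n : ℝ)) * (S n (⌊Δ⌋₊ + 1) : ℝ)))
      Filter.atTop (nhds 1) := by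
  set s := ⌊Δ⌋₊ + 1 with hs
  have hs1 : Δ < s := by rw [hs]; push_cast; exact Nat.lt_floor_add_one Δ
  have hs2 : (s : ℝ) ≤ Δ + 1 := by
    rw [hs]; push_cast; have := Nat.floor_le hΔ; linarith
  have hs0 : 0 < s := by omega
  have hsR : (0 : ℝ) < s := by exact_mod_cast hs0
  have hCpos : ∀ n : ℕ, (0 : ℝ) < n.choose (n / 2) := fun n => by
    rw [ff_choose]; have := ffb_pos n; positivity
  set e : EuclideanSpace ℝ (Fin d) := EuclideanSpace.single ⟨0, hd⟩ 1 with he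
  have hen : ‖e‖ = 1 := by simp [he]
  -- lower bound
  have hlow : ∀ n : ℕ, (ffW n s : ℝ) / 2 ^ n ≤ smallBallProb d n Δ := by
    intro n
    set c := ((((n / 2 : ℕ) : ℝ) + ((s : ℝ) - 1) / 2) • e) with hc
    have h1 := ffW_le_N n s e hen Δ hs2
    rw [← hc] at h1
    have h2 := ff_prob n (fun _ => e) ((2 : ℝ) • c - ∑ _j : Fin n, e) Δ
    have h3 : (1 / 2 : ℝ) • ((2 : ℝ) • c - ∑ _j : Fin n, e + ∑ _j : Fin n, e) = c := by
      rw [sub_add_cancel, smul_smul]; norm_num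
    rw [h3] at h2
    have h4 : (ffW n s : ℝ) / 2 ^ n ≤ (ffN (Finset.univ : Finset (Fin n)) (fun _ => e) c (Δ / 2) : ℝ) / 2 ^ n := by
      gcongr
    refine h4.trans ?_
    rw [← h2]
    refine le_csSup ⟨1, ?_⟩ ⟨fun _ => e, fun _ => hen.ge, _, rfl⟩
    rintro q ⟨v, _, x, rfl⟩
    exact MeasureTheory.measureReal_le_one
  have hup : ∀ ρ : ℝ, 0 < ρ → ∀ᶠ n : ℕ in Filter.atTop,
      smallBallProb d n Δ ≤ (1 + ρ) * s * n.choose (n / 2) / 2 ^ n := by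
    intro ρ hρ
    filter_upwards [ff_upper (E := EuclideanSpace ℝ (Fin d)) Δ ρ hΔ hρ s hs1] with n hn
    refine Real.sSup_le ?_ (by positivity)
    rintro q ⟨v, hv, x, rfl⟩
    rw [ff_prob]
    have := hn v hv ((1 / 2 : ℝ) • (x + ∑ j, v j))
    gcongr
  have hW := ffW_ratio s hs0
  have hpow : ∀ n : ℕ, (2 : ℝ) ^ (-(n : ℝ)) = (2 ^ n)⁻¹ := fun n => by
    rw [Real.rpow_neg (by norm_num), Real.rpow_natCast]
  have hWpos : ∀ᶠ n : ℕ in Filter.atTop, (0 : ℝ) < ffW n s := by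
    filter_upwards [hW.eventually (lt_mem_nhds one_pos)] with n hn
    by_contra hcon
    have h0 : (ffW n s : ℝ) / (s * n.choose (n / 2)) ≤ 0 :=
      div_nonpos_of_nonpos_of_nonneg (not_lt.1 hcon) (by positivity)
    linarith
  rw [tendsto_order]
  constructor
  · intro a ha
    filter_upwards [hW.eventually (lt_mem_nhds ha), hWpos,
      Filter.eventually_ge_atTop (2 * s)] with n hn hpos hns
    refine hn.trans_le ?_
    have hS1 : (ffW n s : ℝ) ≤ S n s := by exact_mod_cast ffW_le_S n s hns
    have hS2 : (S n s : ℝ) ≤ s * n.choose (n / 2) := by exact_mod_cast ff_S_le n s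
    have hSpos : (0 : ℝ) < S n s := hpos.trans_le hS1
    have hC := hCpos n
    rw [hpow]
    calc (ffW n s : ℝ) / (s * n.choose (n / 2)) ≤ ffW n s / S n s := by gcongr
      _ = (ffW n s / 2 ^ n) / ((2 ^ n)⁻¹ * S n s) := by field_simp
      _ ≤ _ := by gcongr; exact hlow n
  · intro a ha
    set ρ := (a - 1) / 2 with hρ
    have hρ0 : 0 < ρ := by rw [hρ]; linarith
    have hlim : Filter.Tendsto
        (fun n : ℕ => (1 + ρ) * ((ffW n s : ℝ) / (s * n.choose (n / 2)))⁻¹)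
        Filter.atTop (nhds ((1 + ρ) * 1⁻¹)) := (hW.inv₀ one_ne_zero).const_mul _
    have hlt : (1 + ρ) * 1⁻¹ < a := by rw [hρ]; linarith
    filter_upwards [hlim.eventually (gt_mem_nhds hlt), hWpos, hup ρ hρ0,
      Filter.eventually_ge_atTop (2 * s)] with n hn hpos hu hns
    refine lt_of_le_of_lt ?_ hn
    have hS1 : (ffW n s : ℝ) ≤ S n s := by exact_mod_cast ffW_le_S n s hns
    have hSpos : (0 : ℝ) < S n s := hpos.trans_le hS1
    have hC := hCpos n
    rw [hpow]
    calc _ ≤ ((1 + ρ) * s * n.choose (n / 2) / 2 ^ n) / ((2 ^ n)⁻¹ * S n s) := by gcongr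
      _ = (1 + ρ) * s * n.choose (n / 2) / S n s := by field_simp
      _ ≤ (1 + ρ) * s * n.choose (n / 2) / ffW n s := by gcongr
      _ = _ := by rw [inv_div]; ring
end

section
/- Frankl–Füredi conjecture (theorem of Tao–Vu): fix d ≥ 1 and a real Δ with s − 1 ≤ Δ < √((s−1)² + 1), where s := ⌊Δ⌋ + 1. Then for all sufficiently large n, for any multiset of vectors v_1,…,v_n ∈ ℝ^d with |v_i| ≥ 1 and any closed ball B ⊂ ℝ^d of radius Δ, P(ξ_1 v_1 + … + ξ_n v_n ∈ B) ≤ 2^{−n} S(n,s), where ξ_i are i.i.d. Rademacher; moreover equality is attained, so p_d(n,Δ) = 2^{−n} S(n,s). -/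
namespace FF
open Finset

lemma mid_even (m : ℕ) : (2 * m).choose (2 * m / 2) = Nat.centralBinom m := by
  rw [Nat.centralBinom_eq_two_mul_choose]; congr 1; omega

lemma mid_odd (m : ℕ) : 2 * (2 * m + 1).choose ((2 * m + 1) / 2) = Nat.centralBinom (m + 1) := by
  rw [Nat.centralBinom_eq_two_mul_choose]
  have h : (2 * m + 1) / 2 = m := by omega
  rw [h, show 2 * (m + 1) = (2 * m + 1) + 1 by ring, Nat.choose_succ_succ, two_mul]
  congr 1
  exact (Nat.choose_symm_half m).symm

lemma cb_upper (m : ℕ) : (2 * m + 1) * (Nat.centralBinom m) ^ 2 ≤ 16 ^ m := by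
  induction m with
  | zero => simp
  | succ m ih =>
    have h := Nat.succ_mul_centralBinom_succ m
    have h2 : (m + 1) ^ 2 * ((2 * (m + 1) + 1) * (Nat.centralBinom (m + 1)) ^ 2)
        ≤ (m + 1) ^ 2 * 16 ^ (m + 1) := by
      calc (m + 1) ^ 2 * ((2 * (m + 1) + 1) * (Nat.centralBinom (m + 1)) ^ 2)
          = (2 * m + 3) * ((m + 1) * Nat.centralBinom (m + 1)) ^ 2 := by ring
        _ = (4 * ((2 * m + 3) * (2 * m + 1))) * ((2 * m + 1) * (Nat.centralBinom m) ^ 2) := by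
            rw [h]; ring
        _ ≤ (16 * (m + 1) ^ 2) * 16 ^ m := by
            apply Nat.mul_le_mul _ ih
            nlinarith
        _ = (m + 1) ^ 2 * 16 ^ (m + 1) := by ring
    exact Nat.le_of_mul_le_mul_left h2 (by positivity)

lemma cb_lower (m : ℕ) (hm : 1 ≤ m) : 16 ^ m ≤ 4 * m * (Nat.centralBinom m) ^ 2 := by
  induction m, hm using Nat.le_induction with
  | base => simp [Nat.centralBinom, Nat.choose]
  | succ m hm ih =>
    have h := Nat.succ_mul_centralBinom_succ m
    have h2 : (m + 1) * 16 ^ (m + 1) ≤ (m + 1) * (4 * (m + 1) * (Nat.centralBinom (m + 1)) ^ 2) := by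
      calc (m + 1) * 16 ^ (m + 1) = 16 * (m + 1) * 16 ^ m := by ring
        _ ≤ 16 * (m + 1) * (4 * m * (Nat.centralBinom m) ^ 2) := by gcongr
        _ = (16 * (4 * (m * (m + 1)))) * (Nat.centralBinom m) ^ 2 := by ring
        _ ≤ (16 * (2 * m + 1) ^ 2) * (Nat.centralBinom m) ^ 2 := by
            gcongr; nlinarith
        _ = 4 * (2 * (2 * m + 1) * Nat.centralBinom m) ^ 2 := by ring
        _ = 4 * ((m + 1) * Nat.centralBinom (m + 1)) ^ 2 := by rw [h]
        _ = _ := by ring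
    exact Nat.le_of_mul_le_mul_left h2 (by positivity)

lemma mid_upper (n : ℕ) : n * (n.choose (n / 2)) ^ 2 ≤ 4 ^ n := by
  rcases Nat.even_or_odd' n with ⟨m, rfl | rfl⟩
  · rw [mid_even, pow_mul]
    refine le_trans ?_ (cb_upper m)
    gcongr; omega
  · have h := mid_odd m
    have h1 := cb_upper (m + 1)
    rw [← h] at h1
    have : (4:ℕ) ^ (2 * m + 1) * 4 = 16 ^ (m + 1) := by
      rw [← pow_succ, show 2 * m + 1 + 1 = 2 * (m + 1) by ring, pow_mul]; norm_num
    nlinarith [sq_nonneg ((2 * m + 1).choose ((2 * m + 1) / 2))]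

lemma mid_lower (n : ℕ) (hn : 1 ≤ n) : 4 ^ n ≤ 4 * n * (n.choose (n / 2)) ^ 2 := by
  rcases Nat.even_or_odd' n with ⟨m, rfl | rfl⟩
  · rw [mid_even, pow_mul]
    refine le_trans (cb_lower m (by omega)) ?_
    gcongr; omega
  · have h := mid_odd m
    have h1 := cb_lower (m + 1) (by omega)
    rw [← h] at h1
    have : (4:ℕ) ^ (2 * m + 1) * 4 = 16 ^ (m + 1) := by
      rw [← pow_succ, show 2 * m + 1 + 1 = 2 * (m + 1) by ring, pow_mul]; norm_num
    nlinarith [sq_nonneg ((2 * m + 1).choose ((2 * m + 1) / 2)),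
      Nat.zero_le (m * ((2 * m + 1).choose ((2 * m + 1) / 2)) ^ 2)]

lemma choose_mono_half {n k l : ℕ} (hkl : k ≤ l) (hl : l ≤ n / 2) : n.choose k ≤ n.choose l := by
  induction l, hkl using Nat.le_induction with
  | base => rfl
  | succ l _ ih => exact (ih (by omega)).trans (Nat.choose_le_succ_of_lt_half_left (by omega))

/-- start of the middle block -/
def aa (n s : ℕ) : ℕ := (n + 1 - s) / 2

lemma mid_ge {n s k : ℕ} (hs : 1 ≤ s) (hn : s ≤ n) (h1 : aa n s ≤ k) (h2 : k < aa n s + s) :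
    n.choose (aa n s) ≤ n.choose k := by
  unfold aa at *
  by_cases hk : k ≤ n / 2
  · exact choose_mono_half h1 hk
  · rw [← Nat.choose_symm (n := n) (k := k) (by omega)]
    exact choose_mono_half (by omega) (by omega)

lemma off_le {n s k : ℕ} (hs : 1 ≤ s) (hn : s ≤ n) (hkn : k ≤ n)
    (h : ¬ (aa n s ≤ k ∧ k < aa n s + s)) :
    n.choose k ≤ n.choose (aa n s) := by
  unfold aa at *
  by_cases hk : k < (n + 1 - s) / 2
  · exact choose_mono_half hk.le (by omega)
  · rw [← Nat.choose_symm (n := n) (k := k) (by omega)]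
    exact choose_mono_half (by omega) (by omega)

def blk (n s : ℕ) : Finset ℕ := Finset.Ico (aa n s) (aa n s + s)

lemma blk_sub {n s : ℕ} (hs : 1 ≤ s) (hn : s ≤ n) : blk n s ⊆ range (n + 1) := by
  intro k; simp only [blk, mem_Ico, mem_range, aa]; omega

lemma weight {n s : ℕ} (hs : 1 ≤ s) (hn : s ≤ n) (x : ℕ → ℝ) (h0 : ∀ k, 0 ≤ x k)
    (h1 : ∀ k, x k ≤ 1) (hx : ∑ k ∈ range (n + 1), x k ≤ s) :
    ∑ k ∈ range (n + 1), x k * (n.choose k : ℝ) ≤ ∑ k ∈ blk n s, (n.choose k : ℝ) := by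
  have hsub := blk_sub hs hn
  rw [← sum_sdiff hsub] at hx ⊢
  set τ : ℝ := (n.choose (aa n s) : ℝ)
  have e1 : ∑ k ∈ range (n + 1) \ blk n s, x k * (n.choose k : ℝ)
      ≤ ∑ k ∈ range (n + 1) \ blk n s, x k * τ := by
    apply sum_le_sum
    intro k hk
    simp only [mem_sdiff, blk, mem_Ico, mem_range] at hk
    apply mul_le_mul_of_nonneg_left _ (h0 k)
    simp only [τ]
    exact_mod_cast off_le hs hn (by omega) hk.2
  have e2 : ∑ k ∈ blk n s, (1 - x k) * τ ≤ ∑ k ∈ blk n s, (1 - x k) * (n.choose k : ℝ) := by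
    apply sum_le_sum
    intro k hk
    simp only [blk, mem_Ico] at hk
    apply mul_le_mul_of_nonneg_left _ (by linarith [h1 k])
    simp only [τ]
    exact_mod_cast mid_ge hs hn hk.1 hk.2
  simp only [sub_mul, one_mul, sum_sub_distrib, ← sum_mul] at e1 e2
  have hc : ∑ k ∈ blk n s, τ = s * τ := by simp [blk]
  rw [hc] at e2
  have : 0 ≤ τ := by positivity
  nlinarith

lemma S_eq {n s : ℕ} (hs : 1 ≤ s) (hn : s ≤ n) : S n s = ∑ k ∈ blk n s, n.choose k := by
  unfold S
  rw [min_eq_left (by omega)]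
  apply le_antisymm
  · apply Finset.sup_le
    intro A hA
    rw [mem_powersetCard] at hA
    have := weight hs hn (fun k => if k ∈ A then 1 else 0) (by intro k; split_ifs <;> simp)
      (by intro k; split_ifs <;> simp) (by
        rw [← Finset.sum_filter, sum_const]
        simp only [nsmul_eq_mul, mul_one]
        rw [← hA.2]
        exact_mod_cast card_le_card (by intro k hk; exact (mem_filter.1 hk).2))
    simp only [ite_mul, one_mul, zero_mul] at this
    rw [← Finset.sum_filter, Finset.filter_mem_eq_inter, inter_eq_right.2 hA.1] at this
    exact_mod_cast this
  · apply Finset.le_sup (f := fun A => ∑ i ∈ A, n.choose i)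
    rw [mem_powersetCard]
    exact ⟨blk_sub hs hn, by simp [blk]⟩

lemma S_ge {n s : ℕ} (hs : 1 ≤ s) (hn : s ≤ n) : s * n.choose (aa n s) ≤ S n s := by
  rw [S_eq hs hn]
  calc s * n.choose (aa n s) = ∑ k ∈ blk n s, n.choose (aa n s) := by simp [blk]
    _ ≤ _ := by
      apply sum_le_sum
      intro k hk
      simp only [blk, mem_Ico] at hk
      exact mid_ge hs hn hk.1 hk.2

lemma S_ge_mid {n s : ℕ} (hs : 1 ≤ s) (hn : s ≤ n) : n.choose (n / 2) ≤ S n s := by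
  rw [S_eq hs hn]
  apply single_le_sum (f := fun k => n.choose k) (fun _ _ => Nat.zero_le _)
  simp only [blk, mem_Ico, aa]; omega

lemma mid_succ (n : ℕ) : 2 * (n + 1) * n.choose (n / 2) ≤ (n + 2) * (n + 1).choose ((n + 1) / 2) := by
  rcases Nat.even_or_odd' n with ⟨m, rfl | rfl⟩
  · have h := mid_odd m
    have h1 := mid_even m
    have h2 := Nat.succ_mul_centralBinom_succ m
    rw [h1]
    nlinarith
  · have h := mid_odd m
    have h1 := mid_even (m + 1)
    rw [show 2 * m + 1 + 1 = 2 * (m + 1) by ring, h1, ← h]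
    nlinarith

open Filter Topology in
lemma tendsto_ratio (k : ℕ) : ∀ δ : ℝ, 0 < δ → ∀ᶠ n : ℕ in atTop,
    (1 - δ) * 2 ^ k * (n.choose (n / 2) : ℝ) ≤ ((n + k).choose ((n + k) / 2) : ℝ) := by
  induction k with
  | zero =>
    intro δ hδ
    filter_upwards with n
    simp only [pow_zero, add_zero]
    nlinarith [(Nat.cast_nonneg (n.choose (n / 2)) : (0:ℝ) ≤ _)]
  | succ k ih =>
    intro δ hδ
    have h1 := ih (δ / 2) (by linarith)
    filter_upwards [h1, eventually_ge_atTop (Nat.ceil (2 / δ))] with n hn hn2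
    have hn3 : 2 / δ ≤ n := Nat.ceil_le.1 hn2
    have hs := mid_succ (n + k)
    have hs' : 2 * ((n:ℝ) + k + 1) * ((n + k).choose ((n + k) / 2) : ℝ)
      ≤ ((n:ℝ) + k + 2) * ((n + (k + 1)).choose ((n + (k + 1)) / 2) : ℝ) := by exact_mod_cast hs
    set P : ℝ := ((n + k).choose ((n + k) / 2) : ℝ)
    set Q : ℝ := ((n + (k + 1)).choose ((n + (k + 1)) / 2) : ℝ)
    have hP : 0 ≤ P := by positivity
    have hM : 0 ≤ 2 ^ k * (n.choose (n / 2) : ℝ) := by positivity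
    set M := 2 ^ k * (n.choose (n / 2) : ℝ)
    by_cases hδ1 : 1 ≤ δ
    · refine le_trans ?_ (by positivity : (0:ℝ) ≤ Q)
      have : (0:ℝ) ≤ 2 ^ (k + 1) * (n.choose (n / 2) : ℝ) := by positivity
      nlinarith
    push Not at hδ1
    have hd : 2 ≤ δ * n := by
      rw [div_le_iff₀ hδ] at hn3; linarith
    have hk : (0:ℝ) ≤ k := by positivity
    have hnn : (0:ℝ) ≤ n := by positivity
    have e : (1 - δ / 2) * ((n:ℝ) + k + 2) ≤ (n:ℝ) + k + 1 := by nlinarith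
    have e2 : 2 * ((1 - δ / 2) * P) ≤ Q := by
      have hpos : 0 < (n:ℝ) + k + 2 := by positivity
      have : (2 * ((1 - δ / 2) * P)) * ((n:ℝ) + k + 2) ≤ Q * ((n:ℝ) + k + 2) := by
        calc (2 * ((1 - δ / 2) * P)) * ((n:ℝ) + k + 2) 
            = 2 * P * ((1 - δ / 2) * ((n:ℝ) + k + 2)) := by ring
          _ ≤ 2 * P * ((n:ℝ) + k + 1) := by gcongr
          _ ≤ _ := by linarith
      exact le_of_mul_le_mul_right this hpos
    have e3 : (1 - δ / 2) * M ≤ P := by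
      simp only [M]; linarith
    calc (1 - δ) * 2 ^ (k + 1) * (n.choose (n / 2) : ℝ) = 2 * ((1 - δ) * M) := by
          simp only [M]; ring
      _ ≤ 2 * ((1 - δ / 2) * ((1 - δ / 2) * M)) := by nlinarith [mul_nonneg hM (sq_nonneg δ)]
      _ ≤ 2 * ((1 - δ / 2) * P) := by
          have : 0 ≤ 1 - δ / 2 := by linarith
          gcongr
      _ ≤ Q := e2

open Filter Topology in
lemma tendsto_shift (j : ℕ) : ∀ δ : ℝ, 0 < δ → ∀ᶠ n : ℕ in atTop,
    (1 - δ) * (n.choose (n / 2) : ℝ) ≤ (n.choose (n / 2 - j) : ℝ) := by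
  induction j with
  | zero =>
    intro δ hδ
    filter_upwards with n
    simp only [tsub_zero]
    nlinarith [(Nat.cast_nonneg (n.choose (n / 2)) : (0:ℝ) ≤ _)]
  | succ j ih =>
    intro δ hδ
    filter_upwards [ih (δ / 2) (by linarith), eventually_ge_atTop (2 * j + 2),
      eventually_ge_atTop (Nat.ceil ((8 * j + 8) / δ))] with n hn hn1 hn2
    have hn3 : (8 * j + 8) / δ ≤ n := Nat.ceil_le.1 hn2
    have hd : 8 * j + 8 ≤ δ * n := by
      rw [div_le_iff₀ hδ] at hn3; linarith
    by_cases hδ1 : 1 ≤ δ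
    · refine le_trans ?_ (by positivity : (0:ℝ) ≤ _)
      have : (0:ℝ) ≤ (n.choose (n / 2) : ℝ) := by positivity
      nlinarith
    push Not at hδ1
    obtain ⟨l, hl⟩ : ∃ l, n / 2 = l + j + 1 := ⟨n / 2 - j - 1, by omega⟩
    have hr := Nat.choose_succ_right_eq n l
    rw [hl, show l + j + 1 - (j + 1) = l by omega]
    rw [hl, show l + j + 1 - j = l + 1 by omega] at hn
    have hr' : (n.choose (l + 1) : ℝ) * ((l:ℝ) + 1) = (n.choose l : ℝ) * ((n:ℝ) - l) := by
      have : ((n - l : ℕ) : ℝ) = (n:ℝ) - l := Nat.cast_sub (by omega)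
      rw [← this]; exact_mod_cast hr
    set P : ℝ := (n.choose (l + 1) : ℝ)
    set Q : ℝ := (n.choose l : ℝ)
    set M : ℝ := (n.choose (l + j + 1) : ℝ)
    have hP : 0 ≤ P := by positivity
    have hM : 0 ≤ M := by positivity
    have hln : (n:ℝ) ≤ 2 * (l + j + 1) + 1 := by
      have : n ≤ 2 * (l + j + 1) + 1 := by omega
      exact_mod_cast this
    have hln2 : (2:ℝ) * (l + j + 1) ≤ n := by
      have : 2 * (l + j + 1) ≤ n := by omega
      exact_mod_cast this
    have hj : (0:ℝ) ≤ j := by positivity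
    have hpos : 0 < (n:ℝ) - l := by
      have : (0:ℝ) ≤ l := by positivity
      linarith
    have e : (1 - δ / 2) * ((n:ℝ) - l) ≤ l + 1 := by
      have : (0:ℝ) ≤ l := by positivity
      nlinarith [mul_nonneg hδ.le (show (0:ℝ) ≤ (n - l) - n / 2 by linarith)]
    have e2 : (1 - δ / 2) * P ≤ Q := by
      have : ((1 - δ / 2) * P) * ((n:ℝ) - l) ≤ Q * ((n:ℝ) - l) := by
        rw [← hr']
        calc ((1 - δ / 2) * P) * ((n:ℝ) - l) = P * ((1 - δ / 2) * ((n:ℝ) - l)) := by ring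
          _ ≤ _ := by gcongr
      exact le_of_mul_le_mul_right this hpos
    calc (1 - δ) * M ≤ (1 - δ / 2) * ((1 - δ / 2) * M) := by nlinarith [mul_nonneg hM (sq_nonneg δ)]
      _ ≤ (1 - δ / 2) * P := by
          have : 0 ≤ 1 - δ / 2 := by linarith
          gcongr
      _ ≤ Q := e2

open Filter Topology in
lemma asym (k s : ℕ) (hs : 1 ≤ s) : ∀ᶠ n : ℕ in atTop,
    (2 ^ k * s - 1) * n.choose (n / 2) ≤ S (n + k) s := by
  set δ : ℝ := 1 / (2 * (2 ^ k * s)) with hδ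
  have hs0 : (0:ℝ) < 2 ^ k * s := by positivity
  have hδ0 : 0 < δ := by positivity
  have h2 := (tendsto_add_atTop_nat k).eventually (tendsto_shift s δ hδ0)
  filter_upwards [tendsto_ratio k δ hδ0, h2, eventually_ge_atTop s] with n h1 h2 h3
  have h4 := S_ge hs (show s ≤ n + k by omega)
  have h5 : (n + k).choose ((n + k) / 2 - s) ≤ (n + k).choose (aa (n + k) s) :=
    choose_mono_half (by unfold aa; omega) (by unfold aa; omega)
  have h4' : (s:ℝ) * ((n + k).choose (aa (n + k) s) : ℝ) ≤ (S (n + k) s : ℝ) := by exact_mod_cast h4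
  have h5' : ((n + k).choose ((n + k) / 2 - s) : ℝ) ≤ ((n + k).choose (aa (n + k) s) : ℝ) := by
    exact_mod_cast h5
  have hsub : ((2 ^ k * s - 1 : ℕ) : ℝ) = 2 ^ k * s - 1 := by
    rw [Nat.cast_sub (by nlinarith [Nat.one_le_two_pow (n := k)])]; push_cast; ring
  have : ((2 ^ k * s - 1 : ℕ) : ℝ) * (n.choose (n / 2) : ℝ) ≤ (S (n + k) s : ℝ) := by
    rw [hsub]
    refine le_trans ?_ h4'
    have hδ1 : δ ≤ 1 := by
      rw [hδ, div_le_one (by positivity)]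
      have : (1:ℝ) ≤ 2 ^ k := one_le_pow₀ (by norm_num)
      have : (1:ℝ) ≤ s := by exact_mod_cast hs
      nlinarith
    have hδ2 : δ * (2 ^ k * s) = 1 / 2 := by rw [hδ]; field_simp
    set M : ℝ := (n.choose (n / 2) : ℝ)
    have hM : 0 ≤ M := by positivity
    calc (2 ^ k * s - 1) * M ≤ (2 ^ k * s) * (1 - δ) * (1 - δ) * M := by
          gcongr; nlinarith
      _ = s * ((1 - δ) * ((1 - δ) * 2 ^ k * M)) := by ring
      _ ≤ s * ((1 - δ) * ((n + k).choose ((n + k) / 2) : ℝ)) := by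
          have : 0 ≤ 1 - δ := by linarith
          gcongr
      _ ≤ s * ((n + k).choose ((n + k) / 2 - s) : ℝ) := by gcongr
      _ ≤ _ := by gcongr
  exact_mod_cast this
end FF

namespace FF
open Finset

section LYM
variable {α : Type*} [Fintype α] [DecidableEq α]

/-- the chain of a numbering -/
def pre (f : Numbering α) : Finset (Finset α) := univ.filter fun A => f.IsPrefix A

lemma mem_pre {f : Numbering α} {A : Finset α} : A ∈ pre f ↔ f.IsPrefix A := by simp [pre]

lemma pre_sub {f : Numbering α} {A B : Finset α} (hA : A ∈ pre f) (hB : B ∈ pre f)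
    (h : #A ≤ #B) : A ⊆ B :=
  (mem_pre.1 hA).subset_of_card_le_card (mem_pre.1 hB) h

lemma lym (h : Finset α → ℕ) (D : ℕ) (H : ∀ f : Numbering α, ∑ A ∈ pre f, h A ≤ D) :
    ∑ A : Finset α, (h A : ℝ) / ((Fintype.card α).choose #A : ℝ) ≤ D := by
  have h1 : ∑ A : Finset α, h A * ((#A).factorial * (Fintype.card α - #A).factorial)
      ≤ D * (Fintype.card α).factorial := by
    calc ∑ A : Finset α, h A * ((#A).factorial * (Fintype.card α - #A).factorial)
        = ∑ A : Finset α, ∑ f : Numbering α, if f.IsPrefix A then h A else 0 := by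
          apply sum_congr rfl
          intro A _
          rw [← Numbering.card_prefixed, ← sum_filter, sum_const, smul_eq_mul, mul_comm]
          rfl
      _ = ∑ f : Numbering α, ∑ A ∈ pre f, h A := by
          rw [sum_comm]
          apply sum_congr rfl
          intro f _
          rw [← sum_filter]; rfl
      _ ≤ ∑ f : Numbering α, D := sum_le_sum fun f _ => H f
      _ = _ := by simp [mul_comm]
  have h2 : ∑ A : Finset α, (h A : ℝ) / ((Fintype.card α).choose #A : ℝ)
      = (∑ A : Finset α, h A * ((#A).factorial * (Fintype.card α - #A).factorial) : ℕ)
        / ((Fintype.card α).factorial : ℝ) := by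
    push_cast
    rw [sum_div]
    apply sum_congr rfl
    intro A _
    rw [Nat.cast_choose ℝ (card_le_univ A)]
    have := Nat.factorial_ne_zero (#A)
    have := Nat.factorial_ne_zero (Fintype.card α - #A)
    have := Nat.factorial_ne_zero (Fintype.card α)
    field_simp
  rw [h2, div_le_iff₀ (by positivity)]
  exact_mod_cast h1

lemma lym_mid (h : Finset α → ℕ) (D : ℕ) (H : ∀ f : Numbering α, ∑ A ∈ pre f, h A ≤ D) :
    ∑ A : Finset α, h A ≤ D * (Fintype.card α).choose (Fintype.card α / 2) := by
  have h1 := lym h D H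
  set M := (Fintype.card α).choose (Fintype.card α / 2)
  have hM : (0:ℝ) < M := by
    exact_mod_cast Nat.choose_pos (Nat.div_le_self _ _)
  have h2 : (∑ A : Finset α, (h A : ℝ)) / M ≤ D := by
    refine le_trans ?_ h1
    rw [sum_div]
    apply sum_le_sum
    intro A _
    have : (0:ℝ) < ((Fintype.card α).choose #A : ℝ) := by
      exact_mod_cast Nat.choose_pos (card_le_univ A)
    have : ((Fintype.card α).choose #A : ℝ) ≤ M := by exact_mod_cast Nat.choose_le_middle _ _
    gcongr
  rw [div_le_iff₀ hM] at h2
  exact_mod_cast h2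

lemma card_inj_pre {f : Numbering α} {C : Finset (Finset α)} (hC : C ⊆ pre f) :
    Set.InjOn Finset.card (C : Set (Finset α)) := by
  intro A hA B hB hAB
  exact subset_antisymm (pre_sub (hC hA) (hC hB) hAB.le) (pre_sub (hC hB) (hC hA) hAB.ge)

lemma window {T : Finset ℕ} {t : ℕ} (h : ∀ a ∈ T, ∀ b ∈ T, b < a + t) : #T ≤ t := by
  rcases T.eq_empty_or_nonempty with rfl | hT
  · simp
  · have : T ⊆ Ico (T.min' hT) (T.min' hT + t) := by
      intro b hb
      rw [mem_Ico]
      exact ⟨min'_le _ _ hb, h _ (min'_mem _ _) _ hb⟩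
    simpa using card_le_card this

lemma chain_card {f : Numbering α} {C : Finset (Finset α)} (hC : C ⊆ pre f) {t : ℕ}
    (h : ∀ A ∈ C, ∀ B ∈ C, A ⊆ B → #B < #A + t) (ht : 1 ≤ t) : #C ≤ t := by
  rw [← card_image_of_injOn (card_inj_pre hC)]
  apply window
  intro a ha b hb
  rw [mem_image] at ha hb
  obtain ⟨A, hA, rfl⟩ := ha
  obtain ⟨B, hB, rfl⟩ := hb
  rcases le_total #A #B with h1 | h1
  · exact h A hA B hB (pre_sub (hC hA) (hC hB) h1)
  · omega

lemma chain_ends {f : Numbering α} {C : Finset (Finset α)} (hC : C ⊆ pre f) {s : ℕ}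
    (hs : 1 ≤ s) (h : s ≤ #C) : ∃ L ∈ C, ∃ H ∈ C, #L + (s - 1) ≤ #H := by
  by_contra hcon
  push Not at hcon
  have : #C ≤ s - 1 := by
    rw [← card_image_of_injOn (card_inj_pre hC)]
    apply window
    intro a ha b hb
    rw [mem_image] at ha hb
    obtain ⟨A, hA, rfl⟩ := ha
    obtain ⟨B, hB, rfl⟩ := hb
    exact hcon A hA B hB
  omega

lemma erdos (F : Finset (Finset α)) (s : ℕ) (hs : 1 ≤ s) (hn : s ≤ Fintype.card α)
    (h : ∀ A ∈ F, ∀ B ∈ F, A ⊆ B → #B < #A + s) : #F ≤ S (Fintype.card α) s := by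
  set n := Fintype.card α with hnn
  have h1 := lym (fun A => if A ∈ F then 1 else 0) s (by
    intro f
    rw [← sum_filter, sum_const, smul_eq_mul, mul_one]
    apply chain_card (f := f) (filter_subset _ _) _ hs
    intro A hA B hB
    exact h A (mem_filter.1 hA).2 B (mem_filter.1 hB).2)
  rw [← hnn] at h1
  have hfib : ∀ g : ℕ → ℝ, ∑ A ∈ F, g #A = ∑ k ∈ range (n + 1), (#(F.filter fun A => #A = k)) * g k := by
    intro g
    rw [← sum_fiberwise_of_maps_to (t := range (n + 1)) (g := Finset.card)]
    · apply sum_congr rfl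
      intro k _
      rw [sum_congr rfl (g := fun _ => g k)]
      · simp
      · intro A hA; rw [(mem_filter.1 hA).2]
    · intro A _; rw [mem_range]; have := card_le_univ A; omega
  have h2 := weight hs hn (fun k => (#(F.filter fun A => #A = k) : ℝ) / n.choose k)
    (fun k => by positivity) (fun k => by
      apply div_le_one_of_le₀ _ (by positivity)
      have : #(F.filter fun A => #A = k) ≤ #(powersetCard k (univ : Finset α)) := by
        apply card_le_card
        intro A hA
        rw [mem_powersetCard]
        exact ⟨subset_univ _, (mem_filter.1 hA).2⟩
      rw [card_powersetCard, card_univ] at this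
      exact_mod_cast this) (by
      refine le_trans (le_of_eq ?_) h1
      have := hfib (fun k => ((n.choose k : ℝ))⁻¹)
      simp only [div_eq_mul_inv]
      rw [← this]
      simp)
  have h3 := hfib (fun _ => 1)
  have h4 : (#F : ℝ) ≤ S n s := by
    rw [S_eq hs hn]
    push_cast
    refine le_trans (le_of_eq ?_) h2
    simp only [mul_one, sum_const, nsmul_eq_mul] at h3
    rw [h3]
    apply sum_congr rfl
    intro k hk
    have : (n.choose k : ℝ) ≠ 0 := by
      have := Nat.choose_pos (n := n) (k := k) (by rw [mem_range] at hk; omega)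
      positivity
    field_simp
  exact_mod_cast h4
end LYM
end FF

namespace FF
open Finset

section geom
variable {E : Type*} [NormedAddCommGroup E] [InnerProductSpace ℝ E]

/-- `v` points nearly in direction `u` -/
def Near (u : E) (ε : ℝ) (v : E) : Prop := ‖v - ‖v‖ • u‖ ≤ ε * ‖v‖

lemma near_sum {α : Type*} {u : E} {ε : ℝ} {v : α → E} (hv : ∀ a, Near u ε (v a))
    (h1 : ∀ a, 1 ≤ ‖v a‖) (A : Finset α) :
    ∃ L : ℝ, (#A : ℝ) ≤ L ∧ ‖∑ a ∈ A, v a - L • u‖ ≤ ε * L := by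
  refine ⟨∑ a ∈ A, ‖v a‖, ?_, ?_⟩
  · have := card_nsmul_le_sum A (fun a => ‖v a‖) 1 (fun a _ => h1 a)
    simpa using this
  · rw [sum_smul, ← sum_sub_distrib, mul_sum]
    exact norm_sum_le_of_le _ fun a _ => hv a

lemma inner_ge {u q : E} {ε L : ℝ} (hu : ‖u‖ = 1) (hq : ‖q - L • u‖ ≤ ε * L) :
    (1 - ε) * L ≤ inner ℝ u q := by
  have h1 : inner ℝ u q = L + inner ℝ u (q - L • u) := by
    rw [inner_sub_right, inner_smul_right, real_inner_self_eq_norm_sq, hu]; ring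
  have h2 := abs_real_inner_le_norm u (q - L • u)
  rw [hu, one_mul] at h2
  have := neg_abs_le (inner ℝ u (q - L • u))
  linarith

lemma inner_sum_ge {α : Type*} {u : E} (hu : ‖u‖ = 1) {ε : ℝ} (hε : ε < 1) {v : α → E}
    (hv : ∀ a, Near u ε (v a)) (h1 : ∀ a, 1 ≤ ‖v a‖) (A : Finset α) :
    (1 - ε) * #A ≤ inner ℝ u (∑ a ∈ A, v a) := by
  obtain ⟨L, hL, hq⟩ := near_sum hv h1 A
  refine le_trans ?_ (inner_ge hu hq)
  have : 0 ≤ 1 - ε := by linarith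
  gcongr

lemma key_far {u q w : E} {ε L r : ℝ} (hu : ‖u‖ = 1) (h0 : 0 ≤ ε) (hε : ε < 1)
    (hq : ‖q - L • u‖ ≤ ε * L) (hr : 0 ≤ r) (hL : r ≤ L) (hw : 1 ≤ ‖w‖) (hwu : 0 ≤ inner ℝ u w) :
    (1 - ε) * Real.sqrt (r ^ 2 + 1) ≤ ‖q + w‖ := by
  have hL0 : 0 ≤ L := hr.trans hL
  have h1 : Real.sqrt (L ^ 2 + 1) ≤ ‖L • u + w‖ := by
    apply Real.sqrt_le_iff.2 ⟨norm_nonneg _, ?_⟩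
    rw [norm_add_sq_real, norm_smul, hu, inner_smul_left, Real.norm_eq_abs, mul_one, sq_abs]
    have : 0 ≤ L * inner ℝ u w := mul_nonneg hL0 hwu
    simp only [conj_trivial]
    nlinarith
  have h2 : ‖L • u + w‖ ≤ ‖q + w‖ + ‖q - L • u‖ := by
    have : L • u + w = (q + w) - (q - L • u) := by abel
    rw [this]; exact norm_sub_le _ _
  have h3 : L ≤ Real.sqrt (L ^ 2 + 1) := Real.le_sqrt_of_sq_le (by linarith)
  have h4 : Real.sqrt (r ^ 2 + 1) ≤ Real.sqrt (L ^ 2 + 1) := by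
    apply Real.sqrt_le_sqrt; nlinarith
  have h5 : (1 - ε) * Real.sqrt (r ^ 2 + 1) ≤ (1 - ε) * Real.sqrt (L ^ 2 + 1) := by
    have : 0 ≤ 1 - ε := by linarith
    gcongr
  nlinarith

lemma two_dir {u₁ u₂ a b : E} {ε L₁ L₂ : ℝ} (hu1 : ‖u₁‖ = 1) (hu2 : ‖u₂‖ = 1) (hε : 0 < ε)
    (h1 : ‖a - L₁ • u₁‖ ≤ ε / 8 * |L₁|) (h2 : ‖b - L₂ • u₂‖ ≤ ε / 8 * |L₂|)
    (hs : 7 / 8 * ε ≤ ‖u₂ - u₁‖) (ha : 7 / 8 * ε ≤ ‖u₂ + u₁‖) :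
    ε / 4 * (|L₁| + |L₂|) ≤ ‖a + b‖ := by
  have k1 : ‖L₁ • u₁ + L₂ • u₂‖ ≤ ‖a + b‖ + ‖a - L₁ • u₁‖ + ‖b - L₂ • u₂‖ := by
    have : L₁ • u₁ + L₂ • u₂ = (a + b) - (a - L₁ • u₁) - (b - L₂ • u₂) := by abel
    rw [this]
    exact (norm_sub_le _ _).trans (add_le_add_left (norm_sub_le _ _) _)
  have k2 : 3 / 8 * ε * (|L₁| + |L₂|) ≤ ‖L₁ • u₁ + L₂ • u₂‖ := by
    apply le_of_sq_le_sq _ (norm_nonneg _)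
    rw [norm_add_sq_real, norm_smul, norm_smul, hu1, hu2, inner_smul_left, inner_smul_right]
    simp only [conj_trivial, Real.norm_eq_abs, mul_one]
    set c := inner ℝ u₁ u₂
    have e1 : (7 / 8 * ε) ^ 2 ≤ 2 - 2 * c := by
      have : ‖u₂ - u₁‖ ^ 2 = 2 - 2 * c := by
        rw [norm_sub_sq_real, hu1, hu2, real_inner_comm]; ring
      rw [← this]; gcongr
    have e2 : (7 / 8 * ε) ^ 2 ≤ 2 + 2 * c := by
      have : ‖u₂ + u₁‖ ^ 2 = 2 + 2 * c := by
        rw [norm_add_sq_real, hu1, hu2, real_inner_comm]; ring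
      rw [← this]; gcongr
    have e3 : -(|L₁| * |L₂| * |c|) ≤ L₁ * (L₂ * c) := by
      have := neg_abs_le (L₁ * (L₂ * c))
      rw [abs_mul, abs_mul] at this
      linarith
    have e4 : (7 / 8 * ε) ^ 2 ≤ 2 - 2 * |c| := by
      rcases abs_cases c with h | h <;> rw [h.1] <;> linarith
    set x := |L₁|
    set y := |L₂|
    have hx : 0 ≤ x := abs_nonneg _
    have hy : 0 ≤ y := abs_nonneg _
    have hc : 0 ≤ |c| := abs_nonneg _
    have e5 : (1 - |c|) * ((x + y) ^ 2) ≤ 2 * (x ^ 2 + y ^ 2 - 2 * (x * y * |c|)) := by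
      nlinarith [mul_nonneg hc (sq_nonneg (x - y)), sq_nonneg (x - y)]
    have e6 := mul_le_mul_of_nonneg_right e4 (sq_nonneg (x + y))
    nlinarith [mul_nonneg (sq_nonneg ε) (sq_nonneg (x + y))]
  linarith
end geom

section numeric
lemma num1 {s : ℕ} (hs : 1 ≤ s) {Δ ε : ℝ} (hε1 : ε < 1)
    (h : Δ < (1 - ε) * Real.sqrt (((s:ℝ) - 1) ^ 2 + 1)) : Δ < (1 - ε) * s := by
  refine h.trans_le ?_
  have : 0 ≤ 1 - ε := by linarith
  gcongr
  have h1 : (1:ℝ) ≤ s := by exact_mod_cast hs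
  apply Real.sqrt_le_iff.2 ⟨by linarith, by nlinarith⟩

lemma num2 {s t : ℕ} (hs : 1 ≤ s) (ht : s ≤ t) (ht2 : 2 ≤ t) {Δ ε : ℝ} (hε1 : ε < 1)
    (h : Δ < (1 - ε) * Real.sqrt (((s:ℝ) - 1) ^ 2 + 1)) : 2 * Δ < (1 - ε) * (t + s - 1) := by
  have h0 : 0 ≤ 1 - ε := by linarith
  have h3 : Real.sqrt (((s:ℝ) - 1) ^ 2 + 1) ≤ ((t:ℝ) + s - 1) / 2 := by
    have h1 : (1:ℝ) ≤ s := by exact_mod_cast hs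
    have h2 : (s:ℝ) ≤ t := by exact_mod_cast ht
    have h4 : (2:ℝ) ≤ t := by exact_mod_cast ht2
    apply Real.sqrt_le_iff.2 ⟨by linarith, ?_⟩
    rcases hs.eq_or_lt with h5 | h5
    · subst h5; push_cast; nlinarith
    · have h6 : (2:ℝ) ≤ s := by exact_mod_cast h5
      nlinarith
  have := mul_le_mul_of_nonneg_left h3 h0
  linarith
end numeric

section stepB
variable {E : Type*} [NormedAddCommGroup E] [InnerProductSpace ℝ E]
variable {α β : Type*} [Fintype α] [DecidableEq α] [Fintype β] [DecidableEq β]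

lemma stepB (u : E) (hu : ‖u‖ = 1) (ε Δ : ℝ) (h0 : 0 < ε) (hε : ε < 1) (s : ℕ) (hs : 1 ≤ s)
    (h : Δ < (1 - ε) * Real.sqrt (((s:ℝ) - 1) ^ 2 + 1))
    (v : α → E) (w : β → E) (hv : ∀ a, Near u ε (v a)) (hv1 : ∀ a, 1 ≤ ‖v a‖)
    (hw1 : ∀ b, 1 ≤ ‖w b‖) (hwu : ∀ b, 0 ≤ inner ℝ u (w b))
    (F : Finset (Finset α × Finset β))
    (hF : ∀ p ∈ F, ∀ q ∈ F, ‖(∑ a ∈ p.1, v a + ∑ b ∈ p.2, w b)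
      - (∑ a ∈ q.1, v a + ∑ b ∈ q.2, w b)‖ ≤ Δ) :
    #F ≤ (2 ^ (Fintype.card β) * s - 1) * (Fintype.card α).choose (Fintype.card α / 2) ∨
    ∀ p ∈ F, ∀ q ∈ F, p.1 ⊆ q.1 → p.2 ⊆ q.2 → #q.1 + #q.2 < #p.1 + #p.2 + s := by
  have hΔs := num1 hs hε h
  by_cases hc : ∃ f : Numbering α, ∀ B : Finset β, s ≤ #((pre f).filter fun A => (A, B) ∈ F)
  · right
    obtain ⟨f, hf⟩ := hc
    have hex : ∀ B : Finset β, ∃ l r : Finset α, l ∈ pre f ∧ (l, B) ∈ F ∧ r ∈ pre f ∧ (r, B) ∈ F ∧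
        #l + (s - 1) ≤ #r := by
      intro B
      obtain ⟨L, hL, H, hH, hLH⟩ := chain_ends (filter_subset _ _) hs (hf B)
      rw [mem_filter] at hL hH
      exact ⟨L, H, hL.1, hL.2, hH.1, hH.2, hLH⟩
    choose lo hi hlo hloF hhi hhiF hlh using hex
    have step : ∀ (B : Finset β) (b : β), b ∉ B → #(lo (insert b B)) + 1 ≤ #(lo B) := by
      intro B b hb
      by_contra hcon
      have h2 := hlh (insert b B)
      have hle : #(lo B) + (s - 1) ≤ #(hi (insert b B)) := by omega
      have hsub : lo B ⊆ hi (insert b B) := pre_sub (hlo B) (hhi _) (by omega)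
      have h3 := hF _ (hhiF (insert b B)) _ (hloF B)
      simp only at h3
      rw [sum_insert hb, ← sum_sdiff hsub] at h3
      obtain ⟨L, hL, hq⟩ := near_sum hv hv1 (hi (insert b B) \ lo B)
      have hcard := card_sdiff_add_card_eq_card hsub
      have hL2 : (s:ℝ) - 1 ≤ L := by
        refine le_trans ?_ hL
        have : s ≤ #(hi (insert b B) \ lo B) + 1 := by omega
        have : (s:ℝ) ≤ #(hi (insert b B) \ lo B) + 1 := by exact_mod_cast this
        linarith
      have h1s : (1:ℝ) ≤ s := by exact_mod_cast hs
      have := key_far hu h0.le hε hq (by linarith) hL2 (hw1 b) (hwu b)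
      have e : (∑ a ∈ hi (insert b B) \ lo B, v a + ∑ a ∈ lo B, v a + (w b + ∑ b ∈ B, w b)
        - (∑ a ∈ lo B, v a + ∑ b ∈ B, w b)) = ∑ a ∈ hi (insert b B) \ lo B, v a + w b := by abel
      rw [e] at h3
      linarith
    have steps : ∀ (B J : Finset β), Disjoint B J → #(lo (J ∪ B)) + #J ≤ #(lo B) := by
      intro B J
      induction J using Finset.induction_on with
      | empty => intro _; simp
      | insert b J hb ih =>
        intro hd
        rw [disjoint_insert_right] at hd
        have h1 := ih hd.2
        have h2 := step (J ∪ B) b (by rw [mem_union]; tauto)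
        rw [insert_union, card_insert_of_notMem hb]
        omega
    intro p hp q hq h1 h2
    by_contra hcon
    have hc1 := card_sdiff_add_card_eq_card h1
    have hc2 := card_sdiff_add_card_eq_card h2
    set G := q.1 \ p.1 with hG
    set J := q.2 \ p.2 with hJ
    have hts : s ≤ #G + #J := by omega
    have hJB : J ∪ p.2 = q.2 := sdiff_union_of_subset h2
    have hd : Disjoint p.2 J := disjoint_sdiff
    have hst := steps p.2 J hd
    rw [hJB] at hst
    have hl := hlh p.2
    have hsub : lo q.2 ⊆ hi p.2 := pre_sub (hlo _) (hhi _) (by omega)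
    have hc3 := card_sdiff_add_card_eq_card hsub
    have n1 := hF q hq p hp
    rw [← sum_sdiff h1, ← sum_sdiff h2, ← hG, ← hJ] at n1
    have e1 : (∑ a ∈ G, v a + ∑ a ∈ p.1, v a + (∑ b ∈ J, w b + ∑ b ∈ p.2, w b)
      - (∑ a ∈ p.1, v a + ∑ b ∈ p.2, w b)) = ∑ a ∈ G, v a + ∑ b ∈ J, w b := by abel
    rw [e1] at n1
    have i1 := (real_inner_le_norm u (∑ a ∈ G, v a + ∑ b ∈ J, w b))
    rw [hu, one_mul, inner_add_right] at i1
    have g1 := inner_sum_ge hu hε hv hv1 G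
    by_cases ht : 2 ≤ #G + #J
    · have n2 := hF _ (hhiF p.2) _ (hloF q.2)
      simp only at n2
      rw [← sum_sdiff h2, ← sum_sdiff hsub, ← hJ] at n2
      have e2 : (∑ a ∈ hi p.2 \ lo q.2, v a + ∑ a ∈ lo q.2, v a + ∑ b ∈ p.2, w b
        - (∑ a ∈ lo q.2, v a + (∑ b ∈ J, w b + ∑ b ∈ p.2, w b)))
        = ∑ a ∈ hi p.2 \ lo q.2, v a - ∑ b ∈ J, w b := by abel
      rw [e2] at n2
      have i2 := (real_inner_le_norm u (∑ a ∈ hi p.2 \ lo q.2, v a - ∑ b ∈ J, w b))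
      rw [hu, one_mul, inner_sub_right] at i2
      have g2 := inner_sum_ge hu hε hv hv1 (hi p.2 \ lo q.2)
      have hcc : #J + s ≤ #(hi p.2 \ lo q.2) + 1 := by omega
      have hcc' : (#J : ℝ) + s - 1 ≤ #(hi p.2 \ lo q.2) := by
        have : (#J : ℝ) + s ≤ #(hi p.2 \ lo q.2) + 1 := by exact_mod_cast hcc
        linarith
      have g3 : (1 - ε) * ((#J : ℝ) + s - 1) ≤ (1 - ε) * #(hi p.2 \ lo q.2) := by
        have : 0 ≤ 1 - ε := by linarith
        gcongr
      have := num2 hs hts ht hε h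
      push_cast at this
      linarith
    · have hs1 : s = 1 := by omega
      subst hs1
      by_cases hJ0 : #J = 0
      · have hG1 : #G = 1 := by omega
        rw [card_eq_zero] at hJ0
        rw [hJ0, sum_empty, inner_zero_right] at i1
        rw [hJ0, sum_empty] at n1
        rw [hG1] at g1
        linarith
      · have hG0 : #G = 0 := by omega
        have hJ1 : #J = 1 := by omega
        obtain ⟨b, hb⟩ := card_eq_one.1 hJ1
        rw [card_eq_zero] at hG0
        rw [hb, hG0, sum_empty, sum_singleton, zero_add] at n1
        have := hw1 b
        push_cast at hΔs
        linarith
  · left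
    push Not at hc
    have hcard : #F = ∑ A : Finset α, ∑ B : Finset β, if (A, B) ∈ F then 1 else 0 := by
      rw [← Fintype.sum_prod_type' (f := fun A B => if (A, B) ∈ F then 1 else 0)]
      simp
    rw [hcard]
    apply lym_mid (fun A => ∑ B : Finset β, if (A, B) ∈ F then 1 else 0)
    intro f
    rw [sum_comm]
    obtain ⟨B₀, hB₀⟩ := hc f
    have hle : ∀ B : Finset β, (∑ A ∈ pre f, if (A, B) ∈ F then 1 else 0) ≤ s := by
      intro B
      rw [← sum_filter, sum_const, smul_eq_mul, mul_one]
      apply chain_card (f := f) (filter_subset _ _) _ hs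
      intro A hA A' hA' hsub
      by_contra hcon
      have n1 := hF _ (mem_filter.1 hA').2 _ (mem_filter.1 hA).2
      simp only at n1
      rw [← sum_sdiff hsub, add_sub_add_right_eq_sub, add_sub_cancel_right] at n1
      have i1 := (real_inner_le_norm u (∑ a ∈ A' \ A, v a))
      rw [hu, one_mul] at i1
      have g1 := inner_sum_ge hu hε hv hv1 (A' \ A)
      have hc1 := card_sdiff_add_card_eq_card hsub
      have : (s:ℝ) ≤ #(A' \ A) := by
        have : s ≤ #(A' \ A) := by omega
        exact_mod_cast this
      have g3 : (1 - ε) * (s:ℝ) ≤ (1 - ε) * #(A' \ A) := by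
        have : 0 ≤ 1 - ε := by linarith
        gcongr
      linarith
    have hlt : ∑ B : Finset β, (∑ A ∈ pre f, if (A, B) ∈ F then 1 else 0) < ∑ B : Finset β, s := by
      apply sum_lt_sum (fun B _ => hle B)
      refine ⟨B₀, mem_univ _, ?_⟩
      rw [← sum_filter, sum_const, smul_eq_mul, mul_one]
      exact hB₀
    rw [sum_const, card_univ, Fintype.card_finset, smul_eq_mul] at hlt
    omega
end stepB

section stepA
variable {E : Type*} [NormedAddCommGroup E] [InnerProductSpace ℝ E]
variable {α β γ : Type*} [Fintype α] [DecidableEq α] [Fintype β] [DecidableEq β]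
  [Fintype γ] [DecidableEq γ]

lemma near_diff {u : E} {ε : ℝ} {v : α → E} (hv : ∀ a, Near u ε (v a))
    (h1 : ∀ a, 1 ≤ ‖v a‖) {f : Numbering α} {A B : Finset α} (hA : A ∈ pre f) (hB : B ∈ pre f) :
    ∃ L : ℝ, (#B : ℝ) ≤ #A + |L| ∧ ‖∑ a ∈ B, v a - ∑ a ∈ A, v a - L • u‖ ≤ ε * |L| := by
  rcases le_total #A #B with hc | hc
  · have hsub := pre_sub hA hB hc
    obtain ⟨L, hL, hq⟩ := near_sum hv h1 (B \ A)
    have h0 : 0 ≤ L := le_trans (by positivity) hL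
    refine ⟨L, ?_, ?_⟩
    · rw [abs_of_nonneg h0, ← card_sdiff_add_card_eq_card hsub]; push_cast; linarith
    · rw [abs_of_nonneg h0, ← sum_sdiff hsub, add_sub_cancel_right]; exact hq
  · have hsub := pre_sub hB hA hc
    obtain ⟨L, hL, hq⟩ := near_sum hv h1 (A \ B)
    have h0 : 0 ≤ L := le_trans (by positivity) hL
    refine ⟨-L, ?_, ?_⟩
    · have : (#B : ℝ) ≤ #A := by exact_mod_cast hc
      linarith [abs_nonneg (-L)]
    · have e : ∑ a ∈ B, v a - (∑ a ∈ A \ B, v a + ∑ a ∈ B, v a) - (-L) • u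
          = -(∑ a ∈ A \ B, v a - L • u) := by rw [neg_smul]; abel
      rw [abs_neg, abs_of_nonneg h0, ← sum_sdiff hsub, e, norm_neg]
      exact hq

lemma stepA (u₁ u₂ : E) (hu1 : ‖u₁‖ = 1) (hu2 : ‖u₂‖ = 1) (ε Δ : ℝ) (h0 : 0 < ε)
    (hs : 7 / 8 * ε ≤ ‖u₂ - u₁‖) (ha : 7 / 8 * ε ≤ ‖u₂ + u₁‖) (M : ℕ) (hM : 4 * Δ / ε < M)
    (v : α → E) (w : β → E) (z : γ → E)
    (hv : ∀ a, Near u₁ (ε / 8) (v a)) (hv1 : ∀ a, 1 ≤ ‖v a‖)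
    (hw : ∀ a, Near u₂ (ε / 8) (w a)) (hw1 : ∀ b, 1 ≤ ‖w b‖)
    (F : Finset (Finset α × Finset β × Finset γ))
    (hF : ∀ p ∈ F, ∀ q ∈ F, ‖(∑ a ∈ p.1, v a + ∑ b ∈ p.2.1, w b + ∑ b ∈ p.2.2, z b)
      - (∑ a ∈ q.1, v a + ∑ b ∈ q.2.1, w b + ∑ b ∈ q.2.2, z b)‖ ≤ Δ) :
    #F ≤ M ^ 2 * 2 ^ (Fintype.card γ) * (Fintype.card β).choose (Fintype.card β / 2)
        * (Fintype.card α).choose (Fintype.card α / 2) := by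
  have hcard : #F = ∑ A : Finset α, ∑ B : Finset β, ∑ C : Finset γ,
      if (A, B, C) ∈ F then 1 else 0 := by
    simp_rw [← Fintype.sum_prod_type' (f := fun B C => if (_, B, C) ∈ F then 1 else 0)]
    rw [← Fintype.sum_prod_type' (f := fun A B => if (A, B) ∈ F then 1 else 0)]
    simp
  rw [hcard]
  apply lym_mid (fun A => ∑ B : Finset β, ∑ C : Finset γ, if (A, B, C) ∈ F then 1 else 0)
  intro f
  rw [sum_comm]
  apply lym_mid (fun B => ∑ A ∈ pre f, ∑ C : Finset γ, if (A, B, C) ∈ F then 1 else 0)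
  intro g
  have : ∑ B ∈ pre g, ∑ A ∈ pre f, ∑ C : Finset γ, (if (A, B, C) ∈ F then 1 else 0)
      = ∑ C : Finset γ, ∑ B ∈ pre g, ∑ A ∈ pre f, (if (A, B, C) ∈ F then 1 else 0) := by
    rw [sum_comm (s := univ)]
    apply sum_congr rfl
    intro B _
    rw [sum_comm]
  rw [this]
  have hb : ∀ C : Finset γ, ∑ B ∈ pre g, ∑ A ∈ pre f, (if (A, B, C) ∈ F then 1 else 0) ≤ M ^ 2 := by
    intro C
    rw [← sum_product' (f := fun B A => if (A, B, C) ∈ F then 1 else 0), ← sum_filter, sum_const,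
      smul_eq_mul, mul_one]
    set T := (pre g ×ˢ pre f).filter fun x => (x.2, x.1, C) ∈ F with hT
    have hmem : ∀ x ∈ T, x.1 ∈ pre g ∧ x.2 ∈ pre f ∧ (x.2, x.1, C) ∈ F := by
      intro x hx
      rw [hT, mem_filter, mem_product] at hx
      exact ⟨hx.1.1, hx.1.2, hx.2⟩
    have hkey : ∀ x ∈ T, ∀ y ∈ T, #y.1 < #x.1 + M ∧ #y.2 < #x.2 + M := by
      intro x hx y hy
      obtain ⟨x1, x2, x3⟩ := hmem x hx
      obtain ⟨y1, y2, y3⟩ := hmem y hy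
      obtain ⟨L₁, hL1, hq1⟩ := near_diff hv hv1 x2 y2
      obtain ⟨L₂, hL2, hq2⟩ := near_diff hw hw1 x1 y1
      have n := hF _ y3 _ x3
      have k := two_dir hu1 hu2 h0 hq1 hq2 hs ha
      have e : ∑ a ∈ y.2, v a - ∑ a ∈ x.2, v a + (∑ a ∈ y.1, w a - ∑ a ∈ x.1, w a)
        = (∑ a ∈ y.2, v a + ∑ b ∈ y.1, w b + ∑ b ∈ C, z b)
      - (∑ a ∈ x.2, v a + ∑ b ∈ x.1, w b + ∑ b ∈ C, z b) := by abel
      rw [e] at k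
      have k2 := k.trans n
      have k3 : |L₁| + |L₂| < M := by
        refine lt_of_le_of_lt ?_ hM
        rw [le_div_iff₀ h0]; linarith
      have := abs_nonneg L₁
      have := abs_nonneg L₂
      constructor
      · have : (#y.1 : ℝ) < #x.1 + M := by linarith
        exact_mod_cast this
      · have : (#y.2 : ℝ) < #x.2 + M := by linarith
        exact_mod_cast this
    have c1 : #(T.image Prod.fst) ≤ M := by
      have hC : T.image Prod.fst ⊆ pre g := by
        intro B hB; rw [mem_image] at hB; obtain ⟨x, hx, rfl⟩ := hB; exact (hmem x hx).1
      rw [← card_image_of_injOn (card_inj_pre hC)]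
      apply window
      intro a ha b hb
      simp only [mem_image] at ha hb
      obtain ⟨_, ⟨x, hx, rfl⟩, rfl⟩ := ha
      obtain ⟨_, ⟨y, hy, rfl⟩, rfl⟩ := hb
      exact (hkey x hx y hy).1
    have c2 : #(T.image Prod.snd) ≤ M := by
      have hC : T.image Prod.snd ⊆ pre f := by
        intro B hB; rw [mem_image] at hB; obtain ⟨x, hx, rfl⟩ := hB; exact (hmem x hx).2.1
      rw [← card_image_of_injOn (card_inj_pre hC)]
      apply window
      intro a ha b hb
      simp only [mem_image] at ha hb
      obtain ⟨_, ⟨x, hx, rfl⟩, rfl⟩ := ha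
      obtain ⟨_, ⟨y, hy, rfl⟩, rfl⟩ := hb
      exact (hkey x hx y hy).2
    calc #T ≤ #(T.image Prod.fst ×ˢ T.image Prod.snd) := card_le_card subset_product
      _ ≤ M ^ 2 := by rw [card_product, sq]; exact Nat.mul_le_mul c1 c2
  calc _ ≤ ∑ C : Finset γ, M ^ 2 := sum_le_sum fun C _ => hb C
    _ = _ := by simp [mul_comm]
end stepA
end FF

namespace FF
open Finset

lemma pigeon {ι κ : Type*} [DecidableEq κ] (T : Finset ι) (U : Finset κ) (c : ι → κ)
    (hU : U.Nonempty) (hc : ∀ i, c i ∈ U) : ∃ u ∈ U, #T ≤ #U * #(T.filter fun i => c i = u) := by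
  by_contra hcon
  push Not at hcon
  have h1 : ∑ u ∈ U, #U * #(T.filter fun i => c i = u) < ∑ u ∈ U, #T :=
    sum_lt_sum_of_nonempty hU hcon
  rw [← mul_sum, ← card_eq_sum_card_fiberwise (fun i _ => hc i)] at h1
  simp at h1

variable {E : Type*} [NormedAddCommGroup E] [InnerProductSpace ℝ E]

lemma exists_net [FiniteDimensional ℝ E] (δ : ℝ) (hδ : 0 < δ) : ∃ U : Finset E, (∀ u ∈ U, ‖u‖ = 1) ∧
    ∀ v : E, 1 ≤ ‖v‖ → ∃ u ∈ U, Near u δ v := by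
  have : ProperSpace E := FiniteDimensional.proper ℝ E
  obtain ⟨t, ht, hfin, hcov⟩ := (isCompact_sphere (0:E) 1).finite_cover_balls hδ
  refine ⟨hfin.toFinset, ?_, ?_⟩
  · intro u hu
    have := ht (hfin.mem_toFinset.1 hu)
    simpa using this
  · intro v hv
    have hv0 : 0 < ‖v‖ := by linarith
    have hmem : ‖v‖⁻¹ • v ∈ Metric.sphere (0:E) 1 := by
      rw [mem_sphere_zero_iff_norm, norm_smul, norm_inv, norm_norm, inv_mul_cancel₀ hv0.ne']
    have := hcov hmem
    simp only [Set.mem_iUnion, Metric.mem_ball, dist_eq_norm, exists_prop] at this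
    obtain ⟨u, hu, hd⟩ := this
    refine ⟨u, hfin.mem_toFinset.2 hu, ?_⟩
    unfold Near
    have e : v - ‖v‖ • u = ‖v‖ • (‖v‖⁻¹ • v - u) := by
      rw [smul_sub, smul_smul, mul_inv_cancel₀ hv0.ne', one_smul]
    rw [e, norm_smul, norm_norm, mul_comm]
    gcongr

lemma split2 {n : ℕ} (p : Fin n → Prop) [DecidablePred p] {M : Type*} [AddCommMonoid M]
    (v : Fin n → M) (A : Finset (Fin n)) :
    ∑ i ∈ A, v i = ∑ a ∈ A.subtype p, v a + ∑ a ∈ A.subtype (fun i => ¬ p i), v a := by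
  rw [sum_subtype_eq_sum_filter, sum_subtype_eq_sum_filter, sum_filter_add_sum_filter_not]

lemma split2_inj {n : ℕ} (p : Fin n → Prop) [DecidablePred p] {A B : Finset (Fin n)}
    (h1 : A.subtype p = B.subtype p) (h2 : A.subtype (fun i => ¬ p i) = B.subtype (fun i => ¬ p i)) :
    A = B := by
  ext i
  by_cases hi : p i
  · have := congrArg (fun X => (⟨i, hi⟩ : {i // p i}) ∈ X) h1
    simpa using this
  · have := congrArg (fun X => (⟨i, hi⟩ : {i // ¬ p i}) ∈ X) h2
    simpa using this

lemma sum_flip {n : ℕ} (T A : Finset (Fin n)) (v : Fin n → E) :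
    ∑ i ∈ symmDiff A T, (if i ∈ T then - v i else v i) = ∑ i ∈ A, v i - ∑ i ∈ T, v i := by
  have h : ∀ (X : Finset (Fin n)) (g : Fin n → E), ∑ i ∈ X, g i = ∑ i, if i ∈ X then g i else 0 := by
    intro X g; simp
  rw [h (symmDiff A T), h A, h T, ← sum_sub_distrib]
  apply sum_congr rfl
  intro i _
  by_cases h1 : i ∈ A <;> by_cases h2 : i ∈ T <;> simp [h1, h2, mem_symmDiff]

/-- all but few vectors near a line -/
lemma caseB {n : ℕ} (u : E) (hu : ‖u‖ = 1) (ε Δ : ℝ) (h0 : 0 < ε) (hε : ε < 1) (s : ℕ) (hs : 1 ≤ s)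
    (hn : s ≤ n) (h : Δ < (1 - ε) * Real.sqrt (((s:ℝ) - 1) ^ 2 + 1))
    (v : Fin n → E) (hv1 : ∀ i, 1 ≤ ‖v i‖) (bad : Finset (Fin n))
    (hbad : ∀ i, i ∉ bad → Near u ε (v i) ∨ Near u ε (- v i))
    (hnum : (2 ^ #bad * s - 1) * (n - #bad).choose ((n - #bad) / 2) ≤ S n s)
    (F : Finset (Finset (Fin n)))
    (hF : ∀ A ∈ F, ∀ B ∈ F, ‖∑ i ∈ A, v i - ∑ i ∈ B, v i‖ ≤ Δ) : #F ≤ S n s := by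
  classical
  set T : Finset (Fin n) := univ.filter fun i =>
    (i ∉ bad ∧ ¬ Near u ε (v i)) ∨ (i ∈ bad ∧ inner ℝ u (v i) < 0) with hT
  set v' : Fin n → E := fun i => if i ∈ T then - v i else v i with hv'
  have hv'1 : ∀ i, 1 ≤ ‖v' i‖ := by
    intro i
    simp only [hv']
    split_ifs
    · rw [norm_neg]; exact hv1 i
    · exact hv1 i
  have hnear : ∀ i, i ∉ bad → Near u ε (v' i) := by
    intro i hi
    simp only [hv']
    split_ifs with hiT
    · simp only [hT, mem_filter, mem_univ, true_and] at hiT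
      have := hbad i hi
      tauto
    · simp only [hT, mem_filter, mem_univ, true_and] at hiT
      tauto
  have hpos : ∀ i, i ∈ bad → 0 ≤ inner ℝ u (v' i) := by
    intro i hi
    simp only [hv']
    split_ifs with hiT
    · simp only [hT, mem_filter, mem_univ, true_and] at hiT
      rw [inner_neg_right]
      have : inner ℝ u (v i) < 0 := by tauto
      linarith
    · simp only [hT, mem_filter, mem_univ, true_and] at hiT
      by_contra hc
      push Not at hc
      tauto
  set F' := F.image (fun A => symmDiff A T) with hF'
  have hcF' : #F' = #F := card_image_of_injective _ (symmDiff_left_injective T)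
  have hd' : ∀ A ∈ F', ∀ B ∈ F', ‖∑ i ∈ A, v' i - ∑ i ∈ B, v' i‖ ≤ Δ := by
    intro A hA B hB
    rw [hF', mem_image] at hA hB
    obtain ⟨A, hA, rfl⟩ := hA
    obtain ⟨B, hB, rfl⟩ := hB
    simp only [hv']
    rw [sum_flip, sum_flip, sub_sub_sub_cancel_right]
    exact hF A hA B hB
  rw [← hcF']
  set φ : Finset (Fin n) → Finset {i // ¬ i ∈ bad} × Finset {i // i ∈ bad} :=
    fun A => (A.subtype _, A.subtype _) with hφ
  have hφinj : Function.Injective φ := by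
    intro A B hAB
    simp only [hφ, Prod.mk.injEq] at hAB
    exact split2_inj (fun i => i ∈ bad) hAB.2 hAB.1
  have hstep := stepB u hu ε Δ h0 hε s hs h (fun i : {i // ¬ i ∈ bad} => v' i)
    (fun i : {i // i ∈ bad} => v' i) (fun i => hnear i i.2) (fun i => hv'1 i) (fun i => hv'1 i)
    (fun i => hpos i i.2) (F'.image φ) (by
      intro p hp q hq
      rw [mem_image] at hp hq
      obtain ⟨A, hA, rfl⟩ := hp
      obtain ⟨B, hB, rfl⟩ := hq
      have := hd' A hA B hB
      rw [split2 (fun i => i ∈ bad) v' A, split2 (fun i => i ∈ bad) v' B] at this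
      simp only [hφ]
      rw [add_comm (∑ a ∈ A.subtype (fun i => ¬ i ∈ bad), v' a),
        add_comm (∑ a ∈ B.subtype (fun i => ¬ i ∈ bad), v' a)]
      exact this)
  rw [card_image_of_injective _ hφinj] at hstep
  rcases hstep with h1 | h1
  · refine h1.trans ?_
    have e1 : Fintype.card {i // i ∈ bad} = #bad := Fintype.card_coe bad
    have e2 : Fintype.card {i // ¬ i ∈ bad} = n - #bad := by
      rw [Fintype.card_subtype_compl, e1, Fintype.card_fin]
    rw [e1, e2]
    exact hnum
  · have := erdos F' s hs (by simpa using hn) (by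
      intro A hA B hB hAB
      have h2 := h1 (φ A) (mem_image_of_mem _ hA) (φ B) (mem_image_of_mem _ hB)
        (by intro i; simp only [hφ, mem_subtype]; exact fun h => hAB h)
        (by intro i; simp only [hφ, mem_subtype]; exact fun h => hAB h)
      simp only [hφ] at h2
      have cA := split2 (fun i => i ∈ bad) (fun _ => 1) A
      have cB := split2 (fun i => i ∈ bad) (fun _ => 1) B
      simp only [sum_const, smul_eq_mul, mul_one] at cA cB
      omega)
    simpa using this

/-- two well separated groups -/
lemma caseA {n : ℕ} (u₁ u₂ : E) (hu1 : ‖u₁‖ = 1) (hu2 : ‖u₂‖ = 1) (ε Δ : ℝ) (h0 : 0 < ε)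
    (hs : 7 / 8 * ε ≤ ‖u₂ - u₁‖) (ha : 7 / 8 * ε ≤ ‖u₂ + u₁‖) (M : ℕ) (hM : 4 * Δ / ε < M)
    (v : Fin n → E) (hv1 : ∀ i, 1 ≤ ‖v i‖) (G₁ G₂ : Finset (Fin n)) (hG : Disjoint G₁ G₂)
    (h1 : ∀ i ∈ G₁, Near u₁ (ε / 8) (v i)) (h2 : ∀ i ∈ G₂, Near u₂ (ε / 8) (v i))
    (F : Finset (Finset (Fin n)))
    (hF : ∀ A ∈ F, ∀ B ∈ F, ‖∑ i ∈ A, v i - ∑ i ∈ B, v i‖ ≤ Δ) :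
    #F ≤ M ^ 2 * 2 ^ (n - #G₁ - #G₂) * (#G₂).choose (#G₂ / 2) * (#G₁).choose (#G₁ / 2) := by
  classical
  set φ : Finset (Fin n) → Finset {i // i ∈ G₁} × Finset {i // i ∈ G₂} ×
    Finset {i // i ∉ G₁ ∪ G₂} :=
    fun A => (A.subtype _, A.subtype _, A.subtype _) with hφ
  have hφinj : Function.Injective φ := by
    intro A B hAB
    simp only [hφ, Prod.mk.injEq] at hAB
    obtain ⟨a1, a2, a3⟩ := hAB
    ext i
    by_cases hi : i ∈ G₁
    · have := congrArg (fun X => (⟨i, hi⟩ : {i // i ∈ G₁}) ∈ X) a1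
      simpa using this
    by_cases hi2 : i ∈ G₂
    · have := congrArg (fun X => (⟨i, hi2⟩ : {i // i ∈ G₂}) ∈ X) a2
      simpa using this
    · have := congrArg (fun X => (⟨i, by simp [hi, hi2]⟩ : {i // i ∉ G₁ ∪ G₂}) ∈ X) a3
      simpa using this
  have hsum : ∀ A : Finset (Fin n), ∑ i ∈ A, v i = ∑ a ∈ A.subtype (fun i => i ∈ G₁), v a
      + ∑ a ∈ A.subtype (fun i => i ∈ G₂), v a
      + ∑ a ∈ A.subtype (fun i => i ∉ G₁ ∪ G₂), v a := by
    intro A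
    rw [split2 (fun i => i ∈ G₁ ∪ G₂) v A]
    congr 1
    rw [sum_subtype_eq_sum_filter, sum_subtype_eq_sum_filter, sum_subtype_eq_sum_filter,
      ← sum_union]
    · congr 1
      ext i; simp only [mem_filter, mem_union]; tauto
    · rw [Finset.disjoint_left] at hG ⊢
      intro i hi hi2
      exact hG (mem_filter.1 hi).2 (mem_filter.1 hi2).2
  have hstep := stepA u₁ u₂ hu1 hu2 ε Δ h0 hs ha M hM (fun i : {i // i ∈ G₁} => v i)
    (fun i : {i // i ∈ G₂} => v i) (fun i : {i // i ∉ G₁ ∪ G₂} => v i)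
    (fun i => h1 i i.2) (fun i => hv1 i) (fun i => h2 i i.2) (fun i => hv1 i) (F.image φ) (by
      intro p hp q hq
      rw [mem_image] at hp hq
      obtain ⟨A, hA, rfl⟩ := hp
      obtain ⟨B, hB, rfl⟩ := hq
      have := hF A hA B hB
      rw [hsum A, hsum B] at this
      exact this)
  rw [card_image_of_injective _ hφinj] at hstep
  have e1 : Fintype.card {i // i ∈ G₁} = #G₁ := Fintype.card_coe _
  have e2 : Fintype.card {i // i ∈ G₂} = #G₂ := Fintype.card_coe _
  have e3 : Fintype.card {i // i ∉ G₁ ∪ G₂} = n - #G₁ - #G₂ := by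
    rw [Fintype.card_subtype_compl, Fintype.card_coe, Fintype.card_fin, card_union_of_disjoint hG]
    omega
  rw [e1, e2, e3] at hstep
  exact hstep

lemma numA {n a b f M K k : ℕ} (hn : 1 ≤ n) (hab : a + b ≤ n) (ha : n ≤ K * a) (hb : k ≤ K * b)
    (hM : 1 ≤ M) (hK : 1 ≤ K) (hk : 4 * M ^ 4 * K ^ 2 ≤ k)
    (hf : f ≤ M ^ 2 * 2 ^ (n - a - b) * b.choose (b / 2) * a.choose (a / 2)) :
    f ≤ n.choose (n / 2) := by
  have hprod : 4 * M ^ 4 * n ≤ a * b := by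
    have : K ^ 2 * (4 * M ^ 4 * n) ≤ K ^ 2 * (a * b) := by
      calc K ^ 2 * (4 * M ^ 4 * n) = (4 * M ^ 4 * K ^ 2) * n := by ring
        _ ≤ k * n := by gcongr
        _ ≤ (K * b) * (K * a) := Nat.mul_le_mul hb ha
        _ = _ := by ring
    exact Nat.le_of_mul_le_mul_left this (by positivity)
  have hpow : (2 ^ (n - a - b)) ^ 2 * (4 ^ b * 4 ^ a) = 4 ^ n := by
    rw [← pow_mul, mul_comm _ 2, pow_mul, ← pow_add, show (2:ℕ) ^ 2 = 4 by norm_num, ← pow_add]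
    congr 1; omega
  have hsq : 4 * M ^ 4 * n * f ^ 2 ≤ 4 * M ^ 4 * n * (n.choose (n / 2)) ^ 2 := by
    calc 4 * M ^ 4 * n * f ^ 2 ≤ (a * b) *
          (M ^ 2 * 2 ^ (n - a - b) * b.choose (b / 2) * a.choose (a / 2)) ^ 2 := by gcongr
      _ = M ^ 4 * ((2 ^ (n - a - b)) ^ 2 *
          ((b * (b.choose (b / 2)) ^ 2) * (a * (a.choose (a / 2)) ^ 2))) := by ring
      _ ≤ M ^ 4 * ((2 ^ (n - a - b)) ^ 2 * (4 ^ b * 4 ^ a)) := by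
          have := mid_upper a
          have := mid_upper b
          gcongr
      _ = M ^ 4 * 4 ^ n := by rw [hpow]
      _ ≤ M ^ 4 * (4 * n * (n.choose (n / 2)) ^ 2) := by
          have := mid_lower n hn
          gcongr
      _ = _ := by ring
  have := Nat.le_of_mul_le_mul_left hsq (by positivity)
  exact (Nat.pow_le_pow_iff_left (by norm_num)).1 this

lemma upper [FiniteDimensional ℝ E] (Δ : ℝ) (hΔ : 0 ≤ Δ) (s : ℕ) (hs : 1 ≤ s)
    (h : Δ < Real.sqrt (((s:ℝ) - 1) ^ 2 + 1)) :
    ∃ N : ℕ, ∀ n ≥ N, ∀ v : Fin n → E, (∀ i, 1 ≤ ‖v i‖) → ∀ F : Finset (Finset (Fin n)),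
      (∀ A ∈ F, ∀ B ∈ F, ‖∑ i ∈ A, v i - ∑ i ∈ B, v i‖ ≤ Δ) → #F ≤ S n s := by
  classical
  set R := Real.sqrt (((s:ℝ) - 1) ^ 2 + 1) with hR
  have hR0 : 0 < R := lt_of_le_of_lt hΔ h
  obtain ⟨ε, h0, hε, hεΔ⟩ : ∃ ε : ℝ, 0 < ε ∧ ε < 1 ∧ Δ < (1 - ε) * R := by
    refine ⟨(1 - Δ / R) / 2, ?_, ?_, ?_⟩
    · have : Δ / R < 1 := (div_lt_one hR0).2 h
      linarith
    · have : 0 ≤ Δ / R := by positivity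
      linarith
    · have : (1 - (1 - Δ / R) / 2) * R = (R + Δ) / 2 := by field_simp; ring
      rw [this]; linarith
  obtain ⟨U, hU1, hU⟩ := exists_net (E := E) (ε / 8) (by linarith)
  obtain ⟨M, hM⟩ := exists_nat_gt (4 * Δ / ε)
  have hM1 : 1 ≤ M := by
    have : (0:ℝ) < M := lt_of_le_of_lt (by positivity) hM
    exact_mod_cast this
  set K := #U
  set k₀ := 4 * M ^ 4 * K ^ 2 with hk₀
  have hev := fun k => Filter.eventually_atTop.1 (asym k s hs)
  choose Nk hNk using hev
  refine ⟨s + k₀ + ∑ k ∈ range (k₀ + 1), Nk k, ?_⟩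
  intro n hn v hv1 F hF
  have hsn : s ≤ n := by omega
  choose c hcU hcN using fun i => hU (v i) (hv1 i)
  have hUne : U.Nonempty := ⟨c ⟨0, by omega⟩, hcU _⟩
  have hK1 : 1 ≤ K := card_pos.2 hUne
  obtain ⟨u₁, hu₁, hG1⟩ := pigeon univ U c hUne hcU
  rw [card_univ, Fintype.card_fin] at hG1
  set G₁ := univ.filter fun i => c i = u₁ with hG₁
  set bad := univ.filter fun i => ¬ Near u₁ ε (v i) ∧ ¬ Near u₁ ε (- v i) with hbad
  by_cases hb : #bad ≤ k₀
  · apply caseB u₁ (hU1 u₁ hu₁) ε Δ h0 hε s hs hsn hεΔ v hv1 bad _ _ F hF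
    · intro i hi
      simp only [hbad, mem_filter, mem_univ, true_and] at hi
      tauto
    · have h1 : Nk #bad ≤ ∑ k ∈ range (k₀ + 1), Nk k :=
        single_le_sum (fun _ _ => Nat.zero_le _) (mem_range.2 (by omega))
      have h2 := hNk #bad (n - #bad) (by omega)
      rw [Nat.sub_add_cancel (by omega)] at h2
      exact h2
  · push Not at hb
    obtain ⟨u₂, hu₂, hG2⟩ := pigeon bad U c hUne hcU
    set G₂ := bad.filter fun i => c i = u₂ with hG₂
    have hG2ne : G₂.Nonempty := by
      rw [← card_pos]
      by_contra hc
      have : #G₂ = 0 := by omega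
      rw [this] at hG2
      omega
    have hdisj : Disjoint G₁ G₂ := by
      rw [Finset.disjoint_left]
      intro i hi1 hi2
      simp only [hG₁, hG₂, hbad, mem_filter, mem_univ, true_and] at hi1 hi2
      apply hi2.1.1
      have := hcN i
      rw [hi1] at this
      unfold Near at *
      have := norm_nonneg (v i)
      nlinarith
    obtain ⟨i, hi⟩ := hG2ne
    simp only [hG₂, hbad, mem_filter, mem_univ, true_and] at hi
    obtain ⟨⟨hi1, hi2⟩, hi3⟩ := hi
    have hi4 := hcN i
    rw [hi3] at hi4
    have hvi := hv1 i
    have hvi0 : 0 < ‖v i‖ := by linarith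
    unfold Near at hi1 hi2 hi4
    rw [norm_neg] at hi2
    push Not at hi1 hi2
    have hsep1 : 7 / 8 * ε ≤ ‖u₂ - u₁‖ := by
      have e : v i - ‖v i‖ • u₁ = (v i - ‖v i‖ • u₂) + ‖v i‖ • (u₂ - u₁) := by
        rw [smul_sub]; abel
      have := norm_add_le (v i - ‖v i‖ • u₂) (‖v i‖ • (u₂ - u₁))
      rw [← e, norm_smul, norm_norm] at this
      have : ‖v i‖ * (7 / 8 * ε) ≤ ‖v i‖ * ‖u₂ - u₁‖ := by linarith
      exact le_of_mul_le_mul_left this hvi0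
    have hsep2 : 7 / 8 * ε ≤ ‖u₂ + u₁‖ := by
      have e : - v i - ‖v i‖ • u₁ = -((v i - ‖v i‖ • u₂) + ‖v i‖ • (u₂ + u₁)) := by
        rw [smul_add]; abel
      have := norm_add_le (v i - ‖v i‖ • u₂) (‖v i‖ • (u₂ + u₁))
      rw [← norm_neg (v i - ‖v i‖ • u₂ + ‖v i‖ • (u₂ + u₁)), ← e, norm_smul, norm_norm] at this
      have : ‖v i‖ * (7 / 8 * ε) ≤ ‖v i‖ * ‖u₂ + u₁‖ := by linarith
      exact le_of_mul_le_mul_left this hvi0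
    have hA := caseA u₁ u₂ (hU1 u₁ hu₁) (hU1 u₂ hu₂) ε Δ h0 hsep1 hsep2 M hM v hv1 G₁ G₂ hdisj
      (by intro j hj; have := hcN j; rw [hG₁, mem_filter] at hj; rwa [hj.2] at this)
      (by intro j hj; have := hcN j; rw [hG₂, mem_filter] at hj; rwa [hj.2] at this) F hF
    refine le_trans ?_ (S_ge_mid hs hsn)
    refine numA (by omega) ?_ hG1 (hb.le.trans hG2) hM1 hK1 le_rfl hA
    have := card_le_univ (G₁ ∪ G₂)
    rw [card_union_of_disjoint hdisj, Fintype.card_fin] at this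
    exact this

/-- support of a sign pattern -/
def sup {n : ℕ} (ω : Fin n → Bool) : Finset (Fin n) := univ.filter fun i => ω i = true

open Classical in
lemma prob {n : ℕ} (P : Set (Fin n → Bool)) (Q : Finset (Fin n) → Prop)
    (h : ∀ ω, ω ∈ P ↔ Q (sup ω)) :
    ((PMF.uniformOfFintype (Fin n → Bool)).toMeasure P).toReal
      = (2:ℝ) ^ (-(n:ℝ)) * (#(univ.filter Q) : ℝ) := by
  rw [PMF.toMeasure_uniformOfFintype_apply P P.toFinite.measurableSet]
  have hc : Fintype.card P = #(univ.filter Q) := by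
    rw [← Set.toFinset_card]
    apply card_nbij' (fun ω => sup ω) (fun A i => decide (i ∈ A))
    · intro ω hω
      have := (h ω).1 (by simpa using hω)
      simpa using this
    · intro A hA
      have e : sup (fun i => decide (i ∈ A)) = A := by ext i; simp [sup]
      have : Q A := by simpa using hA
      simp only [Set.coe_toFinset]
      rw [h, e]; exact this
    · intro ω _; funext i; simp [sup]
    · intro A _; ext i; simp [sup]
  rw [hc, ENNReal.toReal_div, Real.rpow_neg (by norm_num), Real.rpow_natCast]
  simp [div_eq_inv_mul]

lemma sum_sign {n : ℕ} (v : Fin n → E) (ω : Fin n → Bool) :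
    ∑ j, (if ω j then (1 : ℝ) else -1) • v j = (2:ℝ) • ∑ j ∈ sup ω, v j - ∑ j, v j := by
  rw [sup, sum_filter, smul_sum, ← sum_sub_distrib]
  apply sum_congr rfl
  intro i _
  by_cases hi : ω i = true
  · simp [hi, two_smul]
  · simp [hi]

end FF

theorem frankl_furedi_conjecture (d : ℕ) (hd : 1 ≤ d) (Δ : ℝ) (s : ℕ)
    (hs : s = ⌊Δ⌋₊ + 1) (h1 : (s : ℝ) - 1 ≤ Δ)
    (h2 : Δ < Real.sqrt (((s : ℝ) - 1) ^ 2 + 1)) :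
    ∃ N : ℕ, ∀ n ≥ N,
      (∀ (v : Fin n → EuclideanSpace ℝ (Fin d)), (∀ i, 1 ≤ ‖v i‖) →
        ∀ x : EuclideanSpace ℝ (Fin d),
        (((PMF.uniformOfFintype (Fin n → Bool)).toMeasure
            {ω | (∑ j, (if ω j then (1 : ℝ) else -1) • v j) ∈ Metric.closedBall x Δ}).toReal)
          ≤ (2 : ℝ) ^ (-(n : ℝ)) * (S n s : ℝ)) ∧
      (∃ (v : Fin n → EuclideanSpace ℝ (Fin d)), (∀ i, 1 ≤ ‖v i‖) ∧
        ∃ x : EuclideanSpace ℝ (Fin d),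
        (((PMF.uniformOfFintype (Fin n → Bool)).toMeasure
            {ω | (∑ j, (if ω j then (1 : ℝ) else -1) • v j) ∈ Metric.closedBall x Δ}).toReal)
          = (2 : ℝ) ^ (-(n : ℝ)) * (S n s : ℝ)) := by
  classical
  have hs1 : 1 ≤ s := by omega
  have hs1' : (1:ℝ) ≤ s := by exact_mod_cast hs1
  have hΔ0 : 0 ≤ Δ := by linarith
  obtain ⟨N, hN⟩ := FF.upper (E := EuclideanSpace ℝ (Fin d)) Δ hΔ0 s hs1 h2
  refine ⟨N + s, fun n hn => ⟨?_, ?_⟩⟩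
  · intro v hv x
    rw [FF.prob _ (fun A => ‖((2:ℝ) • ∑ j ∈ A, v j - ∑ j, v j) - x‖ ≤ Δ) (by
      intro ω
      rw [Set.mem_setOf_eq, FF.sum_sign, mem_closedBall_iff_norm])]
    apply mul_le_mul_of_nonneg_left _ (by positivity)
    have := hN n (by omega) v hv (Finset.univ.filter
      (fun A => ‖((2:ℝ) • ∑ j ∈ A, v j - ∑ j, v j) - x‖ ≤ Δ)) (by
      intro A hA B hB
      have hA := (Finset.mem_filter.1 hA).2
      have hB := (Finset.mem_filter.1 hB).2
      have h3 := norm_sub_le (((2:ℝ) • ∑ j ∈ A, v j - ∑ j, v j) - x)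
        (((2:ℝ) • ∑ j ∈ B, v j - ∑ j, v j) - x)
      rw [sub_sub_sub_cancel_right, sub_sub_sub_cancel_right, ← smul_sub, norm_smul] at h3
      norm_num at h3
      linarith)
    exact_mod_cast this
  · have hsn : s ≤ n := by omega
    set e : EuclideanSpace ℝ (Fin d) := EuclideanSpace.single ⟨0, hd⟩ 1 with he
    have hen : ‖e‖ = 1 := by simp [he]
    refine ⟨fun _ => e, fun _ => hen.ge, ((2 * FF.aa n s + s - 1 - n : ℝ)) • e, ?_⟩
    rw [FF.prob _ (fun A => A.card ∈ FF.blk n s) ?_]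
    · congr 2
      rw [FF.S_eq hs1 hsn]
      rw [Finset.card_eq_sum_card_fiberwise (t := FF.blk n s) (f := Finset.card)]
      · apply Finset.sum_congr rfl
        intro k hk
        have h5 : n.choose k = (Finset.powersetCard k (Finset.univ : Finset (Fin n))).card := by simp
        rw [h5]; congr 1
        ext A
        simp only [Finset.mem_filter, Finset.mem_univ, true_and, Finset.mem_powersetCard,
          Finset.subset_univ]
        constructor
        · exact fun h => h.2
        · intro h; exact ⟨h ▸ hk, h⟩
      · intro A hA
        simpa using hA
    · intro ω
      rw [Set.mem_setOf_eq, FF.sum_sign, mem_closedBall_iff_norm]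
      set A := FF.sup ω
      have e1 : (2:ℝ) • ∑ j ∈ A, e - ∑ j : Fin n, e - ((2 * FF.aa n s + s - 1 - n : ℝ)) • e
          = (2 * ((A.card : ℝ) - FF.aa n s) - (s - 1)) • e := by
        simp only [Finset.sum_const, Finset.card_univ, Fintype.card_fin]
        simp only [← Nat.cast_smul_eq_nsmul ℝ]
        module
      rw [e1, norm_smul, hen, mul_one, Real.norm_eq_abs, FF.blk, Finset.mem_Ico]
      have hΔs : Δ < s := by
        rw [hs]; push_cast; exact Nat.lt_floor_add_one Δ
      constructor
      · intro h
        rw [abs_le] at h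
        constructor
        · by_contra hc
          have : (A.card : ℝ) + 1 ≤ FF.aa n s := by exact_mod_cast (by omega : A.card + 1 ≤ FF.aa n s)
          linarith
        · by_contra hc
          have : (FF.aa n s : ℝ) + s ≤ A.card := by exact_mod_cast (by omega : FF.aa n s + s ≤ A.card)
          linarith
      · rintro ⟨g1, g2⟩
        have k1 : (FF.aa n s : ℝ) ≤ A.card := by exact_mod_cast g1
        have k2 : (A.card : ℝ) + 1 ≤ FF.aa n s + s := by exact_mod_cast g2
        rw [abs_le]
        constructor <;> linarith
end
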